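/- arXiv:1401.1335 — 5 statements merged into one kernel-verified Lean document; each statement's English description precedes it below -/
import Mathlib

section
/- Let G be a finite group, let p be a prime divisor of |G| with gcd(|G|, p-1) = 1, and let P be a Sylow p-subgroup of G. If every maximal subgroup of P either is S-quasinormal in G or has a p-nilpotent supplement in G, then G is p-nilpotent. -/
open scoped Pointwise

/-- A group `G` is `p`-nilpotent if it has a normal `p`-complement, i.e. a normal
subgroup `N` whose order is not divisible by `p` and whose index is a power of `p`. -/
def IsPNilpotent (p : ℕ) (G : Type*) [Group G] : Prop :=
  ∃ N : Subgroup G, N.Normal ∧ ¬ p ∣ Nat.card N ∧ ∃ k : ℕ, N.index = p ^ k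

/-- A subgroup `H` of `G` is c-normal in `G` if there is a normal subgroup `T`
with `G = HT` and `H ⊓ T` contained in the normal core of `H`. -/
def Subgroup.IsCNormal {G : Type*} [Group G] (H : Subgroup G) : Prop :=
  ∃ T : Subgroup G, T.Normal ∧ (H : Set G) * (T : Set G) = Set.univ ∧ H ⊓ T ≤ H.normalCore

/-- A subgroup `H` of `G` is S-quasinormal in `G` if it permutes with every Sylow
subgroup of `G`. -/
def Subgroup.IsSQuasinormal {G : Type*} [Group G] (H : Subgroup G) : Prop :=
  ∀ q : ℕ, q.Prime → ∀ Q : Sylow q G,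
    (H : Set G) * ((Q : Subgroup G) : Set G) = ((Q : Subgroup G) : Set G) * (H : Set G)

/-- A subgroup `H` of `G` has a `p`-nilpotent supplement in `G` if there is a
subgroup `K` with `G = HK` and `K` `p`-nilpotent. -/
def HasPNilpotentSupplement (p : ℕ) {G : Type*} [Group G] (H : Subgroup G) : Prop :=
  ∃ K : Subgroup G, (H : Set G) * (K : Set G) = Set.univ ∧ IsPNilpotent p K

/-- `M` is a maximal (proper) subgroup of `P`. -/
def IsMaximalSubgroupOf {G : Type*} [Group G] (M P : Subgroup G) : Prop :=
  M < P ∧ ∀ K : Subgroup G, M < K → K ≤ P → K = P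

/-- `P` is a Sylow `p`-subgroup of the subgroup `E`: a maximal `p`-subgroup of `E`. -/
def IsSylowSubgroupOf (p : ℕ) {G : Type*} [Group G] (P E : Subgroup G) : Prop :=
  P ≤ E ∧ IsPGroup p P ∧ ∀ Q : Subgroup G, Q ≤ E → IsPGroup p Q → P ≤ Q → Q = P

/-- A group is supersolvable if it has a chain of subgroups from `⊥` to `⊤`,
each normal in `G`, in which each successive quotient is cyclic (i.e. each step
is generated by the previous one together with a single element). -/
def IsSupersolvable (G : Type*) [Group G] : Prop :=
  ∃ (n : ℕ) (c : ℕ → Subgroup G), c 0 = ⊥ ∧ c n = ⊤ ∧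
    (∀ i, c i ≤ c (i + 1)) ∧ (∀ i, (c i).Normal) ∧
    ∀ i, ∃ x ∈ c (i + 1), c i ⊔ Subgroup.zpowers x = c (i + 1)


namespace PNil

open MulAction

/-- Transfer evaluation when the hom is invariant under fusion of powers of `g`. -/
lemma transfer_eq {G A : Type*} [Group G] [CommGroup A] (H : Subgroup G) [H.FiniteIndex]
    (φ : H →* A) (g : H)
    (key : ∀ (k : ℕ) (g₀ : G) (hk : g₀⁻¹ * (g : G) ^ k * g₀ ∈ H),
      φ ⟨g₀⁻¹ * (g : G) ^ k * g₀, hk⟩ = φ g ^ k) :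
    MonoidHom.transfer φ (g : G) = φ g ^ H.index := by
  classical
  let := H.fintypeQuotientOfFiniteIndex
  rw [MonoidHom.transfer_eq_prod_quotient_orbitRel_zpowers_quot,
    Subgroup.index_eq_sum_minimalPeriod H (g : G), ← Finset.prod_pow_eq_pow_sum]
  exact Finset.prod_congr rfl fun q _ => key _ _ _

lemma transfer_mul {G A : Type*} [Group G] [CommGroup A] (H : Subgroup G) [H.FiniteIndex]
    (φ ψ : H →* A) (g : G) :
    MonoidHom.transfer (φ * ψ) g = MonoidHom.transfer φ g * MonoidHom.transfer ψ g := by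
  classical
  let := H.fintypeQuotientOfFiniteIndex
  rw [MonoidHom.transfer_eq_prod_quotient_orbitRel_zpowers_quot,
    MonoidHom.transfer_eq_prod_quotient_orbitRel_zpowers_quot,
    MonoidHom.transfer_eq_prod_quotient_orbitRel_zpowers_quot, ← Finset.prod_mul_distrib]
  rfl

lemma index_pow {G : Type*} [Group G] [Finite G] {p : ℕ} [Fact p.Prime] (A B : Subgroup G)
    (hA : IsPGroup p A) (h : (A : Set G) * (B : Set G) = Set.univ) : ∃ n, B.index = p ^ n := by
  obtain ⟨n, hn⟩ := hA.card_orbit ((1 : G) : G ⧸ B)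
  refine ⟨n, ?_⟩
  rw [← hn, Subgroup.index]
  have : orbit A ((1 : G) : G ⧸ B) = Set.univ := by
    ext x
    simp only [Set.mem_univ, iff_true]
    induction x using QuotientGroup.induction_on with
    | H z =>
      have hz : z ∈ (A : Set G) * (B : Set G) := h ▸ Set.mem_univ z
      obtain ⟨a, ha, b, hb, rfl⟩ := Set.mem_mul.1 hz
      refine ⟨⟨a, ha⟩, ?_⟩
      change ((a * 1 : G) : G ⧸ B) = _
      rw [QuotientGroup.eq]
      simpa using hb
  rw [this, Nat.card_univ]

lemma le_of_perm {G : Type*} [Group G] [Finite G] {p : ℕ} [Fact p.Prime] (M : Subgroup G)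
    (hM : IsPGroup p M) (R : Sylow p G)
    (h : (M : Set G) * ((R : Subgroup G) : Set G) = ((R : Subgroup G) : Set G) * (M : Set G)) :
    M ≤ R := by
  let L : Subgroup G :=
    { carrier := (M : Set G) * ((R : Subgroup G) : Set G)
      one_mem' := Set.mem_mul.2 ⟨1, M.one_mem, 1, R.one_mem, by simp⟩
      mul_mem' := by
        rintro _ _ ⟨a, ha, b, hb, rfl⟩ ⟨c, hc, d, hd, rfl⟩
        have : b * c ∈ (M : Set G) * ((R : Subgroup G) : Set G) := by
          rw [h]; exact Set.mul_mem_mul hb hc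
        obtain ⟨e, he, f, hf, hef⟩ := Set.mem_mul.1 this
        refine Set.mem_mul.2 ⟨a * e, M.mul_mem ha he, f * d, R.mul_mem hf hd, ?_⟩
        simp only
        rw [mul_assoc, ← mul_assoc e, hef]; group
      inv_mem' := by
        rintro _ ⟨a, ha, b, hb, rfl⟩
        simp only
        rw [h]
        exact Set.mem_mul.2 ⟨b⁻¹, R.inv_mem hb, a⁻¹, M.inv_mem ha, by simp⟩ }
  have hML : M ≤ L := fun m hm => Set.mem_mul.2 ⟨m, hm, 1, R.one_mem, by simp⟩
  have hRL : (R : Subgroup G) ≤ L := fun m hm => Set.mem_mul.2 ⟨1, M.one_mem, m, hm, by simp⟩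
  obtain ⟨n, hn⟩ := index_pow (p := p) (M.subgroupOf L) ((R : Subgroup G).subgroupOf L)
    (hM.comap_of_injective _ L.subtype_injective) (by
      ext ⟨x, hx⟩
      simp only [Set.mem_univ, iff_true]
      obtain ⟨a, ha, b, hb, hab⟩ := Set.mem_mul.1 hx
      exact Set.mem_mul.2 ⟨⟨a, hML ha⟩, ha, ⟨b, hRL hb⟩, hb, Subtype.ext hab⟩)
  have h1 : ((R : Subgroup G).relIndex L) ∣ (R : Subgroup G).index :=
    Subgroup.relIndex_dvd_index_of_le hRL
  have h2 : ¬ p ∣ (R : Subgroup G).index := R.not_dvd_index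
  have h3 : (R : Subgroup G).relIndex L = p ^ n := hn
  have h4 : n = 0 := by
    by_contra h0
    exact h2 (((dvd_pow_self p h0).trans (dvd_of_eq h3.symm)).trans h1)
  rw [h4, pow_zero, Subgroup.relIndex_eq_one] at h3
  exact hML.trans h3

lemma normal_of_sq {G : Type*} [Group G] [Finite G] {p : ℕ} [Fact p.Prime] (M : Subgroup G)
    (P : Sylow p G) (hMP : M ≤ P) (hn : ∀ x ∈ P, ∀ m ∈ M, x * m * x⁻¹ ∈ M)
    (h : M.IsSQuasinormal) : M.Normal := by
  have hp : p.Prime := Fact.out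
  have hMp : IsPGroup p M := P.isPGroup'.to_le hMP
  have hMR : ∀ R : Sylow p G, M ≤ R := fun R => le_of_perm M hMp R (h p hp R)
  have hconj : ∀ g : G, ∀ m ∈ M, ∀ R : Sylow p G, g * m * g⁻¹ ∈ R := by
    intro g m hm R
    have := hMR (g⁻¹ • R) hm
    have h2 : m ∈ ((g⁻¹ • R : Sylow p G) : Subgroup G) := this
    rw [Sylow.coe_subgroup_smul, Subgroup.mem_pointwise_smul_iff_inv_smul_mem] at h2
    have h3 : g * m * g⁻¹ ∈ (R : Subgroup G) := by simpa [MulAut.smul_def] using h2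
    exact h3
  have aux : ∀ q : ℕ, q.Prime → q ≠ p → ∀ Q : Sylow q G, ∀ x ∈ Q, ∀ m ∈ M,
      x * m * x⁻¹ ∈ M := by
    intro q hq hqp Q x hx m hm
    have : Fact q.Prime := ⟨hq⟩
    have h1 : x * m ∈ (M : Set G) * ((Q : Subgroup G) : Set G) := by
      rw [h q hq Q]; exact Set.mul_mem_mul hx hm
    obtain ⟨m', hm', y, hy, hxy⟩ := Set.mem_mul.1 h1
    have e : y * x⁻¹ = m'⁻¹ * (x * m * x⁻¹) := by
      have hxy' : m' * y = x * m := hxy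
      rw [← hxy']; group
    have hQ : y * x⁻¹ ∈ Q := Q.mul_mem hy (Q.inv_mem hx)
    have hP : y * x⁻¹ ∈ P := by
      rw [e]; exact P.mul_mem (P.inv_mem (hMP hm')) (hconj x m hm P)
    have hd := IsPGroup.disjoint_of_ne q p hqp (Q : Subgroup G) (P : Subgroup G)
      Q.isPGroup' P.isPGroup'
    have h1 : y * x⁻¹ = 1 := Subgroup.disjoint_def.1 hd hQ hP
    rw [h1] at e
    have : x * m * x⁻¹ = m' := by
      rw [← mul_one m', e]; group
    rw [this]; exact hm'
  have norm_of : ∀ L : Subgroup G, (∀ x ∈ L, ∀ m ∈ M, x * m * x⁻¹ ∈ M) →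
      L ≤ Subgroup.normalizer (M : Set G) := by
    intro L hL x hx
    rw [Subgroup.mem_normalizer_iff]
    intro m
    refine ⟨fun hm => hL x hx m hm, fun hm => ?_⟩
    have := hL x⁻¹ (L.inv_mem hx) _ hm
    simpa [mul_assoc] using this
  rw [← Subgroup.normalizer_eq_top_iff, ← Subgroup.index_eq_one]
  by_contra hne
  obtain ⟨q, hq, hqd⟩ := Nat.exists_prime_and_dvd hne
  have : Fact q.Prime := ⟨hq⟩
  have : ∃ Q : Sylow q G, (Q : Subgroup G) ≤ Subgroup.normalizer (M : Set G) := by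
    by_cases hqp : q = p
    · subst hqp
      exact ⟨P, norm_of _ hn⟩
    · exact ⟨default, norm_of _ (aux q hq hqp default)⟩
  obtain ⟨Q, hQ⟩ := this
  exact Q.not_dvd_index (hqd.trans (Subgroup.index_dvd_of_le hQ))

end PNil

namespace PNil

lemma exists_pow_of_ne {p : ℕ} [Fact p.Prime] (c d : Multiplicative (ZMod p)) (hc : c ≠ 1) :
    ∃ a : ℕ, d = c ^ a := by
  have h : d ∈ Submonoid.powers c :=
    mem_powers_of_prime_card (p := p) (by simp) hc
  obtain ⟨a, ha⟩ := h
  exact ⟨a, ha.symm⟩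

lemma orderOf_c {p : ℕ} [Fact p.Prime] (c : Multiplicative (ZMod p)) (hc : c ≠ 1) :
    orderOf c = p := by
  have h : orderOf c ∣ p := by
    have := orderOf_dvd_natCard c
    simpa using this
  rcases (Nat.dvd_prime Fact.out).1 h with h | h
  · exact absurd (orderOf_eq_one_iff.1 h) hc
  · exact h

lemma fusion {G : Type*} [Group G] [Finite G] {p : ℕ} [Fact p.Prime]
    (hgcd : Nat.gcd (Nat.card G) (p - 1) = 1) (P : Subgroup G)
    (φ : P →* Multiplicative (ZMod p))
    (hn : ∀ (g x : G) (hx : x ∈ P), φ ⟨x, hx⟩ = 1 → ∃ h : g⁻¹ * x * g ∈ P, φ ⟨_, h⟩ = 1)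
    (x : P) (g : G) (h : g⁻¹ * x * g ∈ P) : φ ⟨g⁻¹ * x * g, h⟩ = φ x := by
  by_cases hx : φ x = 1
  · obtain ⟨h', e⟩ := hn g x x.2 hx
    rw [hx, e]
  obtain ⟨b, hb⟩ := exists_pow_of_ne (φ x) (φ ⟨g⁻¹ * x * g, h⟩) hx
  have step : ∀ z : P, ∃ hz : g⁻¹ * z * g ∈ P, φ ⟨g⁻¹ * z * g, hz⟩ = φ z ^ b := by
    intro z
    obtain ⟨a, ha⟩ := exists_pow_of_ne (φ x) (φ z) hx
    have hm : φ ((x ^ a)⁻¹ * z) = 1 := by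
      rw [map_mul, map_inv, map_pow, ha, inv_mul_cancel]
    obtain ⟨hm1, hm2⟩ := hn g _ ((x ^ a)⁻¹ * z).2 hm
    have e : g⁻¹ * (z : G) * g
        = (g⁻¹ * x * g) ^ a * (g⁻¹ * ((x ^ a)⁻¹ * z : P) * g) := by
      have := conj_pow (i := a) (a := g⁻¹) (b := (x : G))
      rw [inv_inv] at this
      rw [this]
      push_cast
      group
    have hz : g⁻¹ * (z : G) * g ∈ P := by
      rw [e]; exact P.mul_mem (P.pow_mem h a) hm1
    refine ⟨hz, ?_⟩
    have e2 : (⟨g⁻¹ * (z : G) * g, hz⟩ : P)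
        = ⟨g⁻¹ * x * g, h⟩ ^ a * ⟨g⁻¹ * ((x ^ a)⁻¹ * z : P) * g, hm1⟩ := Subtype.ext e
    rw [e2, map_mul, hm2, mul_one, map_pow, hb, ha, ← pow_mul, ← pow_mul, mul_comm]
  have iter : ∀ n : ℕ, ∃ hz : (g ^ n)⁻¹ * (x : G) * g ^ n ∈ P,
      φ ⟨(g ^ n)⁻¹ * x * g ^ n, hz⟩ = φ x ^ (b ^ n) := by
    intro n
    induction n with
    | zero => exact ⟨by simp, by simp⟩
    | succ n ih =>
      obtain ⟨h1, h2⟩ := ih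
      obtain ⟨h3, h4⟩ := step ⟨_, h1⟩
      have e : (g ^ (n + 1))⁻¹ * (x : G) * g ^ (n + 1)
          = g⁻¹ * ((g ^ n)⁻¹ * (x : G) * g ^ n) * g := by
        rw [pow_succ]; group
      refine ⟨by rw [e]; exact h3, ?_⟩
      rw [h2, ← pow_mul, ← pow_succ] at h4
      rw [← h4]
      congr 1
      exact Subtype.ext e
  obtain ⟨h1, h2⟩ := iter (Nat.card G)
  have h3 : φ x ^ (b ^ Nat.card G) = φ x ^ 1 := by
    rw [← h2, pow_one]
    congr 1
    ext
    simp
  rw [pow_eq_pow_iff_modEq, orderOf_c _ hx, ← ZMod.natCast_eq_natCast_iff] at h3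
  push_cast at h3
  have hb0 : (b : ZMod p) ≠ 0 := by
    intro h0
    rw [h0, zero_pow Nat.card_pos.ne'] at h3
    exact zero_ne_one h3
  have h4 := ZMod.pow_card_sub_one_eq_one hb0
  have h5 : (b : ZMod p) = 1 := by
    have := orderOf_dvd_of_pow_eq_one h3
    have h6 := Nat.dvd_gcd this (orderOf_dvd_of_pow_eq_one h4)
    rw [hgcd, Nat.dvd_one, orderOf_eq_one_iff] at h6
    exact h6
  have h6 : b ≡ 1 [MOD p] := by
    rw [← ZMod.natCast_eq_natCast_iff]; simpa using h5
  rw [hb]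
  nth_rw 2 [← pow_one (φ x)]
  rw [pow_eq_pow_iff_modEq, orderOf_c _ hx]
  exact h6

/-- maximal subgroup attached to a nontrivial hom -/
lemma max_of_hom {G : Type*} [Group G] {p : ℕ} [Fact p.Prime] (P : Subgroup G)
    (φ : P →* Multiplicative (ZMod p)) (hφ : φ ≠ 1) :
    IsMaximalSubgroupOf (φ.ker.map P.subtype) P := by
  refine ⟨lt_of_le_of_ne (Subgroup.map_subtype_le _) ?_, ?_⟩
  · intro e
    apply hφ
    ext1 x
    have : (x : G) ∈ φ.ker.map P.subtype := by rw [e]; exact x.2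
    obtain ⟨y, hy, hyx⟩ := this
    have : y = x := Subtype.ext hyx
    subst this
    exact hy
  · intro K hMK hKP
    obtain ⟨x, hxK, hxM⟩ := Set.exists_of_ssubset hMK
    have hx : φ ⟨x, hKP hxK⟩ ≠ 1 := fun h => hxM ⟨⟨x, hKP hxK⟩, h, rfl⟩
    refine le_antisymm hKP fun z hz => ?_
    obtain ⟨a, ha⟩ := exists_pow_of_ne _ (φ ⟨z, hz⟩) hx
    have hm : φ ((⟨x, hKP hxK⟩ ^ a)⁻¹ * ⟨z, hz⟩) = 1 := by
      rw [map_mul, map_inv, map_pow, ha, inv_mul_cancel]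
    have h1 : (x ^ a)⁻¹ * z ∈ K := hMK.le ⟨_, hm, rfl⟩
    have := K.mul_mem (K.pow_mem hxK a) h1
    simpa using this

lemma transfer_ne_of_normal {G : Type*} [Group G] [Finite G] {p : ℕ} [Fact p.Prime]
    (hgcd : Nat.gcd (Nat.card G) (p - 1) = 1) (P : Sylow p G)
    (φ : (P : Subgroup G) →* Multiplicative (ZMod p)) (u : (P : Subgroup G)) (hu : φ u ≠ 1)
    (hN : (φ.ker.map (P : Subgroup G).subtype).Normal) :
    MonoidHom.transfer φ (u : G) ≠ 1 := by
  rw [transfer_eq]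
  · intro h
    have := orderOf_dvd_of_pow_eq_one h
    rw [orderOf_c _ hu] at this
    exact P.not_dvd_index this
  · intro k g₀ hk
    have := fusion hgcd (P : Subgroup G) φ (by
      intro g x hx h1
      have h2 := hN.conj_mem x ⟨⟨x, hx⟩, h1, rfl⟩ g⁻¹
      rw [inv_inv] at h2
      obtain ⟨y, hy, hyx⟩ := h2
      have hyx' : (y : G) = g⁻¹ * x * g := hyx
      refine ⟨hyx' ▸ y.2, ?_⟩
      have : y = ⟨g⁻¹ * x * g, hyx' ▸ y.2⟩ := Subtype.ext hyx'
      rw [← this]; exact hy) (u ^ k) g₀ (by simpa using hk)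
    rw [map_pow] at this
    rw [← this]
    rfl

lemma transfer_ne_of_supp {G : Type*} [Group G] [Finite G] {p : ℕ} [Fact p.Prime]
    (P : Sylow p G)
    (φ : (P : Subgroup G) →* Multiplicative (ZMod p)) (hφ : φ ≠ 1)
    (hN : HasPNilpotentSupplement p (φ.ker.map (P : Subgroup G).subtype)) :
    ∃ u : (P : Subgroup G), MonoidHom.transfer φ (u : G) ≠ 1 := by
  have hp : p.Prime := Fact.out
  obtain ⟨K, hMK, N, hNn, hNp, k, hNk⟩ := hN
  obtain ⟨u, huK, hu⟩ : ∃ u : (P : Subgroup G), (u : G) ∈ K ∧ φ u ≠ 1 := by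
    obtain ⟨x, hx⟩ : ∃ x, φ x ≠ 1 := by
      by_contra hcon
      push Not at hcon
      exact hφ (MonoidHom.ext hcon)
    have : (x : G) ∈ ((φ.ker.map (P : Subgroup G).subtype : Subgroup G) : Set G) * (K : Set G) :=
      hMK ▸ Set.mem_univ _
    obtain ⟨_, ⟨m, hm, rfl⟩, y, hy, e⟩ := Set.mem_mul.1 this
    have e' : (m : G) * y = x := e
    have e2 : ((m⁻¹ * x : (P : Subgroup G)) : G) = y := by
      push_cast; rw [← e']; group
    refine ⟨m⁻¹ * x, e2 ▸ hy, ?_⟩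
    have hm' : φ m = 1 := hm
    rw [map_mul, map_inv, hm']
    simpa using hx
  obtain ⟨n, hn⟩ := index_pow (p := p) _ K
    (P.isPGroup'.to_le (Subgroup.map_subtype_le φ.ker)) hMK
  set H : Subgroup G := N.map K.subtype with hH
  have hHK : H ≤ K := Subgroup.map_subtype_le _
  have hHcard : Nat.card H = Nat.card N :=
    Nat.card_congr (N.equivMapOfInjective _ K.subtype_injective).symm.toEquiv
  have hHidx : H.index = p ^ (k + n) := by
    rw [← Subgroup.relIndex_mul_index hHK, hn, pow_add, ← hNk]
    congr 1
    rw [Subgroup.relIndex, hH]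
    congr 1
    exact Subgroup.comap_map_eq_self_of_injective K.subtype_injective N
  have hcop : (Nat.card H).Coprime (Nat.card (P : Subgroup G)) := by
    rw [hHcard]
    obtain ⟨r, hr⟩ := IsPGroup.iff_card.1 P.isPGroup'
    rw [hr]
    exact (Nat.Coprime.pow_left _ ((Nat.Prime.coprime_iff_not_dvd hp).2 hNp)).symm
  have hmul : Nat.card H * Nat.card (P : Subgroup G) = Nat.card G := by
    rw [← H.card_mul_index]
    congr 1
    apply Nat.dvd_antisymm
    · refine Nat.Coprime.dvd_of_dvd_mul_left hcop.symm ?_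
      rw [H.card_mul_index]
      exact Subgroup.card_subgroup_dvd_card _
    · have h1 : H.index ∣ Nat.card (P : Subgroup G) * (P : Subgroup G).index := by
        rw [Subgroup.card_mul_index]; exact H.index_dvd_card
      refine Nat.Coprime.dvd_of_dvd_mul_right ?_ h1
      rw [hHidx]
      exact Nat.Coprime.pow_left _ ((Nat.Prime.coprime_iff_not_dvd hp).2 P.not_dvd_index)
  have hcompl := Subgroup.isComplement'_of_coprime hmul hcop
  have hnorm : ∀ x ∈ K, ∀ h ∈ H, x * h * x⁻¹ ∈ H := by
    rintro x hx _ ⟨h, hh, rfl⟩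
    exact ⟨⟨x, hx⟩ * h * ⟨x, hx⟩⁻¹, hNn.conj_mem h hh ⟨x, hx⟩, rfl⟩
  refine ⟨u, ?_⟩
  rw [transfer_eq]
  · intro h
    have := orderOf_dvd_of_pow_eq_one h
    rw [orderOf_c _ hu] at this
    exact P.not_dvd_index this
  · intro j g₀ hk
    obtain ⟨⟨h, x⟩, hg⟩ := hcompl.2 g₀
    have hg' : (h : G) * (x : G) = g₀ := hg
    have hw : (u : G) ^ j ∈ P := P.pow_mem u.2 j
    have h1 : (h : G)⁻¹ * (u : G) ^ j * h ∈ P := by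
      have := P.mul_mem (P.mul_mem x.2 hk) (P.inv_mem x.2)
      rw [← hg'] at this
      convert! this using 1
      group
    have h2 : (h : G)⁻¹ * (u : G) ^ j * h * ((u : G) ^ j)⁻¹ ∈ P := P.mul_mem h1 (P.inv_mem hw)
    have h3 : (h : G)⁻¹ * (u : G) ^ j * h * ((u : G) ^ j)⁻¹ ∈ H := by
      have := H.mul_mem (H.inv_mem h.2) (hnorm _ (K.pow_mem huK j) h h.2)
      simpa [mul_assoc] using this
    have h4 := Subgroup.disjoint_def.1 hcompl.disjoint h3 h2
    have h5 : (h : G)⁻¹ * (u : G) ^ j * h = (u : G) ^ j := mul_inv_eq_one.1 h4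
    have h6 : g₀⁻¹ * (u : G) ^ j * g₀ = (x : G)⁻¹ * (u : G) ^ j * x := by
      rw [← hg']
      conv_rhs => rw [← h5]
      group
    have h7 : (⟨g₀⁻¹ * (u : G) ^ j * g₀, hk⟩ : (P : Subgroup G))
        = (⟨x, x.2⟩ : (P : Subgroup G))⁻¹ * u ^ j * ⟨x, x.2⟩ := Subtype.ext h6
    rw [h7, map_mul, map_mul, map_inv, map_pow, mul_comm, mul_inv_cancel_left]

lemma extend {G : Type*} [Group G] [Finite G] {p : ℕ} [Fact p.Prime]
    (hgcd : Nat.gcd (Nat.card G) (p - 1) = 1) (P : Sylow p G)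
    (h : ∀ M : Subgroup G, IsMaximalSubgroupOf M (P : Subgroup G) →
      M.IsSQuasinormal ∨ HasPNilpotentSupplement p M)
    (φ : (P : Subgroup G) →* Multiplicative (ZMod p)) :
    ∃ ψ : G →* Multiplicative (ZMod p), ∀ x : (P : Subgroup G), ψ x = φ x := by
  let A : ((P : Subgroup G) →* Multiplicative (ZMod p)) →*
      ((P : Subgroup G) →* Multiplicative (ZMod p)) :=
    MonoidHom.mk' (fun φ => (MonoidHom.transfer φ).comp (P : Subgroup G).subtype) (by
      intro a b
      ext1 x
      exact transfer_mul _ _ _ _)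
  have hinj : Function.Injective A := by
    rw [injective_iff_map_eq_one]
    intro φ hA
    by_contra hφ
    have hA' : ∀ u : (P : Subgroup G), MonoidHom.transfer φ (u : G) = 1 :=
      fun u => DFunLike.congr_fun hA u
    rcases h _ (max_of_hom _ φ hφ) with hs | hs
    · obtain ⟨x, hx⟩ : ∃ x, φ x ≠ 1 := by
        by_contra hcon
        push Not at hcon
        exact hφ (MonoidHom.ext hcon)
      refine transfer_ne_of_normal hgcd P φ x hx ?_ (hA' x)
      refine normal_of_sq _ P (Subgroup.map_subtype_le _) ?_ hs
      rintro x hx _ ⟨m, hm, rfl⟩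
      exact ⟨⟨x, hx⟩ * m * ⟨x, hx⟩⁻¹, φ.normal_ker.conj_mem m hm ⟨x, hx⟩, rfl⟩
    · obtain ⟨u, hu⟩ := transfer_ne_of_supp P φ hφ hs
      exact hu (hA' u)
  have : Finite ((P : Subgroup G) →* Multiplicative (ZMod p)) :=
    Finite.of_injective (fun f (x : ((P : Subgroup G) : Type _)) => f x)
      (fun f g hfg => MonoidHom.ext fun x => congrFun hfg x)
  obtain ⟨φ', hφ'⟩ := Finite.surjective_of_injective hinj φ
  exact ⟨MonoidHom.transfer φ', fun x => DFunLike.congr_fun hφ' x⟩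

end PNil

namespace PNil

open MulAction

lemma exists_hom {Q : Type*} [Group Q] [Finite Q] [Nontrivial Q] {p : ℕ} [Fact p.Prime]
    (hQ : IsPGroup p Q) : ∃ f : Q →* Multiplicative (ZMod p), f ≠ 1 := by
  have hp : p.Prime := Fact.out
  obtain ⟨n, hn0, hn⟩ := hQ.nontrivial_iff_card.1 inferInstance
  obtain ⟨m, rfl⟩ : ∃ m, n = m + 1 := ⟨n - 1, by omega⟩
  obtain ⟨K, hK⟩ := Sylow.exists_subgroup_card_pow_prime (G := Q) p (n := m)
    (by rw [hn]; exact pow_dvd_pow _ (Nat.le_succ m))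
  have hidx : K.index = p := by
    have := K.card_mul_index
    rw [hK, hn, pow_succ] at this
    exact Nat.eq_of_mul_eq_mul_left (pow_pos hp.pos m) this
  have hKn : K.Normal := Subgroup.normal_of_index_eq_minFac_card (by
    rw [hidx, hn, hp.pow_minFac (Nat.succ_ne_zero m)])
  have e : (Q ⧸ K) ≃* Multiplicative (ZMod p) :=
    mulEquivOfPrimeCardEq (p := p) hidx (by simp)
  refine ⟨e.toMonoidHom.comp (QuotientGroup.mk' K), fun h => ?_⟩
  have hK1 : K.index = 1 := by
    rw [Subgroup.index_eq_one, eq_top_iff]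
    intro x _
    have h1 : e (QuotientGroup.mk' K x) = 1 := DFunLike.congr_fun h x
    rw [map_eq_one_iff e e.injective] at h1
    exact (QuotientGroup.eq_one_iff x).1 h1
  rw [hidx] at hK1
  exact hp.one_lt.ne' hK1

lemma exists_inv_hom {P : Type*} [Group P] [Finite P] {p : ℕ} [Fact p.Prime]
    (hP : IsPGroup p P) (Q : Subgroup P) [Q.Normal] (hQ : Q ≠ ⊥) :
    ∃ f : Q →* Multiplicative (ZMod p), f ≠ 1 ∧
      ∀ (x : P) (q : Q), f (MulAut.conjNormal x q) = f q := by
  have hp : p.Prime := Fact.out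
  have : Nontrivial Q := (Subgroup.nontrivial_iff_ne_bot Q).2 hQ
  obtain ⟨f₀, hf₀⟩ := exists_hom (hP.to_subgroup Q)
  have : Finite (Q →* Multiplicative (ZMod p)) :=
    Finite.of_injective (fun f (x : Q) => f x)
      (fun f g hfg => MonoidHom.ext fun x => congrFun hfg x)
  let _ : MulAction P (Q →* Multiplicative (ZMod p)) :=
    { smul := fun x f => f.comp (MulAut.conjNormal x⁻¹ : MulAut Q).toMonoidHom
      one_smul := fun f => by
        ext1 q
        change f (MulAut.conjNormal (1 : P)⁻¹ q) = f q
        simp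
      mul_smul := fun x y f => by
        ext1 q
        change f (MulAut.conjNormal (x * y)⁻¹ q)
          = f (MulAut.conjNormal y⁻¹ (MulAut.conjNormal x⁻¹ q))
        rw [mul_inv_rev, map_mul]; rfl }
  have hdvd : p ∣ Nat.card (Q →* Multiplicative (ZMod p)) := by
    have h1 : f₀ ^ p = 1 := by
      ext1 q
      have : (f₀ q) ^ Nat.card (Multiplicative (ZMod p)) = 1 := pow_card_eq_one'
      simpa using this
    have h2 := orderOf_dvd_natCard f₀
    rwa [orderOf_eq_prime h1 hf₀] at h2
  obtain ⟨f, hf, hne⟩ := hP.exists_fixed_point_of_prime_dvd_card_of_fixed_point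
    (α := Q →* Multiplicative (ZMod p)) hdvd (a := 1) (fun x => rfl)
  refine ⟨f, hne.symm, fun x q => ?_⟩
  have := DFunLike.congr_fun (hf x⁻¹) q
  have h2 : f (MulAut.conjNormal (x⁻¹)⁻¹ q) = f q := this
  rwa [inv_inv] at h2

/-- The relevant special case of Tate's theorem. -/
lemma inf_eq_bot {G : Type*} [Group G] [Finite G] {p : ℕ} [Fact p.Prime] (P : Sylow p G)
    (N : Subgroup G) [N.Normal] (hNP : ∀ g : G, ∃ x ∈ P, g⁻¹ * x ∈ N)
    (hN : ∀ f : N →* Multiplicative (ZMod p), f = 1)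
    (hQ : ∀ f : (P : Subgroup G) →* Multiplicative (ZMod p), ∀ x : (P : Subgroup G),
      (x : G) ∈ N → f x = 1) :
    N.subgroupOf (P : Subgroup G) = ⊥ := by
  by_contra hne
  obtain ⟨l, hl1, hl⟩ := exists_inv_hom P.isPGroup' (N.subgroupOf (P : Subgroup G)) hne
  let E : Subgroup (G × (P : Subgroup G)) :=
    MonoidHom.eqLocus ((QuotientGroup.mk' N).comp (MonoidHom.fst G (P : Subgroup G)))
      (((QuotientGroup.mk' N).comp (P : Subgroup G).subtype).comp
        (MonoidHom.snd G (P : Subgroup G)))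
  have memE : ∀ e : G × (P : Subgroup G), e ∈ E ↔ e.1⁻¹ * e.2 ∈ N := fun e =>
    QuotientGroup.eq
  let π : E →* G := (MonoidHom.fst G (P : Subgroup G)).comp E.subtype
  have hπ : Function.Surjective π := by
    intro g
    obtain ⟨x, hx, h⟩ := hNP g
    exact ⟨⟨(g, ⟨x, hx⟩), (memE _).2 h⟩, rfl⟩
  let S : Subgroup E := (P : Subgroup G).comap π
  have hidx : S.index = (P : Subgroup G).index := Subgroup.index_comap_of_surjective _ hπ
  let y : S →* (P : Subgroup G) :=
    (π.comp S.subtype).codRestrict (P : Subgroup G) (fun s => s.2)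
  let z : S →* (P : Subgroup G) :=
    ((MonoidHom.snd G (P : Subgroup G)).comp E.subtype).comp S.subtype
  have hyc : ∀ s : S, ((y s : (P : Subgroup G)) : G) = s.1.1.1 := fun _ => rfl
  have hyz : ∀ s : S, (y s)⁻¹ * z s ∈ N.subgroupOf (P : Subgroup G) := fun s =>
    (memE _).1 s.1.2
  let l' : S →* Multiplicative (ZMod p) := MonoidHom.mk' (fun s => l ⟨(y s)⁻¹ * z s, hyz s⟩) (by
    intro a b
    rw [← hl (y b)⁻¹ ⟨(y a)⁻¹ * z a, hyz a⟩, ← map_mul]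
    congr 1
    ext
    simp [mul_assoc])
  let τ : E →* Multiplicative (ZMod p) := MonoidHom.transfer l'
  have h1 : ∀ q : (P : Subgroup G), ∀ hq : q ∈ N.subgroupOf (P : Subgroup G),
      ∀ he : ((1 : G), q) ∈ E, τ ⟨(1, q), he⟩ = l ⟨q, hq⟩ ^ (P : Subgroup G).index := by
    intro q hq he
    let s : S := ⟨⟨(1, q), he⟩, (P : Subgroup G).one_mem⟩
    have hs : l' s = l ⟨q, hq⟩ := by
      change l _ = l _
      refine congrArg l (Subtype.ext (Subtype.ext ?_))
      simp only [Subgroup.coe_mul, Subgroup.coe_inv, hyc]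
      simp [z, s]
    have := transfer_eq S l' s (by
      intro k e₀ hk
      rw [hs, ← map_pow, ← hl (e₀.1.2)⁻¹]
      change l _ = l _
      refine congrArg l (Subtype.ext (Subtype.ext ?_))
      simp only [Subgroup.coe_mul, Subgroup.coe_inv, hyc]
      simp [z, s])
    rw [hs, hidx] at this
    exact this
  let ι : N →* E := (MonoidHom.inl G (P : Subgroup G)).comp N.subtype |>.codRestrict E (by
    intro n
    rw [memE]
    simp)
  have h2 : ∀ n : N, τ (ι n) = 1 := fun n => DFunLike.congr_fun (hN (τ.comp ι)) n
  let δ : (P : Subgroup G) →* E :=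
    ((P : Subgroup G).subtype.prod (MonoidHom.id _)).codRestrict E (by
      intro x
      rw [memE]
      simp)
  apply hl1
  ext1 q
  have hq : ((q : (P : Subgroup G)) : G) ∈ N := q.2
  have he : ((1 : G), (q : (P : Subgroup G))) ∈ E := by
    rw [memE]; simpa using hq
  have h3 : τ (δ q) = 1 := hQ (τ.comp δ) q hq
  have h4 : δ q = ι ⟨_, hq⟩ * ⟨(1, q), he⟩ := by
    ext <;> simp [δ, ι]
  rw [h4, map_mul, h2, one_mul, h1 q q.2 he] at h3
  by_contra hlq
  have := orderOf_dvd_of_pow_eq_one h3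
  rw [orderOf_c _ hlq] at this
  exact P.not_dvd_index this

end PNil

theorem stmt7 {G : Type*} [Group G] [Fintype G] {p : ℕ}
    (hp : p.Prime) (hdvd : p ∣ Nat.card G)
    (hgcd : Nat.gcd (Nat.card G) (p - 1) = 1)
    (P : Sylow p G)
    (h : ∀ M : Subgroup G, IsMaximalSubgroupOf M (P : Subgroup G) →
      M.IsSQuasinormal ∨ HasPNilpotentSupplement p M) :
    IsPNilpotent p G := by
  have : Fact p.Prime := ⟨hp⟩
  let X : Set G := {g | ¬ p ∣ orderOf g}
  let N : Subgroup G := Subgroup.closure X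
  have hNn : N.Normal := by
    refine ⟨fun n hn g => ?_⟩
    have hmap : N.map (MulAut.conj g).toMonoidHom ≤ N := by
      rw [MonoidHom.map_closure, Subgroup.closure_le]
      rintro _ ⟨x, hx, rfl⟩
      apply Subgroup.subset_closure
      have e : orderOf ((MulAut.conj g).toMonoidHom x) = orderOf x :=
        orderOf_injective _ (MulAut.conj g).injective x
      change ¬ p ∣ orderOf _
      rw [e]
      exact hx
    exact hmap ⟨n, hn, rfl⟩
  have kill : ∀ c : Multiplicative (ZMod p), ∀ m : ℕ, ¬ p ∣ m → c ^ m = 1 → c = 1 := by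
    intro c m hm hc
    by_contra hne
    have := orderOf_dvd_of_pow_eq_one hc
    rw [PNil.orderOf_c _ hne] at this
    exact hm this
  have hN1 : ∀ f : N →* Multiplicative (ZMod p), f = 1 := by
    intro f
    have hle : N ≤ f.ker.map N.subtype := by
      rw [Subgroup.closure_le]
      intro x hx
      have hxN : x ∈ N := Subgroup.subset_closure hx
      refine ⟨⟨x, hxN⟩, ?_, rfl⟩
      refine kill _ (orderOf x) hx ?_
      rw [← map_pow]
      have : (⟨x, hxN⟩ : N) ^ orderOf x = 1 := Subtype.ext (pow_orderOf_eq_one x)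
      rw [this, map_one]
    ext1 n
    obtain ⟨m, hm, e⟩ := hle n.2
    have : m = n := Subtype.ext e
    rw [← this]
    exact hm
  have hG1 : ∀ f : G →* Multiplicative (ZMod p), ∀ n ∈ N, f n = 1 := by
    intro f n hn
    exact DFunLike.congr_fun (hN1 (f.comp N.subtype)) ⟨n, hn⟩
  have hquot : IsPGroup p (G ⧸ N) := by
    intro x
    induction x using QuotientGroup.induction_on with
    | H g =>
      obtain ⟨a, m, hm, e⟩ := Nat.exists_eq_pow_mul_and_not_dvd (orderOf_pos g).ne' p hp.ne_one
      refine ⟨a, ?_⟩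
      rw [← QuotientGroup.mk_pow, QuotientGroup.eq_one_iff]
      apply Subgroup.subset_closure
      change ¬ p ∣ orderOf (g ^ p ^ a)
      rw [orderOf_pow_of_dvd (pow_pos hp.pos a).ne' (e ▸ dvd_mul_right _ _), e,
        Nat.mul_div_cancel_left _ (pow_pos hp.pos a)]
      exact hm
  obtain ⟨k, hk⟩ := IsPGroup.iff_card.1 hquot
  have hidx : N.index = p ^ k := hk
  have htop : N ⊔ (P : Subgroup G) = ⊤ := by
    rw [← Subgroup.index_eq_one]
    have d1 : (N ⊔ (P : Subgroup G)).index ∣ p ^ k :=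
      hidx ▸ Subgroup.index_dvd_of_le le_sup_left
    have d2 : (N ⊔ (P : Subgroup G)).index ∣ (P : Subgroup G).index :=
      Subgroup.index_dvd_of_le le_sup_right
    exact Nat.eq_one_of_dvd_coprimes
      (Nat.Coprime.pow_left k ((Nat.Prime.coprime_iff_not_dvd hp).2 P.not_dvd_index)) d1 d2
  have hNP : ∀ g : G, ∃ x ∈ P, g⁻¹ * x ∈ N := by
    intro g
    have : g⁻¹ ∈ N ⊔ (P : Subgroup G) := htop ▸ Subgroup.mem_top _
    obtain ⟨n, hn, x, hx, e⟩ := Subgroup.mem_sup_of_normal_left.1 this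
    refine ⟨x⁻¹, P.inv_mem hx, ?_⟩
    rw [← e]
    simpa using hn
  have hbot := PNil.inf_eq_bot P N hNP hN1 (by
    intro f x hx
    obtain ⟨ψ, hψ⟩ := PNil.extend hgcd P h f
    rw [← hψ]
    exact hG1 ψ x hx)
  refine ⟨N, hNn, ?_, k, hidx⟩
  intro hd
  obtain ⟨x, hx⟩ := exists_prime_orderOf_dvd_card' p hd
  have hxp : IsPGroup p (Subgroup.zpowers (x : G)) := by
    refine IsPGroup.of_card (n := 1) ?_
    rw [Nat.card_zpowers, Subgroup.orderOf_coe, hx, pow_one]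
  obtain ⟨R, hR⟩ := hxp.exists_le_sylow
  obtain ⟨g, hg⟩ := MulAction.exists_smul_eq G R P
  have hxP : g * x * g⁻¹ ∈ P := by
    have h1 : (x : G) ∈ (R : Subgroup G) := hR (Subgroup.mem_zpowers _)
    have h2 : MulAut.conj g • (x : G) ∈ ((g • R : Sylow p G) : Subgroup G) := by
      rw [Sylow.coe_subgroup_smul]
      exact Subgroup.smul_mem_pointwise_smul _ _ _ h1
    rw [hg] at h2
    exact h2
  have hxN : g * x * g⁻¹ ∈ N := hNn.conj_mem x x.2 g
  have h3 : (⟨g * x * g⁻¹, hxP⟩ : (P : Subgroup G)) ∈ N.subgroupOf (P : Subgroup G) := hxN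
  rw [hbot, Subgroup.mem_bot] at h3
  have h4 : g * (x : G) * g⁻¹ = 1 := congrArg Subtype.val h3
  have h5 : (x : G) = 1 := conj_eq_one_iff.1 h4
  have h6 : x = 1 := Subtype.ext h5
  rw [h6, orderOf_one] at hx
  exact hp.one_lt.ne hx
end

section
/- Let G be a finite group and p a prime divisor of |G| with gcd(|G|, p-1) = 1. If every maximal subgroup of a Sylow p-subgroup P of G has a p-nilpotent supplement in G, then G is p-nilpotent. -/
open scoped Pointwise

section Tate

/-- The product over left cosets of a function on a group. -/
noncomputable def cosetProd {N A : Type*} [Group N] [Finite N] [CommGroup A]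
    (Q : Subgroup N) (f : N → A) : A :=
  letI : Fintype (N ⧸ Q) := Fintype.ofFinite _
  ∏ x : N ⧸ Q, f x.out

theorem cosetProd_comp {N A : Type*} [Group N] [Finite N] [CommGroup A]
    (Q : Subgroup N) (f : N → A) (hf : ∀ n, ∀ q ∈ Q, f (n * q) = f n)
    (e : N → N) (he : ∀ a b, (e a)⁻¹ * e b ∈ Q → a⁻¹ * b ∈ Q) :
    cosetProd Q (fun n => f (e n)) = cosetProd Q f := by
  unfold cosetProd
  let : Fintype (N ⧸ Q) := Fintype.ofFinite _
  have hinj : Function.Injective (fun x : N ⧸ Q => ((e x.out : N) : N ⧸ Q)) := by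
    intro x y hxy
    have h1 : (e x.out)⁻¹ * e y.out ∈ Q := QuotientGroup.eq.mp hxy
    have h2 := QuotientGroup.eq.mpr (he _ _ h1)
    simpa using h2
  have hbij := Finite.injective_iff_bijective.mp hinj
  have key := hbij.prod_comp (fun x : N ⧸ Q => f x.out)
  have h3 : ∀ x : N ⧸ Q, f (((e x.out : N) : N ⧸ Q).out) = f (e x.out) := by
    intro x
    obtain ⟨q, hq⟩ := QuotientGroup.mk_out_eq_mul Q (e x.out)
    rw [hq, hf _ _ q.2]
  simp only [h3] at key
  exact key

theorem cosetProd_mul {N A : Type*} [Group N] [Finite N] [CommGroup A]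
    (Q : Subgroup N) (f g : N → A) :
    cosetProd Q (fun n => f n * g n) = cosetProd Q f * cosetProd Q g := by
  unfold cosetProd
  exact Finset.prod_mul_distrib

theorem cosetProd_const {N A : Type*} [Group N] [Finite N] [CommGroup A]
    (Q : Subgroup N) (a : A) : cosetProd Q (fun _ => a) = a ^ Q.index := by
  unfold cosetProd
  let : Fintype (N ⧸ Q) := Fintype.ofFinite _
  rw [Finset.prod_const, Finset.card_univ, Subgroup.index, Nat.card_eq_fintype_card]

/-- A transfer argument in the spirit of Tate's theorem. -/
theorem tate_transfer {N A R : Type*} [Group N] [Finite N] [CommGroup A] [Group R]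
    (Q : Subgroup N) (φ : Q →* A) (ψ : R →* MulAut N)
    (hQ : ∀ g : R, ∀ q ∈ Q, ψ g q ∈ Q)
    (hφ : ∀ (g : R) (q : N) (h : q ∈ Q), φ ⟨ψ g q, hQ g q h⟩ = φ ⟨q, h⟩)
    (htriv : ∀ W : N →* A, W = 1)
    (hinner : ∀ q ∈ Q, ∃ g : R, ∀ n, ψ g n = q⁻¹ * n * q)
    (hgen : ∀ B : Subgroup R,
      (∀ s : R, (∃ α : N → A, (∀ n, ∀ q : Q, α (n * q) = α n * φ q) ∧
        ∀ n, α (ψ s n) = α n) → s ∈ B) → B = ⊤) (q : Q) :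
    φ q ^ Q.index = 1 := by
  obtain ⟨α, hα⟩ : ∃ α : N → A, ∀ n, ∀ q : Q, α (n * q) = α n * φ q := by
    refine ⟨fun n => φ ⟨((n : N ⧸ Q).out)⁻¹ * n, QuotientGroup.eq.mp (by simp)⟩, fun n q => ?_⟩
    rw [← map_mul]
    change φ _ = φ _
    refine congrArg φ (Subtype.ext ?_)
    have : ((n * q : N) : N ⧸ Q) = (n : N ⧸ Q) := by
      rw [eq_comm, QuotientGroup.eq]; simp
    simp [this, mul_assoc]
  have hψdiv : ∀ g : R, ∀ a b : N, (ψ g a)⁻¹ * ψ g b ∈ Q → a⁻¹ * b ∈ Q := by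
    intro g a b h
    have := hQ g⁻¹ _ h
    rwa [← map_inv, ← map_mul, map_inv ψ, MulAut.inv_apply_self] at this
  have hαψ : ∀ (α : N → A), (∀ n, ∀ q : Q, α (n * q) = α n * φ q) →
      ∀ (g : R) (n : N), ∀ q : Q, α (ψ g (n * q)) = α (ψ g n) * φ q := by
    intro α hα g n q
    rw [map_mul, hα (ψ g n) ⟨ψ g q, hQ g q q.2⟩, hφ g q q.2]
  let θ : R →* A := MonoidHom.mk' (fun g => cosetProd Q (fun n => α (ψ g n) / α n)) (by
    intro a b
    have h1 := cosetProd_comp Q (fun n => α (ψ a n) / α n) (by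
      intro n q hq
      have h1 := hαψ α hα a n ⟨q, hq⟩
      have h2 := hα n ⟨q, hq⟩
      simp only at h1 h2 ⊢
      rw [h1, h2, mul_div_mul_right_eq_div]) (ψ b) (hψdiv b)
    rw [← h1, ← cosetProd_mul]
    congr 1
    funext n
    simp)
  let W : N →* A := MonoidHom.mk' (fun g => cosetProd Q (fun n => α (g * n) / α n)) (by
    intro a b
    have h1 := cosetProd_comp Q (fun n => α (a * n) / α n) (by
      intro n q hq
      have h1 := hα (a * n) ⟨q, hq⟩
      have h2 := hα n ⟨q, hq⟩
      simp only at h1 h2 ⊢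
      rw [← mul_assoc, h1, h2, mul_div_mul_right_eq_div]) (fun n => b * n)
        (by intro x y h; simpa [mul_assoc] using h)
    rw [← h1, ← cosetProd_mul]
    congr 1
    funext n
    simp [mul_assoc])
  have hker : θ.ker = ⊤ := by
    apply hgen
    rintro s ⟨β, hβ, hβs⟩
    rw [MonoidHom.mem_ker]
    change cosetProd Q (fun n => α (ψ s n) / α n) = 1
    have h1 := cosetProd_comp Q (fun n => α n / β n) (by
      intro n q hq
      have h1 := hα n ⟨q, hq⟩
      have h2 := hβ n ⟨q, hq⟩
      simp only at h1 h2 ⊢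
      rw [h1, h2, mul_div_mul_right_eq_div]) (ψ s) (hψdiv s)
    simp only [hβs] at h1
    have h2 : (fun n => α (ψ s n) / β n) = fun n => (α (ψ s n) / α n) * (α n / β n) := by
      funext n; simp
    rw [h2, cosetProd_mul] at h1
    simpa using h1
  obtain ⟨g, hg⟩ := hinner q q.2
  have h1 : cosetProd Q (fun n => α (ψ g n) / α n) = 1 := by
    have : g ∈ θ.ker := by rw [hker]; trivial
    exact this
  have h2 : cosetProd Q (fun n => α ((q : N)⁻¹ * n) / α n) = 1 := by
    have : W (q : N)⁻¹ = 1 := by rw [htriv W]; rfl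
    exact this
  have h3 : (fun n => α (ψ g n) / α n) = fun n => (α ((q : N)⁻¹ * n) / α n) * φ q := by
    funext n
    rw [hg, hα, mul_div_right_comm]
  rw [h3, cosetProd_mul, h2, cosetProd_const, one_mul] at h1
  exact h1

theorem relIndex_eq_index_of_mul {G : Type*} [Group G] (P B : Subgroup G)
    (h : ∀ g : G, ∃ b ∈ B, ∃ x ∈ P, g = b * x) : P.relIndex B = P.index := by
  unfold Subgroup.relIndex Subgroup.index
  apply Nat.card_eq_of_bijective
    (Quotient.map' (fun b : B => (b : G)) (by
      intro a b hab
      rw [QuotientGroup.leftRel_apply] at hab ⊢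
      simpa [Subgroup.mem_subgroupOf] using hab) : B ⧸ P.subgroupOf B → G ⧸ P)
  constructor
  · intro x y
    induction x using QuotientGroup.induction_on with | _ x
    induction y using QuotientGroup.induction_on with | _ y
    intro hxy
    have : ((x : G) : G ⧸ P) = ((y : G) : G ⧸ P) := hxy
    rw [QuotientGroup.eq] at this ⊢
    simpa [Subgroup.mem_subgroupOf] using this
  · intro x
    induction x using QuotientGroup.induction_on with | _ x
    obtain ⟨b, hb, y, hy, rfl⟩ := h x
    refine ⟨((⟨b, hb⟩ : B) : B ⧸ P.subgroupOf B), ?_⟩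
    change ((b : G) : G ⧸ P) = _
    rw [QuotientGroup.eq]
    simpa using hy

theorem nilpotent_le_commutator {R : Type*} [Group R] [Group.IsNilpotent R] (Q : Subgroup R)
    (h : Q ≤ ⁅Q, ⊤⁆) : Q = ⊥ := by
  have key : ∀ n, Q ≤ Subgroup.lowerCentralSeries (⊤ : Subgroup R) n := by
    intro n
    induction n with
    | zero => simp
    | succ n ih => exact h.trans (Subgroup.commutator_mono ih le_rfl)
  obtain ⟨n, hn⟩ := Subgroup.nilpotent_iff_lowerCentralSeries.mp ‹Group.IsNilpotent R›
  exact le_bot_iff.mp (hn ▸ key n)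

end Tate

/-- The subgroup generated by the elements of order prime to p. -/
def pResidual (p : ℕ) (G : Type*) [Group G] : Subgroup G :=
  Subgroup.closure {x : G | ¬ p ∣ orderOf x}

theorem pResidual_normal (p : ℕ) (G : Type*) [Group G] : (pResidual p G).Normal := by
  refine ⟨fun n hn g => ?_⟩
  unfold pResidual at hn ⊢
  induction hn using Subgroup.closure_induction with
  | mem x hx =>
    apply Subgroup.subset_closure
    have : orderOf (g * x * g⁻¹) = orderOf x := by
      simpa using orderOf_injective (MulAut.conj g).toMonoidHom (MulAut.conj g).injective x
    simpa [this] using hx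
  | one => simp
  | mul x y _ _ hx hy =>
    have := mul_mem hx hy
    simpa [mul_assoc] using this
  | inv x _ hx =>
    have := inv_mem hx
    simpa [mul_assoc] using this

theorem pResidual_index {p : ℕ} (hp : p.Prime) (G : Type*) [Group G] [Finite G] :
    ∃ k, (pResidual p G).index = p ^ k := by
  have := Fact.mk hp
  have := pResidual_normal p G
  have h : IsPGroup p (G ⧸ pResidual p G) := by
    intro x
    induction x using QuotientGroup.induction_on with | _ x
    obtain ⟨k, m, hm, hk⟩ := Nat.exists_eq_pow_mul_and_not_dvd (orderOf_pos x).ne' p hp.ne_one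
    refine ⟨k, ?_⟩
    rw [← QuotientGroup.mk_pow, QuotientGroup.eq_one_iff]
    apply Subgroup.subset_closure
    have : orderOf (x ^ p ^ k) = m := by
      rw [orderOf_pow_of_dvd (pow_pos hp.pos k).ne' (by rw [hk]; exact dvd_mul_right _ _), hk,
        Nat.mul_div_cancel_left _ (pow_pos hp.pos k)]
    simpa [this] using hm
  exact IsPGroup.iff_card.mp h

theorem eq_one_of_pow {A : Type*} [Group A] {p : ℕ} (hp : p.Prime) (hA : IsPGroup p A)
    (a : A) (m : ℕ) (hm : ¬ p ∣ m) (h : a ^ m = 1) : a = 1 := by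
  obtain ⟨k, hk⟩ := hA a
  have h1 : orderOf a ∣ m := orderOf_dvd_of_pow_eq_one h
  have h2 : orderOf a ∣ p ^ k := orderOf_dvd_of_pow_eq_one hk
  have hc : Nat.Coprime (p ^ k) m := Nat.Coprime.pow_left k ((Nat.Prime.coprime_iff_not_dvd hp).mpr hm)
  exact orderOf_eq_one_iff.mp (Nat.eq_one_of_dvd_coprimes hc h2 h1)

theorem pResidual_hom {p : ℕ} (hp : p.Prime) {G : Type*} [Group G] {A : Type*} [Group A]
    (hA : IsPGroup p A) (W : pResidual p G →* A) : W = 1 := by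
  have key : ∀ x (hx : x ∈ pResidual p G), W ⟨x, hx⟩ = 1 := by
    intro x hx
    have hx' : x ∈ Subgroup.closure {x : G | ¬ p ∣ orderOf x} := hx
    induction hx' using Subgroup.closure_induction with
    | mem y hy =>
      refine eq_one_of_pow hp hA _ (orderOf y) hy ?_
      rw [← map_pow]
      convert map_one W
      exact Subtype.ext (pow_orderOf_eq_one y)
    | one => exact map_one W
    | mul x y h1 h2 hx1 hy =>
      have := map_mul W ⟨x, h1⟩ ⟨y, h2⟩
      rw [hx1 h1, hy h2, mul_one] at this
      exact this
    | inv x h1 hx1 =>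
      have := map_inv W ⟨x, h1⟩
      rw [hx1 h1, inv_one] at this
      exact this
  ext x
  exact key x.1 x.2

/-- A supplement yields a Hall subgroup `H`, normalized by `P ⊓ K`, with `G = H P`. -/
theorem hall_of_supplement {G : Type*} [Group G] [Finite G] {p : ℕ} (hp : p.Prime)
    (P : Sylow p G) (K : Subgroup G) (hPK : ∀ g : G, ∃ b ∈ K, ∃ x ∈ (P : Subgroup G), g = b * x)
    (hK : IsPNilpotent p K) :
    ∃ H : Subgroup G, (∀ d ∈ K, ∀ x ∈ H, d * x * d⁻¹ ∈ H) ∧ H ≤ pResidual p G ∧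
      (∀ x ∈ H, x ∈ (P : Subgroup G) → x = 1) ∧
      ∀ g : G, ∃ x ∈ H, ∃ y ∈ (P : Subgroup G), g = x * y := by
  have := Fact.mk hp
  obtain ⟨H, hHn, hHp, k, hk⟩ := hK
  have hord : ∀ x ∈ H, ¬ p ∣ orderOf x := by
    intro x hx hd
    apply hHp
    refine hd.trans ?_
    have := orderOf_dvd_natCard (⟨x, hx⟩ : H)
    rwa [Subgroup.orderOf_mk] at this
  have hord' : ∀ x ∈ H.map K.subtype, ¬ p ∣ orderOf x := by
    rintro _ ⟨x, hx, rfl⟩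
    rw [Subgroup.coe_subtype, Subgroup.orderOf_coe]
    exact hord x hx
  refine ⟨H.map K.subtype, ?_, ?_, ?_, ?_⟩
  · rintro d hd _ ⟨x, hx, rfl⟩
    exact ⟨⟨d, hd⟩ * x * ⟨d, hd⟩⁻¹, hHn.conj_mem _ hx _, rfl⟩
  · intro x hx
    exact Subgroup.subset_closure (hord' x hx)
  · intro x hx hxP
    have h1 := eq_one_of_pow hp P.2 ⟨x, hxP⟩ (orderOf x) (hord' x hx)
      (Subtype.ext (pow_orderOf_eq_one x))
    exact congrArg Subtype.val h1
  · have hidx : ¬ p ∣ ((P : Subgroup G).subgroupOf K).index := by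
      have := relIndex_eq_index_of_mul (P : Subgroup G) K hPK
      unfold Subgroup.relIndex at this
      rw [this]
      exact P.not_dvd_index
    have htop : H ⊔ (P : Subgroup G).subgroupOf K = ⊤ := by
      rw [← Subgroup.index_eq_one]
      have h1 : (H ⊔ (P : Subgroup G).subgroupOf K).index ∣ p ^ k :=
        hk ▸ Subgroup.index_dvd_of_le le_sup_left
      have h2 := Subgroup.index_dvd_of_le (le_sup_right : _ ≤ H ⊔ (P : Subgroup G).subgroupOf K)
      exact Nat.eq_one_of_dvd_coprimes
        (Nat.Coprime.pow_left k ((Nat.Prime.coprime_iff_not_dvd hp).mpr hidx)) h1 h2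
    intro g
    obtain ⟨b, hb, x, hx, rfl⟩ := hPK g
    have hb' : (⟨b, hb⟩ : K) ∈ H ⊔ (P : Subgroup G).subgroupOf K := by rw [htop]; trivial
    obtain ⟨u, hu, v, hv, huv⟩ := Subgroup.mem_sup_of_normal_left.mp hb'
    have : (u : G) * v = b := congrArg Subtype.val huv
    refine ⟨u, ⟨u, hu, rfl⟩, v * x, mul_mem hv hx, ?_⟩
    rw [← this, mul_assoc]

open scoped commutatorElement

instance centerCommGroupAux {G : Type*} [Group G] : CommGroup (Subgroup.center G) :=
  { (inferInstance : Group (Subgroup.center G)) with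
    mul_comm := fun a b => Subtype.ext (b.2.comm a).symm }

theorem stmt8 {G : Type*} [Group G] [Fintype G] {p : ℕ}
    (hp : p.Prime) (hdvd : p ∣ Nat.card G)
    (hgcd : Nat.gcd (Nat.card G) (p - 1) = 1)
    (P : Sylow p G)
    (h : ∀ M : Subgroup G, IsMaximalSubgroupOf M (P : Subgroup G) →
      HasPNilpotentSupplement p M) :
    IsPNilpotent p G := by
  have := Fact.mk hp
  have hNn := pResidual_normal p G
  set N := pResidual p G with hN
  refine ⟨N, hNn, ?_, pResidual_index hp G⟩
  obtain ⟨k0, hk0⟩ := pResidual_index hp G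
  -- `P ⊓ N` as a subgroup of `P`
  let Qp : Subgroup P := N.subgroupOf P
  have hnil : Group.IsNilpotent P := P.2.isNilpotent
  -- reduce to `Qp = ⊥`
  suffices hQp : Qp ≤ ⁅Qp, ⊤⁆ by
    have hbot := nilpotent_le_commutator Qp hQp
    intro hpN
    obtain ⟨x, hx⟩ := exists_prime_orderOf_dvd_card' p hpN
    have hxp : IsPGroup p (Subgroup.zpowers (x : G)) := by
      apply IsPGroup.of_card (n := 1)
      rw [Nat.card_zpowers, Subgroup.orderOf_coe, hx, pow_one]
    obtain ⟨R, hR⟩ := hxp.exists_le_sylow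
    obtain ⟨g, hg⟩ := MulAction.exists_smul_eq G R P
    have hxR : (x : G) ∈ R := hR (Subgroup.mem_zpowers _)
    have hgx : g * x * g⁻¹ ∈ P := by
      rw [← hg]
      exact ⟨x, hxR, rfl⟩
    have hgN : g * x * g⁻¹ ∈ N := hNn.conj_mem _ x.2 g
    have : (⟨_, hgx⟩ : P) ∈ Qp := hgN
    rw [hbot, Subgroup.mem_bot] at this
    have h1 : g * x * g⁻¹ = 1 := congrArg Subtype.val this
    have h2 : x = 1 := by
      apply Subtype.ext
      simpa using h1
    rw [h2, orderOf_one] at hx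
    exact hp.one_lt.ne hx
  have hQpn : Qp.Normal := inferInstance
  have hA : IsPGroup p (Subgroup.center ((P : Subgroup G) ⧸ ⁅Qp, (⊤ : Subgroup P)⁆)) :=
    (P.2.of_surjective (QuotientGroup.mk' _) (QuotientGroup.mk'_surjective _)).to_subgroup _
  let Q : Subgroup N := (P : Subgroup G).subgroupOf N
  let φ : Q →* Subgroup.center ((P : Subgroup G) ⧸ ⁅Qp, (⊤ : Subgroup P)⁆) :=
    { toFun := fun q => ⟨QuotientGroup.mk' _ (⟨q.1.1, q.2⟩ : P), by
        rw [Subgroup.mem_center_iff]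
        intro g
        induction g using QuotientGroup.induction_on with | _ g
        rw [QuotientGroup.mk'_apply, ← QuotientGroup.mk_mul, ← QuotientGroup.mk_mul,
          QuotientGroup.eq]
        have h1 : ⁅(⟨q.1.1, q.2⟩ : (P : Subgroup G))⁻¹, g⁻¹⁆ ∈ ⁅Qp, (⊤ : Subgroup P)⁆ :=
          Subgroup.commutator_mem_commutator (inv_mem (show _ ∈ Qp from q.1.2)) (Subgroup.mem_top _)
        convert h1 using 1
        simp [commutatorElement_def, mul_assoc]⟩
      map_one' := rfl
      map_mul' := fun _ _ => rfl }
  let ψ : P →* MulAut N := MulAut.conjNormal.comp (P : Subgroup G).subtype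
  have hψ : ∀ (g : P) (n : N), ((ψ g n : N) : G) = g * n * (g : G)⁻¹ := fun g n => rfl
  have hQ : ∀ g : P, ∀ q ∈ Q, ψ g q ∈ Q := by
    intro g q hq
    change ((ψ g q : N) : G) ∈ (P : Subgroup G)
    rw [hψ]
    exact mul_mem (mul_mem g.2 hq) (inv_mem g.2)
  have hφ : ∀ (g : P) (q : N) (h : q ∈ Q), φ ⟨ψ g q, hQ g q h⟩ = φ ⟨q, h⟩ := by
    intro g q h
    apply Subtype.ext
    have hc := (φ ⟨q, h⟩).2
    rw [Subgroup.mem_center_iff] at hc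
    have h1 := hc (QuotientGroup.mk' _ g)
    change QuotientGroup.mk' ⁅Qp, (⊤ : Subgroup P)⁆ (g * ⟨q.1, h⟩ * g⁻¹) = _
    rw [map_mul, map_mul, map_inv, mul_inv_eq_iff_eq_mul]
    exact h1
  -- every element of `P` is killed
  have hidx : ¬ p ∣ Q.index := by
    have hsup : N ⊔ (P : Subgroup G) = ⊤ := by
      rw [← Subgroup.index_eq_one]
      have h1 : (N ⊔ (P : Subgroup G)).index ∣ p ^ k0 :=
        hk0 ▸ Subgroup.index_dvd_of_le le_sup_left
      have h2 := Subgroup.index_dvd_of_le (le_sup_right : _ ≤ N ⊔ (P : Subgroup G))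
      exact Nat.eq_one_of_dvd_coprimes
        (Nat.Coprime.pow_left k0 ((Nat.Prime.coprime_iff_not_dvd hp).mpr P.not_dvd_index)) h1 h2
    have := relIndex_eq_index_of_mul (P : Subgroup G) N (by
      intro g
      have hg : g ∈ N ⊔ (P : Subgroup G) := by rw [hsup]; trivial
      obtain ⟨a, ha, b, hb, hab⟩ := Subgroup.mem_sup_of_normal_left.mp hg
      exact ⟨a, ha, b, hb, hab.symm⟩)
    change ¬ p ∣ (P : Subgroup G).relIndex N
    rw [this]
    exact P.not_dvd_index
  have key := tate_transfer Q φ ψ hQ hφ (fun W => pResidual_hom hp hA W)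
    (by
      intro q hq
      refine ⟨⟨q, hq⟩⁻¹, fun n => Subtype.ext ?_⟩
      rw [hψ]
      simp)
    (by
      intro B hB
      by_contra hBtop
      obtain ⟨M, hM, hBM⟩ := (eq_top_or_exists_le_coatom B).resolve_left hBtop
      have hMmap : M.map (P : Subgroup G).subtype ≤ P := Subgroup.map_subtype_le M
      have hmax : IsMaximalSubgroupOf (M.map (P : Subgroup G).subtype) (P : Subgroup G) := by
        have hcm : (M.map (P : Subgroup G).subtype).subgroupOf P = M :=
          Subgroup.comap_map_eq_self_of_injective (Subgroup.subtype_injective _) M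
        refine ⟨lt_of_le_of_ne hMmap ?_, ?_⟩
        · intro he
          apply hM.1
          rw [← hcm, he, Subgroup.subgroupOf_self]
        · intro K hK hKP
          have h1 : M < K.subgroupOf P := by
            refine lt_of_le_of_ne ?_ ?_
            · rw [← hcm]
              exact Subgroup.comap_mono hK.le
            · intro he
              apply hK.ne
              rw [he, Subgroup.subgroupOf_map_subtype, inf_eq_left.mpr hKP]
          have h2 := hM.2 _ h1
          exact le_antisymm hKP (Subgroup.subgroupOf_eq_top.mp h2)
      obtain ⟨K, hMK, hK⟩ := h _ hmax
      have hMK' : ∀ g : G, ∃ m ∈ M.map (P : Subgroup G).subtype, ∃ b ∈ K, m * b = g := by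
        intro g
        have hg : g ∈ ((M.map (P : Subgroup G).subtype : Subgroup G) : Set G) * (K : Set G) := by
          rw [hMK]; trivial
        exact Set.mem_mul.mp hg
      have hPK : ∀ g : G, ∃ b ∈ K, ∃ x ∈ (P : Subgroup G), g = b * x := by
        intro g
        obtain ⟨m, hm, b, hb, hmb⟩ := hMK' g⁻¹
        refine ⟨b⁻¹, inv_mem hb, m⁻¹, inv_mem (hMmap hm), ?_⟩
        rw [← mul_inv_rev, hmb, inv_inv]
      obtain ⟨H, hHK, hHN, hHP, hHfac⟩ := hall_of_supplement hp P K hPK hK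
      -- elements of `P ⊓ K` lie in `B`
      have hDB : ∀ d : P, (d : G) ∈ K → d ∈ B := by
        intro d hd
        apply hB
        have hfac : ∀ n : N, ∃ q : Q, (n : G) * ((q : N) : G)⁻¹ ∈ H := by
          intro n
          obtain ⟨x, hx, y, hy, hxy⟩ := hHfac n
          have hyN : y ∈ N := by
            have : y = x⁻¹ * n := by rw [hxy]; simp
            rw [this]
            exact mul_mem (inv_mem (hHN hx)) n.2
          refine ⟨⟨⟨y, hyN⟩, hy⟩, ?_⟩
          simpa [hxy] using hx
        have huniq : ∀ (n : N) (q q' : Q), (n : G) * ((q : N) : G)⁻¹ ∈ H →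
            (n : G) * ((q' : N) : G)⁻¹ ∈ H → q = q' := by
          intro n q q' h1 h2
          have h3 := mul_mem (inv_mem h1) h2
          have h4 : ((n : G) * ((q : N) : G)⁻¹)⁻¹ * ((n : G) * ((q' : N) : G)⁻¹)
              = ((q : N) : G) * ((q' : N) : G)⁻¹ := by group
          rw [h4] at h3
          have h5 := hHP _ h3 (mul_mem q.2 (inv_mem q'.2))
          exact Subtype.ext (Subtype.ext (mul_inv_eq_one.mp h5))
        choose c hc using hfac
        refine ⟨fun n => φ (c n), ?_, ?_⟩
        · intro n q
          change φ _ = φ _ * φ _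
          rw [← map_mul]
          congr 1
          apply huniq (n * q) _ _ (hc _)
          simpa using hc n
        · intro n
          change φ (c (ψ d n)) = φ (c n)
          rw [← hφ d (c n) (c n).2]
          congr 1
          apply huniq (ψ d n) _ _ (hc _)
          have := hHK d hd _ (hc n)
          rw [hψ]
          change (d : G) * n * (d : G)⁻¹ * ((ψ d (c n : N) : N) : G)⁻¹ ∈ H
          rw [hψ]
          simpa [mul_assoc] using this
      apply hM.1
      rw [eq_top_iff]
      intro x _
      obtain ⟨m, ⟨m', hm', rfl⟩, b, hb, hmb⟩ := hMK' x
      have hbP : b = ((m'⁻¹ * x : P) : G) := by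
        have : b = (m' : G)⁻¹ * x := by rw [← hmb]; simp
        rw [this]; rfl
      have h1 : m'⁻¹ * x ∈ M := hBM (hDB _ (hbP ▸ hb))
      have h2 := mul_mem hm' h1
      simpa using h2)
  intro x hx
  have h1 := eq_one_of_pow hp hA _ _ hidx (key ⟨⟨x, hx⟩, x.2⟩)
  have h2 : QuotientGroup.mk' ⁅Qp, (⊤ : Subgroup P)⁆ x = 1 := congrArg Subtype.val h1
  exact (QuotientGroup.eq_one_iff x).mp h2
end

section
/- Let G be a finite group, let p be a prime divisor of |G| with gcd(|G|, p-1) = 1, and let E be a normal subgroup of G such that G/E is p-nilpotent. If E has a Sylow p-subgroup P such that every maximal subgroup of P is c-normal in G, then G is p-nilpotent. -/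
open scoped Pointwise

open Subgroup in
lemma aux_relIndex_normal {G : Type*} [Group G] [Finite G] (S L : Subgroup G) [L.Normal] :
    S.relIndex L = S.relIndex (S ⊔ L) := by
  have h1 : (S ⊓ L).relIndex L * L.relIndex (S ⊔ L) = (S ⊓ L).relIndex (S ⊔ L) :=
    relIndex_mul_relIndex _ _ _ inf_le_right le_sup_right
  have h2 : (S ⊓ L).relIndex S * S.relIndex (S ⊔ L) = (S ⊓ L).relIndex (S ⊔ L) :=
    relIndex_mul_relIndex _ _ _ inf_le_left le_sup_left
  rw [inf_relIndex_right, relIndex_sup_right] at h1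
  rw [inf_relIndex_left] at h2
  have h3 : 0 < L.relIndex S := Nat.pos_of_ne_zero (FiniteIndex.index_ne_zero)
  apply Nat.eq_of_mul_eq_mul_right h3
  rw [h1, ← h2, mul_comm]

open Subgroup in
lemma aux_conj {X : Type*} [Group X] [Finite X] (A : Subgroup X) [A.Normal]
    [IsMulCommutative A] (hA : Nat.Coprime (Nat.card A) A.index)
    (H₁ H₂ : Subgroup X) (h₁ : IsComplement' H₁ A) (h₂ : IsComplement' H₂ A) :
    ∃ a ∈ A, H₂ = H₁.map (MulAut.conj a).toMonoidHom := by
  have key : ∀ H : Subgroup X, IsComplement' H A →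
      ∃ α : A.QuotientDiff, MulAction.stabilizer X α = H := by
    intro H hH
    refine ⟨Quotient.mk'' (⟨(H : Set X), hH⟩ : A.LeftTransversal), ?_⟩
    have hc := (isComplement'_stabilizer_of_coprime
      (α := Quotient.mk'' (⟨(H : Set X), hH⟩ : A.LeftTransversal)) hA).symm
    symm
    apply Subgroup.eq_of_le_of_card_ge
    · intro h hh
      change Quotient.mk'' (MulOpposite.op h⁻¹ • (⟨(H : Set X), hH⟩ : A.LeftTransversal)) = _
      congr 1
      apply Subtype.ext
      change MulOpposite.op h⁻¹ • (H : Set X) = H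
      exact op_smul_coe_set (H.inv_mem hh)
    · rw [← hc.index_eq_card, ← hH.index_eq_card]
  obtain ⟨α, rfl⟩ := key H₁ h₁
  obtain ⟨β, rfl⟩ := key H₂ h₂
  obtain ⟨a, rfl⟩ := exists_smul_eq hA α β
  exact ⟨a, a.2, MulAction.stabilizer_smul_eq_stabilizer_map_conj (a : X) α⟩

/-- no proper normal subgroup with p-quotient -/
def IsPPerf (p : ℕ) (X : Type*) [Group X] : Prop :=
  ∀ N : Subgroup X, N.Normal → (∃ k : ℕ, N.index = p ^ k) → N = ⊤

lemma IsPPerf.of_surjective {p : ℕ} {X Y : Type*} [Group X] [Group Y] (h : IsPPerf p X)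
    (f : X →* Y) (hf : Function.Surjective f) : IsPPerf p Y := by
  intro N hN hk
  have := h (N.comap f) (hN.comap f) (by rwa [Subgroup.index_comap_of_surjective _ hf])
  rw [← Subgroup.map_comap_eq_self_of_surjective hf N, this, Subgroup.map_top_of_surjective f hf]

/-- subgroup generated by the elements of order prime to p -/
def pRes (p : ℕ) (G : Type*) [Group G] : Subgroup G := Subgroup.closure {g : G | ¬ p ∣ orderOf g}

instance (p : ℕ) (G : Type*) [Group G] : (pRes p G).Normal := by
  constructor
  intro n hn g
  have : (pRes p G).map (MulAut.conj g).toMonoidHom ≤ pRes p G := by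
    rw [pRes, MonoidHom.map_closure, Subgroup.closure_le]
    rintro _ ⟨x, hx, rfl⟩
    apply Subgroup.subset_closure
    have : orderOf ((MulAut.conj g) x) = orderOf x := MulEquiv.orderOf_eq _ _
    change ¬ p ∣ orderOf ((MulAut.conj g) x)
    rw [this]; exact hx
  exact this ⟨n, hn, rfl⟩

lemma pRes_index {p : ℕ} (hp : p.Prime) (G : Type*) [Group G] [Finite G] :
    ∃ k, (pRes p G).index = p ^ k := by
  have := Fact.mk hp
  have : IsPGroup p (G ⧸ pRes p G) := by
    rw [isPGroup_iff_pow_pow_eq_one]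
    intro g
    obtain ⟨g, rfl⟩ := QuotientGroup.mk_surjective g
    obtain ⟨k, m, hm, hk⟩ := Nat.exists_eq_pow_mul_and_not_dvd (orderOf_pos g).ne' p hp.ne_one
    refine ⟨k, ?_⟩
    rw [← QuotientGroup.mk_pow, QuotientGroup.eq_one_iff]
    apply Subgroup.subset_closure
    change ¬ p ∣ orderOf (g ^ p ^ k)
    rwa [orderOf_pow_of_dvd (pow_pos hp.pos k).ne' ⟨m, hk⟩, hk,
      Nat.mul_div_cancel_left _ (pow_pos hp.pos k)]
  exact IsPGroup.iff_card.1 this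

lemma mem_of_index {p : ℕ} (hp : p.Prime) {G : Type*} [Group G] [Finite G] (N : Subgroup G)
    [N.Normal] (hN : ∃ k, N.index = p ^ k) (g : G) (hg : ¬ p ∣ orderOf g) : g ∈ N := by
  obtain ⟨k, hk⟩ := hN
  rw [← QuotientGroup.eq_one_iff, ← orderOf_eq_one_iff]
  have h1 : orderOf (g : G ⧸ N) ∣ orderOf g := orderOf_map_dvd (QuotientGroup.mk' N) g
  have h2 : orderOf (g : G ⧸ N) ∣ p ^ k := hk ▸ orderOf_dvd_natCard _
  have h3 : (orderOf g).Coprime (p ^ k) :=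
    ((Nat.Prime.coprime_iff_not_dvd hp).2 hg).symm.pow_right k
  exact Nat.eq_one_of_dvd_coprimes h3 h1 h2

lemma pRes_le {p : ℕ} (hp : p.Prime) {G : Type*} [Group G] [Finite G] (N : Subgroup G)
    [N.Normal] (hN : ∃ k, N.index = p ^ k) : pRes p G ≤ N := by
  rw [pRes, Subgroup.closure_le]
  exact fun g hg => mem_of_index hp N hN g hg

lemma pRes_perf {p : ℕ} (hp : p.Prime) (G : Type*) [Group G] [Finite G] :
    IsPPerf p (pRes p G) := by
  intro N hN hk
  have : pRes p G ≤ N.map (pRes p G).subtype := by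
    conv_lhs => rw [pRes]
    rw [Subgroup.closure_le]
    intro g hg
    have hg' : g ∈ pRes p G := Subgroup.subset_closure hg
    refine ⟨⟨g, hg'⟩, mem_of_index hp N hk _ ?_, rfl⟩
    rw [Subgroup.orderOf_mk]; exact hg
  rw [eq_top_iff]
  intro x _
  obtain ⟨y, hy, hyx⟩ := this x.2
  have : y = x := Subtype.ext hyx
  exact this ▸ hy

open Subgroup in
lemma aux_burnside {p : ℕ} (hp : p.Prime) {X : Type*} [Group X] [Finite X] (hX : IsPPerf p X)
    (hgcd : (Nat.card X).Coprime (p - 1)) (m : ℕ) (hm : ¬ p ∣ m) (hc : Nat.card X = p * m) :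
    False := by
  have := Fact.mk hp
  obtain ⟨P⟩ : Nonempty (Sylow p X) := inferInstance
  have hPc : Nat.card P = p := by
    rw [P.card_eq_multiplicity, hc, Nat.factorization_mul hp.ne_zero (by rintro rfl; simp at hm)]
    simp [hp.factorization_self, Nat.factorization_eq_zero_of_not_dvd hm]
  have hcyc : IsCyclic P := isCyclic_of_prime_card hPc
  have hn : normalizer P ≤ centralizer (P : Set X) := by
    have key := card_dvd_of_injective _ (QuotientGroup.kerLift_injective P.normalizerMonoidHom)
    rw [normalizerMonoidHom_ker, ← index, ← relIndex] at key
    refine relIndex_eq_one.mp (Nat.eq_one_of_dvd_coprimes ?_ dvd_rfl key)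
    rw [hcyc.card_mulAut, hPc, Nat.totient_prime hp]
    apply Nat.Coprime.coprime_dvd_left <| relIndex_dvd_card ..
    apply Nat.Coprime.coprime_dvd_left <| card_subgroup_dvd_card _
    exact hgcd
  have h1 := MonoidHom.ker_transferSylow_isComplement' P hn
  have h2 := MonoidHom.not_dvd_card_ker_transferSylow P hn
  rw [hX (MonoidHom.transferSylow P hn).ker inferInstance ⟨1, by rw [h1.symm.index_eq_card, pow_one]; exact hPc⟩] at h2
  apply h2
  rw [card_top, hc]
  exact dvd_mul_right _ _

open Subgroup in
/-- abelian case -/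
lemma aux_abelian {p : ℕ} (hp : p.Prime) {G : Type*} [Group G] [Finite G] (Q K P : Subgroup G)
    [Q.Normal] [K.Normal] (hQK : Q ≤ K) (hQP : Q ≤ P) (hQ : IsPGroup p Q)
    (hidx : ¬ p ∣ Q.relIndex K) (hK : IsPPerf p K)
    (hcomm : ∀ x ∈ Q, ∀ y ∈ Q, x * y = y * x)
    (hfr : ∀ X : Subgroup G, X ≤ P → P ≤ Q ⊔ X → X = P) : Q = ⊥ := by
  have := Fact.mk hp
  have hAc : IsMulCommutative (Q.subgroupOf K) := by
    refine ⟨⟨fun a b => ?_⟩⟩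
    apply Subtype.ext
    apply Subtype.ext
    exact hcomm _ a.2 _ b.2
  obtain ⟨k, hk⟩ := IsPGroup.iff_card.1 hQ
  have hcard : Nat.card (Q.subgroupOf K) = p ^ k := by
    rw [← hk]; exact Nat.card_congr (subgroupOfEquivOfLe hQK).toEquiv
  have hcop : Nat.Coprime (Nat.card (Q.subgroupOf K)) (Q.subgroupOf K).index := by
    rw [hcard]
    exact Nat.Coprime.pow_left _ ((Nat.Prime.coprime_iff_not_dvd hp).2 hidx)
  obtain ⟨H, hH⟩ := exists_left_complement'_of_coprime hcop
  set H' : Subgroup G := H.map K.subtype with hH'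
  have hH'K : H' ≤ K := map_subtype_le H
  have hsub : H'.subgroupOf K = H := by
    rw [hH', subgroupOf, comap_map_eq_self_of_injective K.subtype_injective]
  have hdisj : Q ⊓ H' = ⊥ := by
    rw [eq_bot_iff]
    rintro x ⟨hxQ, hx⟩
    have hxK := hQK hxQ
    have h1 : (⟨x, hxK⟩ : K) ∈ H := by rw [← hsub]; exact hx
    have h2 : (⟨x, hxK⟩ : K) ∈ Q.subgroupOf K := hxQ
    have := hH.disjoint.le_bot ⟨h1, h2⟩
    exact congrArg Subtype.val (this : (⟨x, hxK⟩ : K) = 1)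
  -- Frattini argument
  have hPle : P ≤ Q ⊔ (normalizer (H' : Set G) ⊓ P) := by
    intro g hg
    let φ : K ≃* K := MulAut.conjNormal g
    have hcompl : IsComplement' (H.map φ.toMonoidHom) (Q.subgroupOf K) := by
      apply isComplement'_of_coprime
      · have e1 : Nat.card (H.map φ.toMonoidHom) = Nat.card H :=
          card_map_of_injective φ.injective
        rw [e1]
        exact hH.card_mul_card
      · have e1 : Nat.card (H.map φ.toMonoidHom) = Nat.card H :=
          card_map_of_injective φ.injective
        rw [e1, ← hH.index_eq_card]
        exact hcop.symm
    obtain ⟨a, haQ, ha⟩ := aux_conj (Q.subgroupOf K) hcop H _ hH hcompl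
    have haQ' : (a : G) ∈ Q := haQ
    have hn : (a : G)⁻¹ * g ∈ normalizer (H' : Set G) := by
      have hle : H'.map (MulAut.conj ((a : G)⁻¹ * g)).toMonoidHom ≤ H' := by
        rintro _ ⟨_, ⟨y, hy, rfl⟩, rfl⟩
        have h1 : φ y ∈ H.map φ.toMonoidHom := ⟨y, hy, rfl⟩
        rw [ha] at h1
        obtain ⟨z, hz, hzy⟩ := h1
        refine ⟨z, hz, ?_⟩
        have h2 : (a : G) * z * (a : G)⁻¹ = g * y * g⁻¹ := congrArg Subtype.val hzy
        change (z : G) = (a : G)⁻¹ * g * y * ((a : G)⁻¹ * g)⁻¹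
        have h3 : (z : G) = (a : G)⁻¹ * (g * y * g⁻¹) * a := by rw [← h2]; group
        rw [h3]; group
      have heq : H'.map (MulAut.conj ((a : G)⁻¹ * g)).toMonoidHom = H' := by
        apply eq_of_le_of_card_ge hle
        exact (card_map_of_injective (MulAut.conj ((a : G)⁻¹ * g)).injective).ge
      rw [mem_normalizer_iff]
      intro h
      conv_rhs => rw [← heq]
      constructor
      · intro hh; exact ⟨h, hh, rfl⟩
      · rintro ⟨y, hy, hyh⟩
        have : y = h := (MulAut.conj ((a : G)⁻¹ * g)).injective hyh
        exact this ▸ hy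
    have hgeq : g = a * ((a : G)⁻¹ * g) := by group
    rw [hgeq]
    exact mul_mem_sup haQ' ⟨hn, P.mul_mem (P.inv_mem (hQP haQ')) hg⟩
  have hPN : P ≤ normalizer (H' : Set G) := by
    rw [← hfr _ inf_le_right hPle]; exact inf_le_left
  have hsup : H ⊔ Q.subgroupOf K = ⊤ := hH.sup_eq_top
  have hHn : H.Normal := by
    rw [← normalizer_eq_top_iff, eq_top_iff, ← hsup]
    refine sup_le le_normalizer ?_
    intro x hx
    have hx' : (x : G) ∈ normalizer (H' : Set G) := hPN (hQP hx)
    rw [mem_normalizer_iff] at hx' ⊢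
    intro h
    have := hx' h
    have e : ∀ y : K, y ∈ H ↔ (y : G) ∈ H' := by
      intro y; conv_lhs => rw [← hsub]
      rfl
    rw [e, e]
    exact this
  have hHtop := hK H hHn ⟨k, by rw [hH.symm.index_eq_card, hcard]⟩
  rw [eq_bot_iff, ← hdisj]
  refine le_inf le_rfl (hQK.trans ?_)
  intro x hx
  exact ⟨⟨x, hx⟩, hHtop ▸ mem_top _, rfl⟩

open Subgroup in
lemma aux_general {p : ℕ} (hp : p.Prime) {G : Type*} [Group G] [Finite G] (Q K P : Subgroup G)
    [Q.Normal] [K.Normal] (hQK : Q ≤ K) (hQP : Q ≤ P) (hQ : IsPGroup p Q)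
    (hidx : ¬ p ∣ Q.relIndex K) (hK : IsPPerf p K)
    (hfr : ∀ X : Subgroup G, X ≤ P → P ≤ Q ⊔ X → X = P) : Q = ⊥ := by
  have := Fact.mk hp
  let f := QuotientGroup.mk' ⁅Q, Q⁆
  have hf : Function.Surjective f := QuotientGroup.mk'_surjective _
  have hker : f.ker = ⁅Q, Q⁆ := QuotientGroup.ker_mk' _
  have hle : ⁅Q, Q⁆ ≤ Q := commutator_le_left Q Q
  have hcm : ∀ X : Subgroup G, Q ≤ X → (X.map f).comap f = X := by
    intro X hX
    rw [comap_map_eq, hker, sup_eq_left]; exact hle.trans hX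
  have hQn : (Q.map f).Normal := Normal.map inferInstance f hf
  have hKn : (K.map f).Normal := Normal.map inferInstance f hf
  have hbot := aux_abelian hp (Q.map f) (K.map f) (P.map f) (map_mono hQK) (map_mono hQP)
    (hQ.map f) (by
      rw [relIndex_map_map, hker, sup_eq_left.2 hle, sup_eq_left.2 (hle.trans hQK)]; exact hidx)
    (hK.of_surjective (f.subgroupMap K) (f.subgroupMap_surjective K))
    (by
      rintro _ ⟨x, hx, rfl⟩ _ ⟨y, hy, rfl⟩
      have : x * y * (y * x)⁻¹ ∈ f.ker := by
        rw [hker]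
        have := commutator_mem_commutator hx hy
        rw [commutatorElement_def] at this
        simpa [mul_assoc] using this
      rw [MonoidHom.mem_ker, map_mul, map_inv, mul_inv_eq_one, map_mul, map_mul] at this
      exact this)
    (by
      intro X hX hPX
      have h1 := hfr (X.comap f) (by rw [← hcm P hQP]; exact comap_mono hX) (by
        rw [← hcm P hQP]
        intro g hg
        have h2 : f g ∈ Q.map f ⊔ X := hPX hg
        rw [mem_sup_of_normal_left] at h2
        obtain ⟨_, ⟨y, hy, rfl⟩, z, hz, hyz⟩ := h2
        have : g = y * (y⁻¹ * g) := by group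
        rw [this]
        refine mul_mem_sup hy ?_
        change f (y⁻¹ * g) ∈ X
        rw [map_mul, ← hyz]
        simpa using hz)
      rw [← h1, map_comap_eq_self_of_surjective hf])
  have hQQ : Q ≤ ⁅Q, Q⁆ := by
    rw [← hker]; exact (map_eq_bot_iff Q).1 hbot
  by_contra hne
  have hnt : Nontrivial Q := (nontrivial_iff_ne_bot Q).2 hne
  have : Group.IsNilpotent Q := hQ.isNilpotent
  have : Group.IsSolvable Q := inferInstance
  have hlt := Group.IsSolvable.commutator_lt_top_of_nontrivial Q
  apply hlt.ne
  rw [eq_top_iff]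
  intro x _
  have h1 := hQQ x.2
  rw [← map_subtype_commutator] at h1
  obtain ⟨y, hy, hyx⟩ := h1
  have : y = x := Subtype.ext hyx
  exact this ▸ hy

open Subgroup in
lemma aux_max_index {p : ℕ} (hp : p.Prime) {P : Type*} [Group P] [Finite P] (hP : IsPGroup p P)
    (M : Subgroup P) (hM : IsCoatom M) : M.Normal ∧ M.index = p := by
  have := Fact.mk hp
  have hnil : Group.IsNilpotent P := hP.isNilpotent
  have hn : M.Normal := NormalizerCondition.normal_of_coatom _
    Group.normalizerCondition_of_isNilpotent hM
  refine ⟨hn, ?_⟩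
  obtain ⟨m, hm⟩ := IsPGroup.iff_card.1 hP
  obtain ⟨n, hn⟩ := IsPGroup.iff_card.1 (hP.to_subgroup M)
  have hmul := M.card_mul_index
  have hidx : M.index ≠ 1 := fun h => hM.1 (index_eq_one.1 h)
  have hnm : n + 1 ≤ m := by
    by_contra hlt
    have : p ^ m ∣ p ^ n := pow_dvd_pow _ (by omega)
    apply hM.1
    apply eq_top_of_le_card
    rw [hm, hn]
    exact Nat.le_of_dvd (pow_pos hp.pos _) this
  obtain ⟨K, hK, hMK⟩ := Sylow.exists_subgroup_card_pow_prime_le p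
    (hm ▸ pow_dvd_pow p hnm : p ^ (n + 1) ∣ Nat.card P) M hn (Nat.le_succ n)
  have hlt : M < K := by
    refine lt_of_le_of_ne hMK ?_
    rintro rfl
    rw [hn] at hK
    have := Nat.pow_right_injective hp.two_le hK
    omega
  have hKt := hM.2 K hlt
  rw [hKt, card_top, ← hmul, hn, pow_succ] at hK
  exact Nat.eq_of_mul_eq_mul_left (pow_pos hp.pos n) hK

open Subgroup in
lemma aux_max {p : ℕ} (hp : p.Prime) {G : Type*} [Group G] [Finite G] (P M Q : Subgroup G)
    (hP : IsPGroup p P) (hM : IsMaximalSubgroupOf M P) (hQ : Q ≤ P) (hQM : ¬ Q ≤ M) :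
    M.relIndex Q = p := by
  have hco : IsCoatom (M.subgroupOf P) := by
    refine ⟨fun h => hM.1.not_ge (subgroupOf_eq_top.1 h), ?_⟩
    intro X hX
    have h1 : M < X.map P.subtype := by
      have := (map_subtype_lt_map_subtype (H := M.subgroupOf P) (K := X)).2 hX
      rwa [map_subgroupOf_eq_of_le hM.1.le] at this
    have h2 := hM.2 _ h1 (map_subtype_le X)
    rw [eq_top_iff]
    intro x _
    have h3 : (x : G) ∈ X.map P.subtype := h2.ge x.2
    obtain ⟨y, hy, hyx⟩ := h3
    have : y = x := Subtype.ext hyx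
    exact this ▸ hy
  obtain ⟨hn, hi⟩ := aux_max_index hp hP _ hco
  have h1 : (M.subgroupOf P).relIndex (Q.subgroupOf P) ∣ p :=
    hi ▸ relIndex_dvd_index_of_normal _ _
  rw [relIndex_subgroupOf hQ] at h1
  exact (hp.eq_one_or_self_of_dvd _ h1).resolve_left (fun h => hQM (relIndex_eq_one.1 h))

lemma aux_exists_max {G : Type*} [Group G] [Finite G] (P X : Subgroup G) (h : X < P) :
    ∃ M, IsMaximalSubgroupOf M P ∧ X ≤ M := by
  obtain ⟨M, hXM, hM⟩ := Finite.exists_le_maximal (p := fun M : Subgroup G => M < P) h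
  refine ⟨M, ⟨hM.prop, ?_⟩, hXM⟩
  intro K hMK hKP
  by_contra hne
  exact hMK.not_ge (hM.le_of_ge (lt_of_le_of_ne hKP hne) hMK.le)

open Subgroup in
lemma aux_sylow_idx {p : ℕ} (hp : p.Prime) {G : Type*} [Group G] [Finite G] (P E : Subgroup G)
    (hP : IsSylowSubgroupOf p P E) : ¬ p ∣ P.relIndex E := by
  have := Fact.mk hp
  obtain ⟨hPE, hPp, hmax⟩ := hP
  let S : Sylow p E :=
    { P.subgroupOf E with
      isPGroup' := hPp.comap_subtype
      is_maximal' := by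
        intro R hR hle
        have hle' : P ≤ R.map E.subtype := by
          have := map_mono (f := E.subtype) hle
          change (P.subgroupOf E).map E.subtype ≤ _ at this
          rwa [map_subgroupOf_eq_of_le hPE] at this
        have h1 := hmax (R.map E.subtype) (map_subtype_le R) (hR.map _) hle'
        change R = P.subgroupOf E
        rw [← h1, subgroupOf, comap_map_eq_self_of_injective E.subtype_injective] }
  exact S.not_dvd_index

open Subgroup in
lemma aux_idx {p : ℕ} (hp : p.Prime) {G : Type*} [Group G] [Finite G] (P E : Subgroup G)
    [E.Normal] (hP : IsSylowSubgroupOf p P E) (hquot : IsPNilpotent p (G ⧸ E)) :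
    ¬ p ∣ (P ⊓ pRes p G).relIndex (pRes p G) := by
  have hPE := hP.1
  set K := pRes p G with hK
  have e1 : (P ⊓ K).relIndex (E ⊓ K) * (E ⊓ K).relIndex K = (P ⊓ K).relIndex K :=
    relIndex_mul_relIndex _ _ _ (inf_le_inf_right K hPE) inf_le_right
  rw [← e1]
  apply hp.not_dvd_mul
  · have e2 : (P ⊓ K).relIndex (E ⊓ K) = P.relIndex (E ⊓ K) := by
      rw [← inf_relIndex_right P (E ⊓ K), ← inf_assoc, inf_eq_left.2 hPE]
    rw [e2, aux_relIndex_normal]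
    intro hd
    apply aux_sylow_idx hp P E hP
    rw [← relIndex_mul_relIndex P (P ⊔ E ⊓ K) E le_sup_left (sup_le hPE inf_le_left)]
    exact hd.mul_right _
  · rw [inf_relIndex_right]
    obtain ⟨N, hN, hNp, hNi⟩ := hquot
    let f := QuotientGroup.mk' E
    have hf : Function.Surjective f := QuotientGroup.mk'_surjective E
    have hKN : K ≤ N.comap f := by
      have := hN.comap f
      apply pRes_le hp
      rwa [index_comap_of_surjective _ hf]
    intro hd
    apply hNp
    have hEker : f.ker = E := QuotientGroup.ker_mk' E
    have e3 : E.relIndex K = Nat.card (K.map f) := by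
      rw [← relIndex_ker, hEker]
    rw [e3] at hd
    exact hd.trans (card_dvd_of_le (map_le_iff_le_comap.2 hKN))

open Subgroup in
lemma aux_cnormal {p : ℕ} (hp : p.Prime) {G : Type*} [Group G] [Finite G] (M : Subgroup G)
    (hMp : IsPGroup p M) (h : M.IsCNormal) : (M ⊓ pRes p G).Normal := by
  have := Fact.mk hp
  obtain ⟨T, hT, hMT, hle⟩ := h
  have hTp : IsPGroup p (G ⧸ T) := by
    rw [isPGroup_iff_pow_pow_eq_one]
    intro g
    obtain ⟨g, rfl⟩ := QuotientGroup.mk_surjective g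
    have hg : g ∈ (M : Set G) * (T : Set G) := hMT ▸ Set.mem_univ g
    obtain ⟨m, hm, t, ht, rfl⟩ := hg
    obtain ⟨k, hk⟩ := isPGroup_iff_pow_pow_eq_one.1 hMp ⟨m, hm⟩
    refine ⟨k, ?_⟩
    have hk' : m ^ p ^ k = 1 := congrArg Subtype.val hk
    change ((m * t : G) : G ⧸ T) ^ p ^ k = 1
    rw [QuotientGroup.mk_mul, (QuotientGroup.eq_one_iff t).2 ht, mul_one,
      ← QuotientGroup.mk_pow, hk', QuotientGroup.mk_one]
  have hKT : pRes p G ≤ T := pRes_le hp T (IsPGroup.iff_card.1 hTp)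
  have : M ⊓ pRes p G = M.normalCore ⊓ pRes p G :=
    le_antisymm (le_inf ((inf_le_inf_left M hKT).trans hle) inf_le_right)
      (inf_le_inf_right _ M.normalCore_le)
  rw [this]
  infer_instance

open Subgroup in
lemma aux_le {p : ℕ} (hp : p.Prime) {G : Type*} [Group G] [Finite G]
    (hgcd : Nat.gcd (Nat.card G) (p - 1) = 1) (P M : Subgroup G)
    (hPp : IsPGroup p P) (hidx : ¬ p ∣ (P ⊓ pRes p G).relIndex (pRes p G))
    (hM : IsMaximalSubgroupOf M P) (hMc : M.IsCNormal) : P ⊓ pRes p G ≤ M := by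
  by_contra hQM
  have h1 := aux_max hp P M _ hPp hM inf_le_left hQM
  have hD := aux_cnormal hp M (hPp.to_le hM.1.le) hMc
  have hperf := pRes_perf hp G
  set K := pRes p G
  have e1 : (M ⊓ K).relIndex (P ⊓ K) = p := by
    rw [← h1, ← inf_relIndex_right M (P ⊓ K), ← inf_assoc, inf_eq_left.2 hM.1.le]
  have e2 : (M ⊓ K).relIndex K = p * (P ⊓ K).relIndex K := by
    rw [← relIndex_mul_relIndex (M ⊓ K) (P ⊓ K) K (inf_le_inf_right K hM.1.le) inf_le_right, e1]
  have hDn : ((M ⊓ K).subgroupOf K).Normal := inferInstance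
  refine aux_burnside hp (X := K ⧸ (M ⊓ K).subgroupOf K)
    (hperf.of_surjective (QuotientGroup.mk' _) (QuotientGroup.mk'_surjective _)) ?_ _ hidx e2
  apply Nat.Coprime.coprime_dvd_left _ hgcd
  exact (card_quotient_dvd_card _).trans (card_subgroup_dvd_card K)

theorem stmt9 {G : Type*} [Group G] [Fintype G] {p : ℕ}
    (hp : p.Prime) (hdvd : p ∣ Nat.card G)
    (hgcd : Nat.gcd (Nat.card G) (p - 1) = 1)
    (E : Subgroup G) [E.Normal] (hquot : IsPNilpotent p (G ⧸ E))
    (P : Subgroup G) (hP : IsSylowSubgroupOf p P E)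
    (h : ∀ M : Subgroup G, IsMaximalSubgroupOf M P → M.IsCNormal) :
    IsPNilpotent p G := by
  have := Fact.mk hp
  have hidx := aux_idx hp P E hP hquot
  have hQle : ∀ M, IsMaximalSubgroupOf M P → P ⊓ pRes p G ≤ M := fun M hM =>
    aux_le hp hgcd P M hP.2.1 hidx hM (h M hM)
  have hQn : (P ⊓ pRes p G).Normal := by
    by_cases hbot : P = ⊥
    · rw [hbot, bot_inf_eq]; infer_instance
    · obtain ⟨M, hM, -⟩ := aux_exists_max P ⊥ (bot_lt_iff_ne_bot.2 hbot)
      have : P ⊓ pRes p G = M ⊓ pRes p G :=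
        le_antisymm (le_inf (hQle M hM) inf_le_right) (inf_le_inf_right _ hM.1.le)
      rw [this]
      exact aux_cnormal hp M (hP.2.1.to_le hM.1.le) (h M hM)
  have hQ := aux_general hp (P ⊓ pRes p G) (pRes p G) P inf_le_right inf_le_left
    (hP.2.1.to_le inf_le_left) hidx (pRes_perf hp G) (by
      intro X hX hPX
      by_contra hne
      obtain ⟨M, hM, hXM⟩ := aux_exists_max P X (lt_of_le_of_ne hX hne)
      exact hM.1.not_ge (hPX.trans (sup_le (hQle M hM) hXM)))
  rw [hQ, Subgroup.relIndex_bot_left] at hidx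
  exact ⟨pRes p G, inferInstance, hidx, pRes_index hp G⟩
end

section
/- Let G be a finite group, let p be a prime divisor of |G| with gcd(|G|, p-1) = 1, and let E be a normal subgroup of G such that G/E is p-nilpotent. If E has a Sylow p-subgroup P such that every maximal subgroup of P either is S-quasinormal in G or has a p-nilpotent supplement in G, then G is p-nilpotent. -/
open scoped Pointwise

/-- The subgroup generated by all `q`-elements for primes `q ≠ p`. -/
def OpSub (p : ℕ) (G : Type*) [Group G] : Subgroup G :=
  Subgroup.closure {g | ∃ q : ℕ, q.Prime ∧ q ≠ p ∧ ∃ k : ℕ, g ^ (q ^ k) = 1}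

instance OpSub_normal (p : ℕ) (G : Type*) [Group G] : (OpSub p G).Normal := by
  refine ⟨fun n hn g => ?_⟩
  have : OpSub p G ≤ (OpSub p G).comap (MulAut.conj g).toMonoidHom := by
    conv_lhs => unfold OpSub
    rw [Subgroup.closure_le]
    rintro x ⟨q, hq, hqp, k, hk⟩
    refine Subgroup.subset_closure ⟨q, hq, hqp, k, ?_⟩
    rw [← map_pow, hk, map_one]
  simpa using this hn

theorem eq_one_of_two_primes {B : Type*} [Group B] {p q : ℕ} (hp : p.Prime) (hq : q.Prime)
    (hne : q ≠ p) {b : B} {k l : ℕ} (h1 : b ^ (q ^ k) = 1) (h2 : b ^ (p ^ l) = 1) : b = 1 := by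
  have h := Nat.dvd_gcd (orderOf_dvd_of_pow_eq_one h1) (orderOf_dvd_of_pow_eq_one h2)
  rw [((Nat.coprime_primes hq hp).2 hne).pow k l] at h
  exact orderOf_eq_one_iff.1 (Nat.dvd_one.1 h)

theorem OpSub_le_ker {G B : Type*} [Group G] [Group B] {p : ℕ} (hp : p.Prime)
    (hB : IsPGroup p B) (f : G →* B) : OpSub p G ≤ f.ker := by
  unfold OpSub
  rw [Subgroup.closure_le]
  rintro x ⟨q, hq, hqp, k, hk⟩
  obtain ⟨l, hl⟩ := hB (f x)
  exact eq_one_of_two_primes hp hq hqp (by rw [← map_pow, hk, map_one]) hl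

theorem OpSub_hom {G B : Type*} [Group G] [Group B] {p : ℕ} (hp : p.Prime)
    (hB : IsPGroup p B) (f : OpSub p G →* B) (x : OpSub p G) : f x = 1 := by
  have : OpSub p G ≤ f.ker.map (OpSub p G).subtype := by
    conv_lhs => unfold OpSub
    rw [Subgroup.closure_le]
    rintro x ⟨q, hq, hqp, k, hk⟩
    have hx : x ∈ OpSub p G := Subgroup.subset_closure ⟨q, hq, hqp, k, hk⟩
    refine ⟨⟨x, hx⟩, ?_, rfl⟩
    obtain ⟨l, hl⟩ := hB (f ⟨x, hx⟩)
    refine eq_one_of_two_primes hp hq hqp (k := k) ?_ hl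
    rw [← map_pow]
    have : (⟨x, hx⟩ : OpSub p G) ^ q ^ k = 1 := Subtype.ext (by simpa using hk)
    rw [this, map_one]
  obtain ⟨y, hy, hyx⟩ := this x.2
  rw [← Subtype.ext hyx]
  exact hy

theorem OpSub_index {G : Type*} [Group G] [Finite G] {p : ℕ} :
    ∃ k, (OpSub p G).index = p ^ k := by
  refine ⟨_, Nat.eq_prime_pow_of_unique_prime_dvd Subgroup.index_ne_zero_of_finite ?_⟩
  intro d hd hdvd
  by_contra hne
  have := Fact.mk hd
  obtain ⟨D⟩ : Nonempty (Sylow d G) := inferInstance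
  have hle : (D : Subgroup G) ≤ OpSub p G := by
    intro x hx
    obtain ⟨k, hk⟩ := D.2 ⟨x, hx⟩
    exact Subgroup.subset_closure ⟨d, hd, hne, k, by simpa using congrArg Subtype.val hk⟩
  exact D.not_dvd_index (hdvd.trans (Subgroup.index_dvd_of_le hle))

/-- The averaging homomorphism. -/
theorem core_delta {G A : Type*} [Group G] [Finite G] [CommGroup A] (T S P : Subgroup G) [T.Normal]
    (hPS : P ≤ S) (z : G → A)
    (hz : ∀ a ∈ S ⊓ T, ∀ b ∈ S ⊓ T, z (a * b) = z a * z b)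
    (hinv : ∀ y ∈ P, ∀ q ∈ S ⊓ T, z (y⁻¹ * q * y) = z q)
    (hrep : ∀ α : G ⧸ S, ∃ t ∈ T, (t : G ⧸ S) = α)
    (hT : ∀ (f : T →* A) (x : T), f x = 1)
    (Z : Subgroup A) (hZ : ∀ q ∈ S ⊓ T, z q ∈ Z) :
    ∃ δ : P →* A, (∀ y, δ y ∈ Z) ∧
      (∀ y : P, (y : G) ∈ S ⊓ T → δ y = (z y)⁻¹ ^ S.index) ∧
      ∀ (x : P) (t : G ⧸ S → G), (∀ α, t α ∈ T) → (∀ α, ((t α : G) : G ⧸ S) = α) →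
        (∀ α, (x : G) * t α = t ((x : G) • α) * x) → δ x = 1 := by
  classical
  have := Fintype.ofFinite (G ⧸ S)
  choose t htT htα using hrep
  have hz1 : z 1 = 1 := by
    have := hz 1 (one_mem _) 1 (one_mem _)
    simpa using this
  have hzinv : ∀ a ∈ S ⊓ T, z a⁻¹ = (z a)⁻¹ := by
    intro a ha
    have := hz a ha a⁻¹ (inv_mem ha)
    rw [mul_inv_cancel, hz1] at this
    exact (inv_eq_of_mul_eq_one_right this.symm).symm
  -- the cocycle
  let c : (G ⧸ S → G) → G → G ⧸ S → G := fun t g α => (t (g • α))⁻¹ * g * t α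
  have hcmul : ∀ t g h α, c t (g * h) α = c t g (h • α) * c t h α := by
    intro t g h α
    simp only [c, mul_smul]
    group
  have hcS : ∀ t : G ⧸ S → G, (∀ α, ((t α : G) : G ⧸ S) = α) → ∀ g α, c t g α ∈ S := by
    intro t ht g α
    simp only [c, mul_assoc]
    rw [← QuotientGroup.eq, ht, ← smul_eq_mul, ← MulAction.Quotient.smul_coe, ht]
  have hcT : ∀ t : G ⧸ S → G, (∀ α, t α ∈ T) → ∀ g α, g⁻¹ * c t g α ∈ T := by
    intro t ht g α
    have : g⁻¹ * c t g α = (g⁻¹ * (t (g • α))⁻¹ * g⁻¹⁻¹) * t α := by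
      simp only [c]; group
    rw [this]
    exact mul_mem (Subgroup.Normal.conj_mem inferInstance _ (inv_mem (ht _)) _) (ht _)
  have hQ : ∀ t : G ⧸ S → G, (∀ α, t α ∈ T) → (∀ α, ((t α : G) : G ⧸ S) = α) → ∀ y ∈ P, ∀ α,
      y⁻¹ * c t y α ∈ S ⊓ T := fun t h1 h2 y hy α =>
    Subgroup.mem_inf.2 ⟨mul_mem (inv_mem (hPS hy)) (hcS t h2 y α), hcT t h1 y α⟩
  have hV : ∀ x ∈ T, ∏ α, z (c t x α) = 1 := by
    have hcQ : ∀ x ∈ T, ∀ α, c t x α ∈ S ⊓ T := by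
      intro x hx α
      refine ⟨hcS t htα x α, ?_⟩
      have := mul_mem hx (hcT t htT x α)
      simpa using this
    let V : T →* A := MonoidHom.mk' (fun x => ∏ α, z (c t x α)) (by
      intro x y
      simp only [Subgroup.coe_mul, hcmul]
      rw [← Equiv.prod_comp (MulAction.toPerm (y : G) : Equiv.Perm (G ⧸ S)) (fun α => z (c t x α)),
        ← Finset.prod_mul_distrib]
      refine Finset.prod_congr rfl fun α _ => ?_
      exact hz _ (hcQ x x.2 _) _ (hcQ y y.2 _))
    intro x hx
    exact hT V ⟨x, hx⟩
  let δ : P →* A := MonoidHom.mk' (fun y => ∏ α, z ((y : G)⁻¹ * c t y α)) (by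
    intro x y
    rw [← Equiv.prod_comp (MulAction.toPerm (y : G) : Equiv.Perm (G ⧸ S))
      (fun α => z ((x : G)⁻¹ * c t x α)), ← Finset.prod_mul_distrib]
    refine Finset.prod_congr rfl fun α _ => ?_
    simp only [Subgroup.coe_mul, hcmul, MulAction.toPerm_apply]
    rw [← hinv y y.2 _ (hQ t htT htα x x.2 ((y : G) • α)), ← hz]
    · congr 1; group
    · have h1 := hQ t htT htα x x.2 ((y : G) • α)
      refine Subgroup.mem_inf.2 ⟨mul_mem (mul_mem (inv_mem (hPS y.2)) h1.1) (hPS y.2), ?_⟩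
      have := Subgroup.Normal.conj_mem (inferInstance : T.Normal) _ h1.2 (y : G)⁻¹
      simpa using this
    · exact hQ t htT htα y y.2 α)
  refine ⟨δ, fun y => Subgroup.prod_mem _ fun α _ => hZ _ (hQ t htT htα y y.2 α), ?_, ?_⟩
  · intro y hy
    have h1 : δ y = ∏ α, (z y)⁻¹ * z (c t y α) := by
      refine Finset.prod_congr rfl fun α _ => ?_
      rw [← hzinv _ hy, ← hz _ (inv_mem hy)]
      have := mul_mem hy (hQ t htT htα y y.2 α)
      simpa using this
    rw [h1, Finset.prod_mul_distrib, hV _ hy.2, mul_one, Finset.prod_const, Finset.card_univ,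
      Subgroup.index, Nat.card_eq_fintype_card]
  · intro x t' h1 h2 h3
    have hu : ∀ α, (t α)⁻¹ * t' α ∈ S ⊓ T := by
      intro α
      refine Subgroup.mem_inf.2 ⟨?_, mul_mem (inv_mem (htT α)) (h1 α)⟩
      rw [← QuotientGroup.eq, h2, htα]
    have hc' : ∀ α, c t' x α = x := by
      intro α
      simp only [c, mul_assoc, h3]
      group
    have key : ∀ α, z ((x : G)⁻¹ * c t x α) =
        z ((t ((x : G) • α))⁻¹ * t' ((x : G) • α)) * (z ((t α)⁻¹ * t' α))⁻¹ := by
      intro α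
      rw [← hzinv _ (hu α), ← hinv x x.2 _ (hu ((x : G) • α)), ← hz]
      · congr 1
        have : (x : G) = (t' ((x : G) • α))⁻¹ * x * t' α := (hc' α).symm
        calc (x : G)⁻¹ * c t x α = (x : G)⁻¹ * ((t ((x : G) • α))⁻¹ * t' ((x : G) • α)) *
              ((t' ((x : G) • α))⁻¹ * x * t' α) * ((t α)⁻¹ * t' α)⁻¹ := by
              simp only [c]; group
          _ = _ := by rw [← this]
      · have h1 := hu ((x : G) • α)
        refine Subgroup.mem_inf.2 ⟨mul_mem (mul_mem (inv_mem (hPS x.2)) h1.1) (hPS x.2), ?_⟩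
        have := Subgroup.Normal.conj_mem (inferInstance : T.Normal) _ h1.2 (x : G)⁻¹
        simpa using this
      · exact inv_mem (hu α)
    change ∏ α, z ((x : G)⁻¹ * c t x α) = 1
    have hre := Equiv.prod_comp (MulAction.toPerm (x : G) : Equiv.Perm (G ⧸ S))
        (fun α => z ((t α)⁻¹ * t' α))
    simp only [MulAction.toPerm_apply] at hre
    rw [Finset.prod_congr rfl fun α _ => key α, Finset.prod_mul_distrib, hre,
      ← Finset.prod_mul_distrib]
    simp

theorem card_mul_dvd {G : Type*} [Group G] [Finite G] (M K : Subgroup G) :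
    ∃ d, d ∣ Nat.card M ∧ Nat.card ((M : Set G) * (K : Set G) : Set G) = Nat.card K * d := by
  refine ⟨_, ?_, Subgroup.card_mul_eq_card_subgroup_mul_card_quotient K (M : Set G)⟩
  have h1 : (Set.image (fun x : G => (x : G ⧸ K)) (M : Set G)) = MulAction.orbit M ((1 : G) : G ⧸ K) := by
    ext a
    constructor
    · rintro ⟨m, hm, rfl⟩
      refine ⟨⟨m, hm⟩, ?_⟩
      change ((m * 1 : G) : G ⧸ K) = _
      rw [mul_one]
    · rintro ⟨m, rfl⟩
      refine ⟨m, m.2, ?_⟩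
      change _ = (((m : G) * 1 : G) : G ⧸ K)
      rw [mul_one]
  rw [Nat.card_coe_set_eq, h1, ← MulAction.index_stabilizer]
  exact Subgroup.index_dvd_card _

theorem le_sylow_of_permutes {G : Type*} [Group G] [Finite G] {p : ℕ} [Fact p.Prime]
    {M : Subgroup G} (hM : IsPGroup p M) (S : Sylow p G)
    (h : (M : Set G) * ((S : Subgroup G) : Set G) = ((S : Subgroup G) : Set G) * (M : Set G)) :
    M ≤ S := by
  let H : Subgroup G :=
    { carrier := (M : Set G) * ((S : Subgroup G) : Set G)
      one_mem' := ⟨1, one_mem _, 1, one_mem _, mul_one _⟩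
      mul_mem' := by
        rintro _ _ ⟨m, hm, s, hs, rfl⟩ ⟨m', hm', s', hs', rfl⟩
        have : s * m' ∈ (M : Set G) * ((S : Subgroup G) : Set G) := by
          rw [h]; exact ⟨s, hs, m', hm', rfl⟩
        obtain ⟨a, ha, b, hb, hab⟩ := this
        refine ⟨m * a, mul_mem hm ha, b * s', mul_mem hb hs', ?_⟩
        simp only at hab ⊢
        calc m * a * (b * s') = m * (a * b) * s' := by group
          _ = _ := by rw [hab]; group
      inv_mem' := by
        rintro _ ⟨m, hm, s, hs, rfl⟩
        rw [h]
        exact ⟨s⁻¹, inv_mem hs, m⁻¹, inv_mem hm, by simp⟩ }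
  have hMH : M ≤ H := fun m hm => ⟨m, hm, 1, one_mem _, mul_one _⟩
  have hSH : (S : Subgroup G) ≤ H := fun s hs => ⟨1, one_mem _, s, hs, one_mul _⟩
  obtain ⟨d, hd, hcard⟩ := card_mul_dvd M (S : Subgroup G)
  obtain ⟨a, ha⟩ := hM.exists_card_eq
  obtain ⟨b, hb⟩ := S.2.exists_card_eq
  have hH : IsPGroup p H := by
    refine IsPGroup.of_card_dvd_pow (n := b + a) ?_
    have h2 : Nat.card H = Nat.card (S : Subgroup G) * d := hcard
    rw [h2, pow_add, ← ha]
    exact mul_dvd_mul (dvd_of_eq hb) hd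
  rw [← S.3 hH hSH]
  exact hMH

theorem OpSub_le_normalizer {G : Type*} [Group G] [Finite G] {p : ℕ} (hp : p.Prime)
    {M : Subgroup G} (hM : IsPGroup p M) (h : M.IsSQuasinormal) :
    ∀ x ∈ OpSub p G, ∀ m ∈ M, x * m * x⁻¹ ∈ M := by
  have := Fact.mk hp
  suffices OpSub p G ≤ Subgroup.normalizer (M : Set G) by
    intro x hx m hm
    exact (Subgroup.mem_normalizer_iff.1 (this hx) m).1 hm
  unfold OpSub
  rw [Subgroup.closure_le]
  rintro x ⟨q, hq, hqp, k, hk⟩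
  have := Fact.mk hq
  have hxq : IsPGroup q (Subgroup.zpowers x) :=
    IsPGroup.of_card_dvd_pow (n := k) (by
      rw [Nat.card_zpowers]; exact orderOf_dvd_of_pow_eq_one hk)
  obtain ⟨D, hD⟩ := hxq.exists_le_sylow
  have hxD : x ∈ D := hD (Subgroup.mem_zpowers x)
  have main : ∀ y ∈ D, ∀ m ∈ M, y * m * y⁻¹ ∈ M := by
    intro y hy m hm
    obtain ⟨S⟩ : Nonempty (Sylow p G) := inferInstance
    have hyS : y * m * y⁻¹ ∈ S := by
      have hm' : m ∈ y⁻¹ • S := le_sylow_of_permutes hM (y⁻¹ • S) (h p hp _) hm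
      rw [Sylow.smul_def] at hm'
      obtain ⟨s, hs, hsm⟩ := hm'
      have : y * m * y⁻¹ = s := by
        rw [← hsm]; simp [MulAut.smul_def, mul_assoc]
      rw [this]; exact hs
    have h2 : y * m ∈ (M : Set G) * ((D : Subgroup G) : Set G) := by
      rw [h q hq D]; exact ⟨y, hy, m, hm, rfl⟩
    obtain ⟨m', hm', z, hz, hmz⟩ := h2
    simp only at hmz
    have h3 : z * y⁻¹ = m'⁻¹ * (y * m * y⁻¹) := by rw [← hmz]; group
    have h4 : z * y⁻¹ = 1 := by
      obtain ⟨a, ha⟩ := D.2 ⟨z * y⁻¹, mul_mem hz (inv_mem hy)⟩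
      have h5 : z * y⁻¹ ∈ (S : Subgroup G) := by
        rw [h3]
        exact mul_mem (inv_mem (le_sylow_of_permutes hM S (h p hp _) hm')) hyS
      obtain ⟨b, hb⟩ := S.2 ⟨z * y⁻¹, h5⟩
      exact eq_one_of_two_primes hp hq hqp (by simpa using congrArg Subtype.val ha)
        (by simpa using congrArg Subtype.val hb)
    rw [h4] at h3
    have : y * m * y⁻¹ = m' := by
      have := congrArg (m' * ·) h3
      simpa using this.symm
    rw [this]; exact hm'
  change x ∈ Subgroup.normalizer (M : Set G)
  rw [Subgroup.mem_normalizer_iff]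
  refine fun m => ⟨main x hxD m, fun hm => ?_⟩
  have := main x⁻¹ (inv_mem hxD) _ hm
  simpa [mul_assoc] using this

/-- Burnside with the gcd hypothesis. -/
theorem cyclic_normalizer_le {G : Type*} [Group G] [Finite G] {p : ℕ} [Fact p.Prime]
    (hgcd : Nat.gcd (Nat.card G) (p - 1) = 1) (P : Sylow p G) (hP : IsCyclic P) :
    Subgroup.normalizer P ≤ Subgroup.centralizer (P : Set G) := by
  have key := Subgroup.card_dvd_of_injective _
    (QuotientGroup.kerLift_injective P.normalizerMonoidHom)
  rw [Subgroup.normalizerMonoidHom_ker, ← Subgroup.index, ← Subgroup.relIndex] at key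
  refine Subgroup.relIndex_eq_one.mp (Nat.eq_one_of_dvd_coprimes ?_ dvd_rfl key)
  obtain ⟨k, hk⟩ := P.2.exists_card_eq
  rcases eq_zero_or_pos k with h0 | h0
  · rw [hP.card_mulAut, hk, h0, pow_zero, Nat.totient_one]
    apply Nat.coprime_one_right
  rw [hP.card_mulAut, hk, Nat.totient_prime_pow Fact.out h0]
  refine (Nat.Coprime.pow_right _ ?_).mul_right ?_
  · apply Nat.Coprime.coprime_dvd_left (Subgroup.relIndex_dvd_of_le_left _ P.le_centralizer)
    apply Nat.Coprime.coprime_dvd_left (Subgroup.relIndex_dvd_index_of_le P.le_normalizer)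
    rw [Nat.coprime_comm, Nat.Prime.coprime_iff_not_dvd Fact.out]
    exact P.not_dvd_index
  · apply Nat.Coprime.coprime_dvd_left <| Subgroup.relIndex_dvd_card ..
    apply Nat.Coprime.coprime_dvd_left <| Subgroup.card_subgroup_dvd_card _
    exact hgcd

/-- No nontrivial cyclic Sylow if there is no nontrivial map to `p`-groups. -/
theorem sylow_trivial_of_cyclic {G : Type*} [Group G] [Finite G] {p : ℕ} [Fact p.Prime]
    (hgcd : Nat.gcd (Nat.card G) (p - 1) = 1) (P : Sylow p G) (hP : IsCyclic P)
    (hG : ∀ (f : G →* P) (x : G), f x = 1) : ∀ x ∈ P, x = 1 := by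
  intro x hx
  have hN := cyclic_normalizer_le hgcd P hP
  have h1 := MonoidHom.transferSylow_eq_pow P hN x hx
  rw [hG] at h1
  have h2 : x ^ P.index = 1 := by simpa using (congrArg Subtype.val h1).symm
  obtain ⟨k, hk⟩ := P.2 ⟨x, hx⟩
  have hk' : x ^ p ^ k = 1 := by simpa using congrArg Subtype.val hk
  have h := Nat.dvd_gcd (orderOf_dvd_of_pow_eq_one h2) (orderOf_dvd_of_pow_eq_one hk')
  have hc : Nat.Coprime P.index (p ^ k) := by
    apply Nat.Coprime.pow_right
    rw [Nat.coprime_comm, Nat.Prime.coprime_iff_not_dvd Fact.out]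
    exact P.not_dvd_index
  rw [hc] at h
  exact orderOf_eq_one_iff.1 (Nat.dvd_one.1 h)

theorem commutator_lt_of_nilpotent {H : Type*} [Group H] [Group.IsNilpotent H] (Q : Subgroup H)
    (hQ : Q ≠ ⊥) : ¬ Q ≤ ⁅Q, (⊤ : Subgroup H)⁆ := by
  intro hle
  have h : ∀ n, Q ≤ (⊤ : Subgroup H).lowerCentralSeries n := by
    intro n
    induction n with
    | zero => exact le_top
    | succ n ih =>
      rw [Subgroup.lowerCentralSeries_succ]
      exact hle.trans (Subgroup.commutator_mono ih le_rfl)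
  have hn : Group.IsNilpotent (⊤ : Subgroup H) := inferInstance
  obtain ⟨n, hn⟩ := (Subgroup.isNilpotent_iff_lowerCentralSeries _).1 hn
  exact hQ (le_bot_iff.1 (hn ▸ h n))

theorem coprime_pow_eq_one {B : Type*} [Group B] {p n k : ℕ} (hp : p.Prime) (hn : ¬ p ∣ n)
    {b : B} (h1 : b ^ n = 1) (h2 : b ^ (p ^ k) = 1) : b = 1 := by
  have h := Nat.dvd_gcd (orderOf_dvd_of_pow_eq_one h1) (orderOf_dvd_of_pow_eq_one h2)
  have hc : Nat.Coprime n (p ^ k) := by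
    apply Nat.Coprime.pow_right
    rw [Nat.coprime_comm, Nat.Prime.coprime_iff_not_dvd hp]
    exact hn
  rw [hc] at h
  exact orderOf_eq_one_iff.1 (Nat.dvd_one.1 h)

theorem OpSub_quot {G : Type*} [Group G] [Finite G] {p : ℕ} : IsPGroup p (G ⧸ OpSub p G) := by
  obtain ⟨k, hk⟩ := OpSub_index (G := G) (p := p)
  exact IsPGroup.of_card (n := k) hk

theorem exists_section {G : Type*} [Group G] [Finite G] {p : ℕ} [hp : Fact p.Prime]
    {M K : Subgroup G} (hM : IsPGroup p M) (hMK : (M : Set G) * (K : Set G) = Set.univ)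
    (hK : IsPNilpotent p K) (S : Sylow p G) :
    ∃ N : Subgroup G, N ≤ OpSub p G ∧ (∀ x ∈ K, ∀ n ∈ N, x * n * x⁻¹ ∈ N) ∧
      ∃ t : G ⧸ (S : Subgroup G) → G, (∀ α, t α ∈ N) ∧
        (∀ α, ((t α : G) : G ⧸ (S : Subgroup G)) = α) ∧
        ∀ n ∈ N, t (n : G ⧸ (S : Subgroup G)) = n := by
  obtain ⟨N', hN', hdvd, k, hk⟩ := hK
  have hcard : Nat.card (N'.map K.subtype) = Nat.card N' :=
    Nat.card_congr (N'.equivMapOfInjective K.subtype K.subtype_injective).symm.toEquiv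
  have hpow : ∀ n ∈ N'.map K.subtype, n ^ Nat.card N' = 1 := by
    intro n hn
    rw [← hcard]
    have := pow_card_eq_one' (x := (⟨n, hn⟩ : N'.map K.subtype))
    simpa using congrArg Subtype.val this
  refine ⟨N'.map K.subtype, ?_, ?_, ?_⟩
  · intro n hn
    obtain ⟨l, hl⟩ := OpSub_quot (p := p) (n : G ⧸ OpSub p G)
    rw [← QuotientGroup.eq_one_iff]
    refine coprime_pow_eq_one hp.out hdvd ?_ hl
    rw [← QuotientGroup.mk_pow, hpow n hn, QuotientGroup.mk_one]
  · rintro x hx _ ⟨n, hn, rfl⟩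
    exact ⟨⟨x, hx⟩ * n * ⟨x, hx⟩⁻¹, hN'.conj_mem n hn _, rfl⟩
  · let f : N'.map K.subtype → G ⧸ (S : Subgroup G) := fun n => ((n : G) : G ⧸ (S : Subgroup G))
    have hinj : Function.Injective f := by
      intro a b hab
      have h1 : (a : G)⁻¹ * b ∈ (S : Subgroup G) := QuotientGroup.eq.1 hab
      obtain ⟨l, hl⟩ := S.2 ⟨_, h1⟩
      have : (a : G)⁻¹ * b = 1 :=
        coprime_pow_eq_one hp.out hdvd (hpow _ (mul_mem (inv_mem a.2) b.2))
          (by simpa using congrArg Subtype.val hl)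
      exact Subtype.ext (inv_mul_eq_one.1 this)
    have hcle : Nat.card (G ⧸ (S : Subgroup G)) ≤ Nat.card (N'.map K.subtype) := by
      rw [hcard]
      refine Nat.le_of_dvd Nat.card_pos ?_
      obtain ⟨d, hd, hcd⟩ := card_mul_dvd M K
      obtain ⟨a, ha⟩ := hM.exists_card_eq
      have hG : Nat.card G = Nat.card K * d := by
        rw [← hcd, hMK, Nat.card_congr (Equiv.Set.univ G)]
      have hKc : Nat.card K = Nat.card N' * p ^ k := by
        rw [← hk, Subgroup.card_mul_index]
      have h3 : (S : Subgroup G).index ∣ Nat.card N' * p ^ (k + a) := by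
        refine (Subgroup.index_dvd_card _).trans ?_
        rw [hG, hKc, pow_add, ← mul_assoc, ← ha]
        exact mul_dvd_mul_left _ hd
      have hc : Nat.Coprime (S : Subgroup G).index (p ^ (k + a)) := by
        apply Nat.Coprime.pow_right
        rw [Nat.coprime_comm, Nat.Prime.coprime_iff_not_dvd hp.out]
        exact S.not_dvd_index
      exact hc.dvd_of_dvd_mul_right h3
    have hbij : Function.Bijective f :=
      (Nat.bijective_iff_injective_and_card f).2 ⟨hinj, le_antisymm
        (Nat.card_le_card_of_injective f hinj) hcle⟩
    let e := Equiv.ofBijective f hbij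
    refine ⟨fun α => (e.symm α : G), fun α => (e.symm α).2, fun α => e.apply_symm_apply α, ?_⟩
    intro n hn
    have : e ⟨n, hn⟩ = (n : G ⧸ (S : Subgroup G)) := rfl
    change (e.symm (n : G ⧸ (S : Subgroup G)) : G) = n
    rw [← this, e.symm_apply_apply]

open scoped commutatorElement in
theorem exists_invariant_hom.{u} {G : Type u} [Group G] [Finite G] {p : ℕ} [hp : Fact p.Prime]
    (P Q : Subgroup G) (hP : IsPGroup p P) (hQP : Q ≤ P) (hQ : Q ≠ ⊥)
    (hnorm : ∀ y ∈ P, ∀ q ∈ Q, y * q * y⁻¹ ∈ Q) :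
    ∃ (A : Type u) (_ : CommGroup A) (ζ : Q →* A), IsPGroup p A ∧
      (∀ y ∈ P, ∀ q : Q, ∀ h : y⁻¹ * q * y ∈ Q, ζ ⟨y⁻¹ * q * y, h⟩ = ζ q) ∧ ∃ q, ζ q ≠ 1 := by
  have := hP.isNilpotent
  let Q' : Subgroup P := Q.subgroupOf P
  have hQ'n : Q'.Normal := ⟨fun n hn g => hnorm g g.2 n hn⟩
  let D : Subgroup P := ⁅Q', (⊤ : Subgroup P)⁆
  have hcomm : ∀ q ∈ Q', ∀ y : P, (QuotientGroup.mk (q * y) : P ⧸ D) = QuotientGroup.mk (y * q) := by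
    intro q hq y
    rw [QuotientGroup.eq]
    have : (q * y)⁻¹ * (y * q) = ⁅y⁻¹, q⁻¹⁆ := by simp [commutatorElement_def, mul_assoc]
    rw [this, ← commutatorElement_inv]
    exact inv_mem (Subgroup.commutator_mem_commutator (inv_mem hq) (Subgroup.mem_top _))
  have hmem : ∀ q ∈ Q', (QuotientGroup.mk q : P ⧸ D) ∈ Subgroup.center (P ⧸ D) := by
    intro q hq
    rw [Subgroup.mem_center_iff]
    intro g
    obtain ⟨y, rfl⟩ := QuotientGroup.mk_surjective g
    exact (hcomm q hq y).symm
  refine ⟨Subgroup.center (P ⧸ D),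
    { (inferInstance : Group (Subgroup.center (P ⧸ D))) with
      mul_comm := fun a b => Subtype.ext (Subgroup.mem_center_iff.1 b.2 a) },
    ((QuotientGroup.mk' D).comp (Subgroup.inclusion hQP)).codRestrict _ fun q => hmem _ q.2,
    (hP.to_quotient D).to_subgroup _, ?_, ?_⟩
  · intro y hy q h
    apply Subtype.ext
    change (QuotientGroup.mk (⟨y, hy⟩⁻¹ * ⟨q, hQP q.2⟩ * ⟨y, hy⟩ : P) : P ⧸ D) =
      QuotientGroup.mk (⟨q, hQP q.2⟩ : P)
    rw [mul_assoc, QuotientGroup.mk_mul, hcomm _ q.2, ← QuotientGroup.mk_mul, inv_mul_cancel_left]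
  · have hne : Q' ≠ ⊥ := by
      intro h
      rw [Subgroup.subgroupOf_eq_bot] at h
      exact hQ (by rw [← inf_eq_left.2 hQP]; exact h.eq_bot)
    obtain ⟨q, hq, hqD⟩ := SetLike.not_le_iff_exists.1 (commutator_lt_of_nilpotent Q' hne)
    refine ⟨⟨q, hq⟩, fun h => hqD ?_⟩
    exact (QuotientGroup.eq_one_iff _).1 (congrArg Subtype.val h)

theorem exists_rep {G : Type*} [Group G] [Finite G] {p : ℕ} [hp : Fact p.Prime] (S : Sylow p G) :
    (∀ g : G, ∃ t ∈ OpSub p G, ∃ s ∈ S, t * s = g) := by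
  obtain ⟨k, hk⟩ := OpSub_index (G := G) (p := p)
  have h1 : (OpSub p G ⊔ S).index = 1 := by
    have ha := Subgroup.index_dvd_of_le (le_sup_left : OpSub p G ≤ OpSub p G ⊔ S)
    have hb := Subgroup.index_dvd_of_le (le_sup_right : (S : Subgroup G) ≤ OpSub p G ⊔ S)
    have hc : Nat.Coprime (S : Subgroup G).index (p ^ k) := by
      apply Nat.Coprime.pow_right
      rw [Nat.coprime_comm, Nat.Prime.coprime_iff_not_dvd hp.out]
      exact S.not_dvd_index
    exact Nat.eq_one_of_dvd_coprimes hc hb (hk ▸ ha)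
  intro g
  have hg : g ∈ OpSub p G ⊔ S := by rw [Subgroup.index_eq_one.1 h1]; trivial
  obtain ⟨t, ht, s, hs, h⟩ := Subgroup.mem_sup_of_normal_left.1 hg
  exact ⟨t, ht, s, hs, h⟩

/-- the intersection of a Sylow subgroup with `O^p` has index prime to `p`. -/
theorem not_dvd_relIndex {G : Type*} [Group G] [Finite G] {p : ℕ} [hp : Fact p.Prime]
    (S : Sylow p G) : ¬ p ∣ ((S : Subgroup G).subgroupOf (OpSub p G)).index := by
  have h : ((S : Subgroup G).subgroupOf (OpSub p G)).index = (S : Subgroup G).index := by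
    have h1 : (S : Subgroup G).subgroupOf (OpSub p G) =
        MulAction.stabilizer (OpSub p G) ((1 : G) : G ⧸ (S : Subgroup G)) := by
      ext x
      rw [MulAction.mem_stabilizer_iff, Subgroup.mem_subgroupOf]
      change _ ↔ (((x : G) * 1 : G) : G ⧸ (S : Subgroup G)) = ((1 : G) : G ⧸ (S : Subgroup G))
      rw [mul_one, eq_comm, QuotientGroup.eq]
      simp
    rw [h1, MulAction.index_stabilizer, Subgroup.index, ← Set.ncard_univ]
    congr 1
    refine Set.eq_univ_of_forall fun a => ?_
    obtain ⟨g, rfl⟩ := QuotientGroup.mk_surjective a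
    obtain ⟨t, ht, s, hs, rfl⟩ := exists_rep S g
    refine ⟨⟨t, ht⟩, ?_⟩
    change ((t * 1 : G) : G ⧸ (S : Subgroup G)) = _
    rw [mul_one, QuotientGroup.eq]
    have h2 : t⁻¹ * (t * s) = s := by group
    rw [h2]; exact hs
  rw [h]
  exact S.not_dvd_index

/-- The S-quasinormal case. -/
theorem sqn_case {G : Type*} [Group G] [Finite G] {p : ℕ} [hp : Fact p.Prime]
    (hgcd : Nat.gcd (Nat.card G) (p - 1) = 1) (S : Sylow p G) (P M : Subgroup G)
    (hPS : P ≤ S) (hQP : (S : Subgroup G) ⊓ OpSub p G ≤ P) (hM : IsMaximalSubgroupOf M P)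
    (hsq : M.IsSQuasinormal) : (S : Subgroup G) ⊓ OpSub p G ≤ M := by
  by_contra hnot
  obtain ⟨q, hq, hqM⟩ := SetLike.not_le_iff_exists.1 hnot
  have hMp : IsPGroup p M := S.2.to_le (hM.1.le.trans hPS)
  have hnorm := OpSub_le_normalizer hp.out hMp hsq
  let R : Subgroup (OpSub p G) := M.subgroupOf (OpSub p G)
  have hR : R.Normal := ⟨fun n hn g => hnorm g g.2 n hn⟩
  have hP : M ⊔ Subgroup.zpowers q = P := by
    refine hM.2 _ (lt_of_le_of_ne le_sup_left fun h => hqM ?_) (sup_le hM.1.le ?_)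
    · rw [h]; exact Subgroup.mem_sup_right (Subgroup.mem_zpowers q)
    · rw [Subgroup.zpowers_le]; exact hQP hq
  have hzn : Subgroup.zpowers q ≤ Subgroup.normalizer (M : Set G) := by
    rw [Subgroup.zpowers_le, Subgroup.mem_normalizer_iff]
    refine fun m => ⟨hnorm q hq.2 m, fun h => ?_⟩
    have := hnorm q⁻¹ (inv_mem hq.2) _ h
    simpa [mul_assoc] using this
  have hdec : ∀ y ∈ P, ∃ m ∈ M, ∃ k : ℤ, m * q ^ k = y := by
    intro y hy
    rw [← hP, ← SetLike.mem_coe, Subgroup.coe_mul_of_right_le_normalizer_left _ _ hzn] at hy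
    obtain ⟨m, hm, z, ⟨k, rfl⟩, h⟩ := hy
    exact ⟨m, hm, k, h⟩
  let U : Subgroup (OpSub p G ⧸ R) :=
    ((S : Subgroup G).subgroupOf (OpSub p G)).map (QuotientGroup.mk' R)
  have hUp : IsPGroup p U :=
    IsPGroup.map (S.2.comap_of_injective (OpSub p G).subtype (OpSub p G).subtype_injective) _
  have hUi : ¬ p ∣ U.index := fun h => not_dvd_relIndex S
    (h.trans (Subgroup.index_map_dvd _ (QuotientGroup.mk'_surjective R)))
  let V : Sylow p (OpSub p G ⧸ R) := hUp.toSylow hUi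
  let q' : OpSub p G := ⟨q, hq.2⟩
  have hq'U : (QuotientGroup.mk' R q') ∈ V := ⟨q', hq.1, rfl⟩
  have hcyc : IsCyclic V := by
    refine ⟨⟨⟨_, hq'U⟩, ?_⟩⟩
    rintro ⟨_, ⟨y, hy, rfl⟩⟩
    obtain ⟨m, hm, k, hk⟩ := hdec y (hQP ⟨hy, y.2⟩)
    refine ⟨k, Subtype.ext ?_⟩
    change (QuotientGroup.mk' R q') ^ k = QuotientGroup.mk' R y
    rw [← map_zpow]
    change ((q' ^ k : OpSub p G) : OpSub p G ⧸ R) = (y : OpSub p G ⧸ R)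
    rw [QuotientGroup.eq_iff_div_mem, Subgroup.mem_subgroupOf]
    have : ((q' ^ k / y : OpSub p G) : G) = m⁻¹ := by
      simp only [Subgroup.coe_div, Subgroup.coe_zpow, ← hk, q']
      simp
    rw [this]
    exact inv_mem hm
  have hg : Nat.gcd (Nat.card (OpSub p G ⧸ R)) (p - 1) = 1 :=
    Nat.Coprime.coprime_dvd_left ((Subgroup.card_quotient_dvd_card R).trans
      (Subgroup.card_subgroup_dvd_card _)) hgcd
  have h1 := sylow_trivial_of_cyclic hg V hcyc (by
    intro f x
    obtain ⟨y, rfl⟩ := QuotientGroup.mk'_surjective R x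
    exact OpSub_hom hp.out hUp (f.comp (QuotientGroup.mk' R)) y) _ hq'U
  exact hqM ((QuotientGroup.eq_one_iff q').1 h1)

theorem exists_maximal {G : Type*} [Group G] [Finite G] (L P : Subgroup G) (h : L < P) :
    ∃ M, L ≤ M ∧ IsMaximalSubgroupOf M P := by
  obtain ⟨M, hLM, hM⟩ := Finite.exists_le_maximal (p := fun M : Subgroup G => M < P) h
  refine ⟨M, hLM, hM.1, fun K hMK hKP => ?_⟩
  by_contra hne
  exact absurd (hM.2 (lt_of_le_of_ne hKP hne) hMK.le) (not_le_of_gt hMK)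

theorem main_aux {G : Type*} [Group G] [Finite G] {p : ℕ} [hp : Fact p.Prime]
    (hgcd : Nat.gcd (Nat.card G) (p - 1) = 1) (S : Sylow p G) (P : Subgroup G)
    (hPS : P ≤ S) (hQP : (S : Subgroup G) ⊓ OpSub p G ≤ P)
    (h : ∀ M : Subgroup G, IsMaximalSubgroupOf M P →
      M.IsSQuasinormal ∨ HasPNilpotentSupplement p M) :
    (S : Subgroup G) ⊓ OpSub p G = ⊥ := by
  classical
  by_contra hne
  have hPp : IsPGroup p P := S.2.to_le hPS
  have hQn : ∀ y ∈ P, ∀ q ∈ (S : Subgroup G) ⊓ OpSub p G,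
      y * q * y⁻¹ ∈ (S : Subgroup G) ⊓ OpSub p G := fun y hy q hq =>
    Subgroup.mem_inf.2 ⟨mul_mem (mul_mem (hPS hy) hq.1) (inv_mem (hPS hy)),
      (OpSub_normal p G).conj_mem _ hq.2 _⟩
  obtain ⟨A, _, ζ, hA, hinv, q0, hq0⟩ := exists_invariant_hom P _ hPp hQP hne hQn
  let z : G → A := fun g => if hg : g ∈ (S : Subgroup G) ⊓ OpSub p G then ζ ⟨g, hg⟩ else 1
  have hzeq : ∀ g (hg : g ∈ (S : Subgroup G) ⊓ OpSub p G), z g = ζ ⟨g, hg⟩ :=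
    fun g hg => dif_pos hg
  obtain ⟨δ, hδZ, hδQ, hδ1⟩ := core_delta (OpSub p G) (S : Subgroup G) P hPS z
    (by
      intro a ha b hb
      rw [hzeq a ha, hzeq b hb, hzeq _ (mul_mem ha hb), ← map_mul]
      rfl)
    (by
      intro y hy q hq
      have h1 : y⁻¹ * q * y ∈ (S : Subgroup G) ⊓ OpSub p G := by
        simpa using hQn y⁻¹ (inv_mem hy) q hq
      rw [hzeq _ h1, hzeq _ hq]
      exact hinv y hy ⟨q, hq⟩ h1)
    (by
      intro α
      obtain ⟨g, rfl⟩ := QuotientGroup.mk_surjective α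
      obtain ⟨t, ht, s, hs, rfl⟩ := exists_rep S g
      refine ⟨t, ht, ?_⟩
      rw [QuotientGroup.eq]
      have h2 : t⁻¹ * (t * s) = s := by group
      rw [h2]; exact hs)
    (OpSub_hom hp.out hA) ζ.range
    (by
      intro q hq
      rw [hzeq q hq]
      exact ⟨_, rfl⟩)
  -- every value of `δ` is attained on `Q`
  have hcop : p.Coprime (S : Subgroup G).index :=
    (Nat.Prime.coprime_iff_not_dvd hp.out).2 S.not_dvd_index
  have hsurj : ∀ q : ((S : Subgroup G) ⊓ OpSub p G : Subgroup G),
      ∃ u : ((S : Subgroup G) ⊓ OpSub p G : Subgroup G), δ ⟨u, hQP u.2⟩ = ζ q := by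
    intro q
    have hQp : IsPGroup p ((S : Subgroup G) ⊓ OpSub p G : Subgroup G) := S.2.to_le inf_le_left
    obtain ⟨v, hv⟩ := (hQp.powEquiv hcop).surjective q
    rw [IsPGroup.powEquiv_apply] at hv
    refine ⟨v⁻¹, ?_⟩
    rw [hδQ _ (v⁻¹).2, hzeq _ (v⁻¹).2]
    change (ζ v⁻¹)⁻¹ ^ _ = _
    rw [map_inv, inv_inv, ← map_pow, hv]
  have hlt : δ.ker.map P.subtype < P := by
    refine lt_of_le_of_ne (Subgroup.map_subtype_le _) fun heq => hq0 ?_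
    obtain ⟨u, hu⟩ := hsurj q0
    have h1 : (u : G) ∈ δ.ker.map P.subtype := by rw [heq]; exact hQP u.2
    obtain ⟨w, hw, hwu⟩ := h1
    rw [← hu]
    have : w = ⟨u, hQP u.2⟩ := Subtype.ext hwu
    rw [← this]
    exact hw
  obtain ⟨M, hLM, hM⟩ := exists_maximal _ _ hlt
  have hQM : ¬ (S : Subgroup G) ⊓ OpSub p G ≤ M := by
    intro hle
    refine absurd hM.1 (not_lt_of_ge fun y hy => ?_)
    obtain ⟨q, hq⟩ := hδZ ⟨y, hy⟩
    obtain ⟨u, hu⟩ := hsurj q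
    have h1 : y * (u : G)⁻¹ ∈ M := by
      refine hLM ⟨⟨y, hy⟩ * ⟨u, hQP u.2⟩⁻¹, ?_, rfl⟩
      change δ _ = 1
      rw [map_mul, map_inv, hu, hq, mul_inv_cancel]
    simpa using mul_mem h1 (hle u.2)
  rcases h M hM with hs | ⟨K, hMK, hK⟩
  · exact hQM (sqn_case hgcd S P M hPS hQP hM hs)
  · obtain ⟨N, hNT, hNK, t, htN, htα, htn⟩ :=
      exists_section (hPp.to_le hM.1.le) hMK hK S
    obtain ⟨y, hyP, hyM⟩ := SetLike.exists_of_lt hM.1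
    obtain ⟨m, hm, x, hx, hmx⟩ : y ∈ (M : Set G) * (K : Set G) := by rw [hMK]; trivial
    simp only at hmx
    have hxy : x = m⁻¹ * y := by rw [← hmx]; group
    have hxP : x ∈ P := by rw [hxy]; exact mul_mem (inv_mem (hM.1.le hm)) hyP
    have hxM : x ∉ M := fun hxM => hyM (by rw [← hmx]; exact mul_mem hm hxM)
    refine hxM (hLM ⟨⟨x, hxP⟩, ?_, rfl⟩)
    refine hδ1 ⟨x, hxP⟩ t (fun α => hNT (htN α)) htα fun α => ?_
    have h1 : ((x * t α * x⁻¹ : G) : G ⧸ (S : Subgroup G)) = x • α := by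
      conv_rhs => rw [← htα α]
      rw [MulAction.Quotient.smul_coe, smul_eq_mul, QuotientGroup.eq]
      have : (x * t α * x⁻¹)⁻¹ * (x * t α) = x := by group
      rw [this]
      exact hPS hxP
    have h2 := htn _ (hNK x hx _ (htN α))
    rw [h1] at h2
    change x * t α = t (x • α) * x
    rw [h2]
    group

theorem stmt10 {G : Type*} [Group G] [Fintype G] {p : ℕ}
    (hp : p.Prime) (hdvd : p ∣ Nat.card G)
    (hgcd : Nat.gcd (Nat.card G) (p - 1) = 1)
    (E : Subgroup G) [E.Normal] (hquot : IsPNilpotent p (G ⧸ E))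
    (P : Subgroup G) (hP : IsSylowSubgroupOf p P E)
    (h : ∀ M : Subgroup G, IsMaximalSubgroupOf M P →
      M.IsSQuasinormal ∨ HasPNilpotentSupplement p M) :
    IsPNilpotent p G := by
  have := Fact.mk hp
  obtain ⟨hPE, hPp, hPmax⟩ := hP
  obtain ⟨S, hPS⟩ := hPp.exists_le_sylow
  have hSE : (S : Subgroup G) ⊓ E = P :=
    hPmax _ inf_le_right (S.2.to_le inf_le_left) (le_inf hPS hPE)
  have hQP : (S : Subgroup G) ⊓ OpSub p G ≤ P := by
    rw [← hSE]
    refine le_inf inf_le_left ?_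
    rintro s ⟨hsS, hsT⟩
    obtain ⟨N, hN, hNp, k, hk⟩ := hquot
    have hNq : IsPGroup p ((G ⧸ E) ⧸ N) := IsPGroup.of_card (n := k) hk
    have h1 := OpSub_le_ker hp hNq ((QuotientGroup.mk' N).comp (QuotientGroup.mk' E)) hsT
    have h2 : (QuotientGroup.mk' E s) ∈ N := (QuotientGroup.eq_one_iff _).1 h1
    obtain ⟨l, hl⟩ := S.2 ⟨s, hsS⟩
    have hl' : s ^ p ^ l = 1 := by simpa using congrArg Subtype.val hl
    have h3 : (QuotientGroup.mk' E s) = 1 := by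
      refine coprime_pow_eq_one hp hNp (k := l) ?_ (by rw [← map_pow, hl', map_one])
      have := pow_card_eq_one' (x := (⟨_, h2⟩ : N))
      exact congrArg Subtype.val this
    exact (QuotientGroup.eq_one_iff _).1 h3
  have hbot := main_aux hgcd S P hPS hQP h
  refine ⟨OpSub p G, inferInstance, ?_, OpSub_index⟩
  have h1 := not_dvd_relIndex S
  rwa [Subgroup.subgroupOf_eq_bot.2 (disjoint_iff.2 hbot), Subgroup.index_bot] at h1
end

section
/- Let G be a finite group. If for every prime p dividing |G| and every non-cyclic Sylow p-subgroup P of G, every maximal subgroup of P is c-normal in G, then G is supersoluble. -/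
open scoped Pointwise

namespace CN
open Subgroup

/-- Working form of the hypothesis. -/
def Hyp (G : Type*) [Group G] : Prop :=
  ∀ q : ℕ, q.Prime → ∀ Q : Sylow q G, IsCyclic (Q : Subgroup G) ∨
    ∀ M : Subgroup G, M ⋖ (Q : Subgroup G) →
      ∃ T : Subgroup G, T.Normal ∧ M ⊔ T = ⊤ ∧ (M ⊓ T).Normal

lemma isPGroup_quot {G : Type*} [Group G] {p : ℕ} {M T : Subgroup G} [T.Normal]
    (hM : IsPGroup p M) (h : M ⊔ T = ⊤) : IsPGroup p (G ⧸ T) := by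
  intro x
  obtain ⟨g, rfl⟩ := QuotientGroup.mk'_surjective T x
  have hg : g ∈ M ⊔ T := h ▸ mem_top g
  obtain ⟨m, hm, t, ht, rfl⟩ := mem_sup_of_normal_right.1 hg
  obtain ⟨k, hk⟩ := hM ⟨m, hm⟩
  refine ⟨k, ?_⟩
  have h1 : QuotientGroup.mk' T t = 1 := (QuotientGroup.eq_one_iff t).2 ht
  have h2 : m ^ p ^ k = 1 := by simpa using congrArg Subtype.val hk
  rw [map_mul, h1, mul_one, ← map_pow, h2, map_one]

lemma Hyp.quot {G : Type*} [Group G] [Finite G] (h : Hyp G) {p : ℕ} (hp : p.Prime)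
    (N : Subgroup G) [N.Normal] (hN : IsPGroup p N) : Hyp (G ⧸ N) := by
  intro q hq Q'
  have := Fact.mk hq
  have := Fact.mk hp
  set f := QuotientGroup.mk' N with hf
  have hfs : Function.Surjective f := QuotientGroup.mk'_surjective N
  have hker : f.ker = N := QuotientGroup.ker_mk' N
  obtain ⟨Q, rfl⟩ := Sylow.mapSurjective_surjective hfs q Q'
  rw [Sylow.coe_mapSurjective]
  rcases h q hq Q with hc | hc
  · left
    exact isCyclic_of_surjective (f.subgroupMap (Q : Subgroup G)) (f.subgroupMap_surjective _)
  right
  intro M' hM'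
  have hMmap : (M'.comap f ⊓ Q).map f = M' := by
    apply le_antisymm
    · rintro _ ⟨x, hx, rfl⟩
      exact hx.1
    · intro y hy
      obtain ⟨x, hx, rfl⟩ := hM'.le hy
      exact ⟨x, ⟨hy, hx⟩, rfl⟩
  have hMQ : (M'.comap f ⊓ Q) ⋖ (Q : Subgroup G) := by
    refine ⟨lt_of_le_of_ne inf_le_right ?_, ?_⟩
    · intro he
      rw [he] at hMmap
      exact hM'.lt.ne hMmap.symm
    · intro K hMK hKQ
      have h1 : M' ≤ K.map f := by
        rw [← hMmap]; exact map_mono hMK.le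
      have h2 : K.map f ≤ (Q : Subgroup G).map f := map_mono hKQ.le
      rcases hM'.eq_or_eq h1 h2 with h3 | h3
      · apply hMK.not_ge
        refine le_inf ?_ hKQ.le
        rw [← map_le_iff_le_comap, h3]
      · apply hKQ.not_ge
        intro x hx
        have : f x ∈ K.map f := by rw [h3]; exact ⟨x, hx, rfl⟩
        obtain ⟨k, hk, hkx⟩ := this
        have h4 : k⁻¹ * x ∈ (Q : Subgroup G) := mul_mem (inv_mem (hKQ.le hk)) hx
        have h5 : k⁻¹ * x ∈ K := by
          apply hMK.le
          refine ⟨?_, h4⟩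
          show f (k⁻¹ * x) ∈ M'
          rw [map_mul, map_inv, hkx, inv_mul_cancel]
          exact one_mem _
        have := mul_mem hk h5
        rwa [mul_inv_cancel_left] at this
  obtain ⟨T, hT, hsup, hn⟩ := hc _ hMQ
  refine ⟨T.map f, hT.map f hfs, ?_, ?_⟩
  · rw [← hMmap, ← Subgroup.map_sup, hsup, map_top_of_surjective f hfs]
  have hNMT : N ≤ M'.comap f ⊓ Q ∨ N ≤ T := by
    by_cases hpq : p = q
    · subst hpq
      left
      refine le_inf ?_ ?_
      · intro x hx
        have : f x = 1 := by rw [← hker] at hx; exact hx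
        show f x ∈ M'
        rw [this]; exact one_mem _
      · exact IsPGroup.le_sylow_of_normal hN Q
    · right
      have hP : IsPGroup q (G ⧸ T) := isPGroup_quot (Q.2.to_le hMQ.le) hsup
      intro x hx
      rw [← QuotientGroup.eq_one_iff (N := T)]
      obtain ⟨a, ha⟩ := hN ⟨x, hx⟩
      obtain ⟨b, hb⟩ := hP (x : G ⧸ T)
      have ha' : x ^ p ^ a = 1 := by simpa using congrArg Subtype.val ha
      have ha'' : (x : G ⧸ T) ^ p ^ a = 1 := by
        rw [← QuotientGroup.mk_pow, ha', QuotientGroup.mk_one]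
      have := pow_gcd_eq_one.2 ⟨ha'', hb⟩
      rwa [Nat.Coprime.gcd_eq_one (Nat.Coprime.pow a b ((Nat.coprime_primes hp hq).2 hpq)),
        pow_one] at this
  have heq : M' ⊓ T.map f = ((M'.comap f ⊓ Q) ⊓ T).map f := by
    apply le_antisymm
    · rintro y ⟨hy, t, ht, rfl⟩
      have hy' : f t ∈ (M'.comap f ⊓ Q).map f := by rw [hMmap]; exact hy
      obtain ⟨m, hm, hmt⟩ := hy'
      have hN1 : m⁻¹ * t ∈ N := by
        rw [← hker, MonoidHom.mem_ker, map_mul, map_inv, hmt, inv_mul_cancel]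
      rcases hNMT with h1 | h1
      · have := mul_mem hm (h1 hN1)
        rw [mul_inv_cancel_left] at this
        exact ⟨t, ⟨this, ht⟩, rfl⟩
      · have := mul_mem ht (inv_mem (h1 hN1))
        simp only [mul_inv_rev, inv_inv, mul_inv_cancel_left] at this
        exact ⟨m, ⟨hm, this⟩, hmt⟩
    · rintro _ ⟨x, hx, rfl⟩
      exact ⟨hx.1.1, x, hx.2, rfl⟩
  rw [heq]
  exact hn.map f hfs

lemma Hyp.hall {G : Type*} [Group G] [Finite G] (h : Hyp G)
    (H : Subgroup G) [H.Normal] (hH : (Nat.card H).Coprime H.index) : Hyp H := by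
  intro q hq B
  have := Fact.mk hq
  by_cases hqH : q ∣ Nat.card H
  swap
  · left
    have : Nat.card B = 1 := by
      rcases B.2.card_eq_or_dvd with h1 | h1
      · exact h1
      · exact absurd (h1.trans (card_subgroup_dvd_card _)) hqH
    have := (Nat.card_eq_one_iff_unique.1 this).1
    infer_instance
  have hqi : ¬ q ∣ H.index := fun h1 => hq.one_lt.ne' (Nat.eq_one_of_dvd_coprimes hH hqH h1)
  have hind : ¬ q ∣ ((B : Subgroup H).map H.subtype).index := by
    rw [index_map_subtype]
    exact hq.not_dvd_mul B.not_dvd_index hqi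
  let Q : Sylow q G := (B.2.map H.subtype).toSylow hind
  have hQ : (Q : Subgroup G) = (B : Subgroup H).map H.subtype := rfl
  have hinj := H.subtype_injective
  rcases h q hq Q with hc | hc
  · left
    rw [hQ] at hc
    exact isCyclic_of_injective ((B : Subgroup H).equivMapOfInjective _ hinj).toMonoidHom
      (MulEquiv.injective _)
  right
  intro M hM
  have hMQ : M.map H.subtype ⋖ (Q : Subgroup G) := by
    rw [hQ]
    refine ⟨(map_lt_map_iff_of_injective hinj).2 hM.lt, ?_⟩
    intro K hMK hKQ
    have hKH : K ≤ H := hKQ.le.trans (map_subtype_le _)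
    have hK : K = (K.subgroupOf H).map H.subtype := by
      rw [subgroupOf_map_subtype, inf_of_le_left hKH]
    rw [hK, map_lt_map_iff_of_injective hinj] at hMK hKQ
    exact hM.2 hMK hKQ
  obtain ⟨T, hT, hsup, hn⟩ := hc _ hMQ
  refine ⟨T.subgroupOf H, inferInstance, ?_, ?_⟩
  · rw [eq_top_iff]
    rintro ⟨x, hx⟩ -
    have hx' : x ∈ M.map H.subtype ⊔ T := hsup ▸ mem_top x
    obtain ⟨_, ⟨m, hm, rfl⟩, t, ht, rfl⟩ := mem_sup_of_normal_right.1 hx'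
    have htH : t ∈ H := by
      have := mul_mem (inv_mem m.2) hx
      simpa using this
    have : (⟨H.subtype m * t, hx⟩ : H) = m * ⟨t, htH⟩ := rfl
    rw [this]
    exact mul_mem_sup hm ht
  · have : M ⊓ T.subgroupOf H = (M.map H.subtype ⊓ T).subgroupOf H := by
      ext x
      simp [mem_subgroupOf]
    rw [this]
    infer_instance

lemma supersolvable_of_quot {G : Type*} [Group G] (N : Subgroup G) [N.Normal]
    (hc : ∃ x, N = zpowers x) (h : IsSupersolvable (G ⧸ N)) : IsSupersolvable G := by
  obtain ⟨x, hx⟩ := hc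
  obtain ⟨n, c, h0, hn, hle, hnorm, hcyc⟩ := h
  set f := QuotientGroup.mk' N with hf
  have hfs : Function.Surjective f := QuotientGroup.mk'_surjective N
  have hker : f.ker = N := QuotientGroup.ker_mk' N
  refine ⟨n + 1, fun i => Nat.casesOn i ⊥ (fun j => (c j).comap f), rfl, ?_, ?_, ?_, ?_⟩
  · show (c n).comap f = ⊤
    rw [hn, comap_top]
  · rintro (_ | i)
    · exact bot_le
    · exact comap_mono (hle i)
  · rintro (_ | i)
    · show (⊥ : Subgroup G).Normal
      infer_instance
    · exact (hnorm i).comap f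
  · rintro (_ | i)
    · show ∃ x ∈ (c 0).comap f, ⊥ ⊔ zpowers x = (c 0).comap f
      rw [h0, MonoidHom.comap_bot, hker]
      exact ⟨x, hx ▸ mem_zpowers x, by rw [bot_sup_eq, hx]⟩
    · show ∃ x ∈ (c (i+1)).comap f, (c i).comap f ⊔ zpowers x = (c (i+1)).comap f
      obtain ⟨y, hy, he⟩ := hcyc i
      obtain ⟨y, rfl⟩ := hfs y
      refine ⟨y, hy, ?_⟩
      have hNle : N ≤ comap f (c i) := by
        refine le_trans hker.ge ?_
        rw [← MonoidHom.comap_bot]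
        exact comap_mono bot_le
      rw [← he, ← MonoidHom.map_zpowers, ← comap_sup_eq _ _ _ hfs, comap_map_eq, hker]
      exact le_antisymm (sup_le_sup_left le_sup_left _)
        (sup_le le_sup_left (sup_le le_sup_right (hNle.trans le_sup_left)))

lemma eq1 {G : Type*} [Group G] {p : ℕ} (hp : p.Prime) {x : G} {k n : ℕ} (h1 : x ^ p ^ k = 1)
    (h2 : x ^ n = 1) (hn : ¬ p ∣ n) : x = 1 := by
  have := pow_gcd_eq_one.2 ⟨h1, h2⟩
  rwa [Nat.Coprime.gcd_eq_one (Nat.Coprime.pow_left k ((Nat.Prime.coprime_iff_not_dvd hp).2 hn)),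
    pow_one] at this

/-- The subgroup generated by the elements of order prime to the given prime. -/
def Op (p : ℕ) (G : Type*) [Group G] : Subgroup G := closure {g | ¬ p ∣ orderOf g}

instance Op_normal (p : ℕ) (G : Type*) [Group G] : (Op p G).Normal := by
  refine ⟨fun n hn g => ?_⟩
  have : (Op p G) ≤ (Op p G).comap (MulAut.conj g).toMonoidHom := by
    refine (closure_le _).2 ?_
    intro x hx
    refine subset_closure ?_
    show ¬ p ∣ orderOf (MulAut.conj g x)
    rw [MulEquiv.orderOf_eq]
    exact hx
  exact this hn

lemma isPGroup_Op {p : ℕ} (hp : p.Prime) (G : Type*) [Group G] [Finite G] :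
    IsPGroup p (G ⧸ Op p G) := by
  intro x
  obtain ⟨g, rfl⟩ := QuotientGroup.mk'_surjective _ x
  obtain ⟨a, m, hm, he⟩ := Nat.exists_eq_pow_mul_and_not_dvd (orderOf_pos g).ne' p hp.ne_one
  refine ⟨a, ?_⟩
  rw [← map_pow]
  refine (QuotientGroup.eq_one_iff _).2 (subset_closure ?_)
  show ¬ p ∣ orderOf (g ^ p ^ a)
  rw [orderOf_pow_of_dvd (pow_pos hp.pos _).ne' (he ▸ dvd_mul_right _ _), he,
    Nat.mul_div_cancel_left _ (pow_pos hp.pos _)]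
  exact hm

lemma Op_le_of_quot {p : ℕ} (hp : p.Prime) {G : Type*} [Group G] {T : Subgroup G}
    [T.Normal] (hT : IsPGroup p (G ⧸ T)) : Op p G ≤ T := by
  refine (closure_le _).2 ?_
  intro g hg
  show g ∈ T
  rw [← QuotientGroup.eq_one_iff]
  obtain ⟨k, hk⟩ := hT (g : G ⧸ T)
  refine eq1 hp hk (n := orderOf g) ?_ hg
  rw [← QuotientGroup.mk_pow, pow_orderOf_eq_one, QuotientGroup.mk_one]

lemma rel_sup {G : Type*} [Group G] [Finite G] (M T : Subgroup G) [T.Normal] :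
    M.relIndex (M ⊔ T) = M.relIndex T := by
  have e1 : T.relIndex (M ⊔ T) = T.relIndex M := relIndex_sup_right M T
  have e2 : Nat.card (M ⊓ T : Subgroup G) * M.relIndex T = Nat.card T := by
    rw [← inf_relIndex_right, ← relIndex_bot_left, relIndex_mul_relIndex _ _ _ bot_le inf_le_right,
      relIndex_bot_left]
  have e3 : Nat.card (M ⊓ T : Subgroup G) * T.relIndex M = Nat.card M := by
    rw [← inf_relIndex_left, ← relIndex_bot_left, relIndex_mul_relIndex _ _ _ bot_le inf_le_left,
      relIndex_bot_left]
  have e4 : Nat.card T * T.relIndex (M ⊔ T) = Nat.card (M ⊔ T : Subgroup G) := by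
    rw [← relIndex_bot_left, relIndex_mul_relIndex _ _ _ bot_le le_sup_right, relIndex_bot_left]
  have e5 : Nat.card M * M.relIndex (M ⊔ T) = Nat.card (M ⊔ T : Subgroup G) := by
    rw [← relIndex_bot_left, relIndex_mul_relIndex _ _ _ bot_le le_sup_left, relIndex_bot_left]
  have hpos : 0 < Nat.card M := Nat.card_pos
  apply Nat.eq_of_mul_eq_mul_left hpos
  rw [e5, ← e4, ← e2, e1, ← e3]
  ring

lemma card_max {G : Type*} [Group G] [Finite G] {p : ℕ} (hp : p.Prime) {M P : Subgroup G}
    (hP : IsPGroup p P) (hM : M ⋖ P) : M.relIndex P = p := by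
  have := Fact.mk hp
  obtain ⟨n, hn⟩ := (hP.to_le hM.le).exists_card_eq
  obtain ⟨m, hm⟩ := hP.exists_card_eq
  have hcard : Nat.card M * M.relIndex P = Nat.card P := by
    rw [← relIndex_bot_left, relIndex_mul_relIndex _ _ _ bot_le hM.le, relIndex_bot_left]
  have hne : M.relIndex P ≠ 1 := fun h => hM.lt.not_ge (relIndex_eq_one.1 h)
  have hlt : n < m := by
    by_contra hcon
    push Not at hcon
    have h1 : Nat.card P ∣ Nat.card M := by rw [hn, hm]; exact pow_dvd_pow _ hcon
    have h2 := Nat.le_of_dvd Nat.card_pos h1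
    have h3 : 0 < Nat.card M := Nat.card_pos
    have h4 : 0 < M.relIndex P := by
      rcases Nat.eq_zero_or_pos (M.relIndex P) with h | h
      · rw [h, mul_zero] at hcard
        exact absurd hcard.symm Nat.card_pos.ne'
      · exact h
    have : 2 ≤ M.relIndex P := by omega
    nlinarith
  have hMc : Nat.card (M.subgroupOf P) = p ^ n := by
    rw [← hn]
    exact Nat.card_congr (subgroupOfEquivOfLe hM.le).toEquiv
  obtain ⟨K, hK, hMK⟩ := Sylow.exists_subgroup_card_pow_succ (G := P) (p := p) (n := n)
    (by rw [hm]; exact pow_dvd_pow _ hlt) hMc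
  have hMK' : M ≤ K.map P.subtype := by
    have := map_mono (f := P.subtype) hMK
    rwa [subgroupOf_map_subtype, inf_of_le_left hM.le] at this
  have hKc : Nat.card (K.map P.subtype) = p ^ (n + 1) := by
    rw [← hK]
    exact Nat.card_congr (K.equivMapOfInjective _ P.subtype_injective).symm.toEquiv
  rcases hM.eq_or_eq hMK' (map_subtype_le K) with h | h
  · rw [h, hn] at hKc
    have := Nat.pow_right_injective hp.two_le hKc
    omega
  · rw [h] at hKc
    rw [hn, hKc, pow_succ] at hcard
    exact Nat.eq_of_mul_eq_mul_left (pow_pos hp.pos n) hcard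

lemma key_le {G : Type*} [Group G] [Finite G] {p : ℕ} (hp : p.Prime)
    (hmin : (Nat.card G).minFac = p) (P : Sylow p G) {M T : Subgroup G}
    (hM : M ⋖ (P : Subgroup G)) [hT : T.Normal] (hsup : M ⊔ T = ⊤) (hn : (M ⊓ T).Normal) :
    Op p G ⊓ P ≤ M := by
  have := Fact.mk hp
  have hMi : M.index = p * (P : Subgroup G).index := by
    rw [← relIndex_mul_index hM.le, card_max hp P.2 hM]
  have hrel : M.relIndex T = M.index := by
    rw [← rel_sup, hsup, relIndex_top_right]
  let K := M ⊓ T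
  let Y := T ⧸ K.subgroupOf T
  have hY : Nat.card Y = p * (P : Subgroup G).index := by
    show (K.subgroupOf T).index = _
    rw [← hMi, ← hrel, ← inf_relIndex_right]
    rfl
  have hminY : (Nat.card Y).minFac = p := by
    apply le_antisymm
    · exact Nat.minFac_le_of_dvd hp.two_le (hY ▸ dvd_mul_right _ _)
    · rw [← hmin]
      apply Nat.minFac_le_of_dvd
      · apply (Nat.minFac_prime _).two_le
        rw [hY]
        exact fun h => hp.ne_one (Nat.eq_one_of_mul_eq_one_right h)
      · refine (Nat.minFac_dvd _).trans ?_
        rw [hY, ← hMi]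
        exact M.index_dvd_card
  let B : Sylow p Y := default
  have hB : Nat.card B = p := by
    rw [B.card_eq_multiplicity, hY, Nat.factorization_mul hp.ne_zero index_ne_zero_of_finite]
    simp [hp.factorization_self, Nat.factorization_eq_zero_of_not_dvd P.not_dvd_index]
  have hBc : IsCyclic B := isCyclic_of_prime_card hB
  have hNC := IsCyclic.normalizer_le_centralizer hminY hBc
  let φ := MonoidHom.transferSylow B hNC
  have hφ : ¬ p ∣ Nat.card φ.ker := MonoidHom.not_dvd_card_ker_transferSylow B hNC
  let ψ := QuotientGroup.mk' (K.subgroupOf T)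
  have hR : Op p G ≤ (φ.ker.comap ψ).map T.subtype := by
    refine (closure_le _).2 ?_
    intro g hg
    have hgT : g ∈ T := by
      refine Op_le_of_quot hp (isPGroup_quot (P.2.to_le hM.le) hsup) ?_
      exact subset_closure hg
    refine ⟨⟨g, hgT⟩, ?_, rfl⟩
    show φ (ψ ⟨g, hgT⟩) = 1
    obtain ⟨k, hk⟩ := B.2 (φ (ψ ⟨g, hgT⟩))
    refine eq1 hp hk (n := orderOf g) ?_ hg
    rw [← map_pow, ← map_pow]
    have : (⟨g, hgT⟩ : T) ^ orderOf g = 1 := by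
      ext
      simp [pow_orderOf_eq_one]
    rw [this, map_one, map_one]
  rintro x ⟨hx, hxP⟩
  obtain ⟨y, hy, rfl⟩ := hR hx
  have h1 : ψ y = 1 := by
    obtain ⟨k, hk⟩ := P.2 ⟨_, hxP⟩
    have hk' : y ^ p ^ k = 1 := by
      have := congrArg Subtype.val hk
      ext
      simpa using this
    refine eq1 hp (k := k) (n := Nat.card φ.ker) ?_ ?_ hφ
    · rw [← map_pow, hk', map_one]
    · have : (⟨ψ y, hy⟩ : φ.ker) ^ Nat.card φ.ker = 1 := pow_card_eq_one'
      simpa using congrArg Subtype.val this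
  have h2 : y ∈ K.subgroupOf T := (QuotientGroup.eq_one_iff y).1 h1
  exact h2.1

lemma key1 {G : Type*} [Group G] [Finite G] (h : Hyp G) {p : ℕ} (hp : p.Prime)
    (hmin : (Nat.card G).minFac = p) (P : Sylow p G) :
    ∃ R S : Subgroup G, R.Normal ∧ S.Normal ∧ S ≤ R ∧ S ≤ P ∧
      (∀ H : Subgroup G, H ≤ P → S ⊔ H = P → H = P) ∧ (∃ k, R.index = p ^ k) ∧
      ¬ p ∣ S.relIndex R := by
  have := Fact.mk hp
  rcases h p hp P with hc | hc
  · have hNC := IsCyclic.normalizer_le_centralizer hmin hc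
    have hcomp := MonoidHom.ker_transferSylow_isComplement' P hNC
    refine ⟨(MonoidHom.transferSylow P hNC).ker, ⊥, inferInstance, inferInstance, bot_le, bot_le,
      ?_, ?_, ?_⟩
    · intro H _ h2
      rwa [bot_sup_eq] at h2
    · obtain ⟨k, hk⟩ := P.2.exists_card_eq
      refine ⟨k, ?_⟩
      rw [← hk]
      exact hcomp.symm.index_eq_card
    · rw [relIndex_bot_left]
      exact MonoidHom.not_dvd_card_ker_transferSylow P hNC
  by_cases hbot : (P : Subgroup G) = ⊥
  · refine ⟨⊤, ⊥, inferInstance, inferInstance, bot_le, bot_le, ?_, ⟨0, by simp⟩, ?_⟩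
    · intro H _ h2
      rwa [bot_sup_eq] at h2
    · rw [relIndex_bot_left]
      have := P.not_dvd_index
      rwa [hbot, index_bot, ← card_top] at this
  have hle : ∀ M : Subgroup G, M ⋖ (P : Subgroup G) → Op p G ⊓ P ≤ M := by
    intro M hM
    obtain ⟨T, hT, hsup, hn⟩ := hc M hM
    exact key_le hp hmin P hM hsup hn
  refine ⟨Op p G, Op p G ⊓ P, inferInstance, ?_, inf_le_left, inf_le_right, ?_, ?_, ?_⟩
  · obtain ⟨M, -, hM⟩ := exists_le_covBy_of_lt (bot_lt_iff_ne_bot.2 hbot)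
    obtain ⟨T, hT, hsup, hn⟩ := hc M hM
    have hRT : Op p G ≤ T := Op_le_of_quot hp (isPGroup_quot (P.2.to_le hM.le) hsup)
    have : Op p G ⊓ P = (M ⊓ T) ⊓ Op p G := by
      apply le_antisymm
      · exact le_inf (le_inf (hle M hM) (inf_le_left.trans hRT)) inf_le_left
      · exact le_inf inf_le_right ((inf_le_left.trans inf_le_left).trans hM.le)
    rw [this]
    infer_instance
  · intro H hHP hsup
    by_contra hne
    obtain ⟨M, hHM, hM⟩ := exists_le_covBy_of_lt (lt_of_le_of_ne hHP hne)
    apply hM.lt.not_ge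
    rw [← hsup]
    exact sup_le (hle M hM) hHM
  · exact IsPGroup.iff_card.1 (isPGroup_Op hp G)
  · rw [inf_relIndex_left, ← rel_sup]
    intro h1
    apply P.not_dvd_index
    rw [← relIndex_mul_index (le_sup_left : (P : Subgroup G) ≤ (P : Subgroup G) ⊔ Op p G)]
    exact h1.mul_right _

theorem exists_normal_sylow.{u} (n : ℕ) : ∀ (G : Type u) [Group G] [Finite G],
    Nat.card G = n → Nat.card G ≠ 1 → Hyp G →
    ∃ q : ℕ, q.Prime ∧ q ∣ Nat.card G ∧ ∃ Q : Sylow q G, (Q : Subgroup G).Normal := by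
  induction n using Nat.strong_induction_on with
  | _ n ih =>
  intro G _ _ hcard hne h
  obtain ⟨p, hmin⟩ : ∃ p, (Nat.card G).minFac = p := ⟨_, rfl⟩
  have hp : p.Prime := hmin ▸ Nat.minFac_prime hne
  have hpG : p ∣ Nat.card G := hmin ▸ Nat.minFac_dvd _
  have := Fact.mk hp
  let P : Sylow p G := default
  obtain ⟨R, S, hR, hS, hSR, hSP, hgen, ⟨k, hk⟩, hrel⟩ := key1 h hp hmin P
  set f := QuotientGroup.mk' S with hf
  have hfs : Function.Surjective f := QuotientGroup.mk'_surjective S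
  have hker : f.ker = S := QuotientGroup.ker_mk' S
  have hcR : Nat.card (R.map f) = S.relIndex R := by rw [← relIndex_ker, hker]
  have hiR : (R.map f).index = R.index := index_map_eq _ hfs (hker.le.trans hSR)
  by_cases h1 : Nat.card (R.map f) = 1
  · refine ⟨p, hp, hpG, P, ?_⟩
    rw [hcR, relIndex_eq_one] at h1
    have h2 : (P : Subgroup G).index ∣ p ^ k := hk ▸ index_dvd_of_le (h1.trans hSP)
    have h3 : (P : Subgroup G).index = 1 := by
      refine Nat.eq_one_of_dvd_coprimes (Nat.Coprime.pow_right k ?_) dvd_rfl h2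
      exact ((Nat.Prime.coprime_iff_not_dvd hp).2 P.not_dvd_index).symm
    rw [index_eq_one.1 h3]
    infer_instance
  have hRn : (R.map f).Normal := hR.map f hfs
  have hpR : ¬ p ∣ Nat.card (R.map f) := by rwa [hcR]
  have hHyp : Hyp (R.map f) := by
    refine Hyp.hall (h.quot hp S (P.2.to_le hSP)) _ ?_
    rw [hiR, hk]
    exact Nat.Coprime.pow_right k ((Nat.Prime.coprime_iff_not_dvd hp).2 hpR).symm
  have hlt : Nat.card (R.map f) < n := by
    have hd : Nat.card (R.map f) ∣ Nat.card G := by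
      rw [hcR]
      exact (relIndex_dvd_card S R).trans (card_subgroup_dvd_card R)
    rw [← hcard]
    refine lt_of_le_of_ne (Nat.le_of_dvd Nat.card_pos hd) ?_
    intro he
    rw [he] at hpR
    exact hpR hpG
  obtain ⟨r, hr, hrR, B, hB⟩ := ih _ hlt (R.map f) rfl h1 hHyp
  have := Fact.mk hr
  have hBc : (B : Subgroup (R.map f)).Characteristic := Sylow.characteristic_of_normal B hB
  have hBn : ((B : Subgroup (R.map f)).map (R.map f).subtype).Normal := inferInstance
  have hrp : r ≠ p := by
    rintro rfl
    exact hpR hrR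
  have hind : ¬ r ∣ ((B : Subgroup (R.map f)).map (R.map f).subtype).index := by
    rw [index_map_subtype]
    refine hr.not_dvd_mul B.not_dvd_index ?_
    rw [hiR, hk]
    exact fun h => hrp ((Nat.prime_dvd_prime_iff_eq hr hp).1 (hr.dvd_of_dvd_pow h))
  let B' : Sylow r (G ⧸ S) := (B.2.map (R.map f).subtype).toSylow hind
  have hB' : (B' : Subgroup (G ⧸ S)).Normal := hBn
  obtain ⟨A, hA⟩ := Sylow.mapSurjective_surjective hfs r B'
  have hAB : (A : Subgroup G).map f = B' := by rw [← hA]; rfl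
  have hdG : r ∣ Nat.card G := by
    refine hrR.trans ?_
    rw [hcR]
    exact (relIndex_dvd_card S R).trans (card_subgroup_dvd_card R)
  refine ⟨r, hr, hdG, A, ?_⟩
  have hCn : ((A : Subgroup G) ⊔ S).Normal := by
    rw [← hker, ← comap_map_eq, hAB]
    exact hB'.comap f
  have hfr := Sylow.normalizer_sup_eq_top' A (N := (A : Subgroup G) ⊔ S) le_sup_left
  rw [← normalizer_eq_top_iff]
  set W := normalizer (A : Set G) with hW
  have hAW : (A : Subgroup G) ≤ W := le_normalizer
  rw [← sup_assoc, sup_of_le_left hAW] at hfr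
  have hPW : W ⊓ P = (P : Subgroup G) := by
    apply hgen _ inf_le_right
    apply le_antisymm (sup_le hSP inf_le_right)
    intro x hx
    have : x ∈ W ⊔ S := hfr ▸ mem_top x
    obtain ⟨w, hw, s, hs, rfl⟩ := mem_sup_of_normal_right.1 this
    have hwP : w ∈ (P : Subgroup G) := by
      have := mul_mem hx (inv_mem (hSP hs))
      rwa [mul_inv_cancel_right] at this
    exact mul_mem (mem_sup_right ⟨hw, hwP⟩) (mem_sup_left hs)
  have hSW : S ≤ W := hSP.trans (inf_eq_right.1 hPW)
  rwa [sup_of_le_left hSW] at hfr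

lemma coset_fix {G : Type*} [Group G] [Finite G] {r k : ℕ} (hr : r.Prime) {x v : G}
    (hx : x ^ r ^ k = 1) (D : Subgroup G) (hrD : ¬ r ∣ Nat.card D)
    (hD : ∀ d ∈ D, x * d * x⁻¹ ∈ D) (hv : v⁻¹ * x * v * x⁻¹ ∈ D) :
    ∃ d ∈ D, x * (v * d) = (v * d) * x := by
  classical
  have := Fact.mk hr
  have := Fintype.ofFinite D
  have hmem : ∀ d : D, v⁻¹ * x * v * d * x⁻¹ ∈ D := by
    intro d
    have := mul_mem hv (hD d d.2)
    convert this using 1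
    group
  let f : Function.End D := fun d => ⟨v⁻¹ * x * v * d * x⁻¹, hmem d⟩
  have hpow : ∀ n : ℕ, ∀ d : D, (((f ^ n) d : D) : G) = v⁻¹ * x ^ n * v * d * (x ^ n)⁻¹ := by
    intro n
    induction n with
    | zero =>
      intro d
      have : (f ^ 0) d = d := by rw [pow_zero]; rfl
      rw [this]
      simp
    | succ n ih =>
      intro d
      have : (f ^ (n + 1)) d = f ((f ^ n) d) := by rw [pow_succ']; rfl
      rw [this]
      show v⁻¹ * x * v * ((f ^ n) d : D) * x⁻¹ = _
      rw [ih, pow_succ']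
      group
  have hf : f ^ r ^ k = 1 := by
    funext d
    apply Subtype.ext
    rw [hpow, hx]
    show _ = (d : G)
    group
  have hmod := Equiv.Perm.card_fixedPoints_modEq hf
  by_contra hcon
  push Not at hcon
  apply hrD
  have hemp : IsEmpty (Function.fixedPoints f) := by
    refine ⟨fun d => ?_⟩
    have h1 : f d.1 = d.1 := d.2
    have h2 : v⁻¹ * x * v * (d.1 : G) * x⁻¹ = d.1 := congrArg Subtype.val h1
    apply hcon _ d.1.2
    nth_rewrite 2 [← h2]
    group
  rw [Fintype.card_eq_zero (α := Function.fixedPoints f)] at hmod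
  rw [Nat.card_eq_fintype_card]
  exact (Nat.modEq_zero_iff_dvd).1 hmod

lemma exists_eigen {A : Type*} [Group A] [Finite A] [Nontrivial A] {q : ℕ} (hq : q.Prime)
    (hcomm : ∀ a b : A, a * b = b * a) (hexp : ∀ a : A, a ^ q = 1) (f : MulAut A)
    (hf : f ^ (q - 1) = 1) : ∃ a : A, a ≠ 1 ∧ ∃ k : ℕ, f a = a ^ k := by
  have := Fact.mk hq
  let : CommGroup A := { (inferInstance : Group A) with mul_comm := hcomm }
  let : Module (ZMod q) (Additive A) := AddCommGroup.zmodModule (n := q) (fun x => hexp x.toMul)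
  let F : Module.End (ZMod q) (Additive A) :=
    (MonoidHom.toAdditive (f : A ≃* A).toMonoidHom).toZModLinearMap q
  have hFa : ∀ n : ℕ, ∀ a : A, (F ^ n) (Additive.ofMul a) = Additive.ofMul ((f ^ n) a) := by
    intro n
    induction n with
    | zero => intro a; rfl
    | succ n ih =>
      intro a
      rw [pow_succ', pow_succ', Module.End.mul_apply, ih]
      rfl
  have hF : F ^ q = F := by
    obtain ⟨m, rfl⟩ : ∃ m, q = m + 1 := ⟨q - 1, (Nat.succ_pred_eq_of_pos hq.pos).symm⟩
    have : F ^ m = 1 := by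
      refine LinearMap.ext fun a => ?_
      have h1 := hFa m a.toMul
      rw [Nat.add_sub_cancel] at hf
      rw [hf] at h1
      exact h1
    rw [pow_succ, this, one_mul]
  have hfin : Module.Finite (ZMod q) (Additive A) := Module.Finite.of_finite
  have hdvd : minpoly (ZMod q) F ∣ Polynomial.X ^ q - Polynomial.X := by
    apply minpoly.dvd
    simp [hF]
  have hspl := (GaloisField.splits_zmod_X_pow_sub_X q).of_dvd
    (FiniteField.X_pow_card_sub_X_ne_zero (ZMod q) hq.one_lt) hdvd
  obtain ⟨μ, hμ⟩ := hspl.exists_eval_eq_zero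
    (minpoly.degree_pos (Algebra.IsIntegral.isIntegral F)).ne'
  have hev := Module.End.hasEigenvalue_of_isRoot (f := F) (μ := μ) hμ
  obtain ⟨v, hv⟩ := hev.exists_hasEigenvector
  refine ⟨v.toMul, hv.2, μ.val, ?_⟩
  have h1 : F v = μ • v := hv.apply_eq_smul
  rw [← ZMod.natCast_zmod_val μ, Nat.cast_smul_eq_nsmul] at h1
  exact h1

lemma zpowers_normal {G : Type*} [Group G] [Finite G] {q : ℕ} (hq : q.Prime) (N : Subgroup G)
    [hN : N.Normal] (hne : N ≠ ⊥) (hcomm : ∀ a ∈ N, ∀ b ∈ N, a * b = b * a)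
    (hexp : ∀ a ∈ N, a ^ q = 1) (hmin : ∀ W : Subgroup G, W.Normal → W ≠ ⊥ → W ≤ N → W = N)
    (hpow : ∀ g : G, (MulAut.conjNormal g : MulAut N) ^ (q - 1) = 1)
    (hcm : ∀ g h : G, Commute (MulAut.conjNormal g : MulAut N) (MulAut.conjNormal h)) :
    ∀ n ∈ N, (zpowers n).Normal := by
  have hnt : Nontrivial N := (nontrivial_iff_ne_bot N).2 hne
  have key : ∀ g : G, ∃ k : ℕ, ∀ n ∈ N, g * n * g⁻¹ = n ^ k := by
    intro g
    obtain ⟨a, ha1, k, hk⟩ := exists_eigen (A := N) hq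
      (fun a b => Subtype.ext (hcomm a a.2 b b.2)) (fun a => Subtype.ext (hexp a a.2))
      (MulAut.conjNormal g) (hpow g)
    refine ⟨k, ?_⟩
    let W : Subgroup G :=
      { carrier := {n | n ∈ N ∧ g * n * g⁻¹ = n ^ k}
        one_mem' := ⟨one_mem _, by simp⟩
        mul_mem' := by
          rintro a b ⟨ha, ha'⟩ ⟨hb, hb'⟩
          refine ⟨mul_mem ha hb, ?_⟩
          rw [(show Commute a b from hcomm a ha b hb).mul_pow, ← ha', ← hb']
          group
        inv_mem' := by
          rintro a ⟨ha, ha'⟩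
          refine ⟨inv_mem ha, ?_⟩
          rw [inv_pow, ← ha']
          group }
    have hWN : W = N := by
      apply hmin
      · refine ⟨?_⟩
        rintro n ⟨hn, hn'⟩ t
        refine ⟨hN.conj_mem n hn t, ?_⟩
        have h1 := congrArg Subtype.val (DFunLike.congr_fun (hcm g t).eq ⟨n, hn⟩)
        simp only [MulAut.mul_apply, MulAut.conjNormal_apply] at h1
        rw [h1, hn', conj_pow]
      · intro hb
        apply ha1
        have : (a : G) ∈ W := ⟨a.2, by
          have := congrArg Subtype.val hk
          simpa using this⟩
        rw [hb, mem_bot] at this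
        exact Subtype.ext this
      · rintro n ⟨hn, -⟩
        exact hn
    intro n hn
    rw [← hWN] at hn
    exact hn.2
  intro n hn
  refine ⟨?_⟩
  rintro m hm g
  obtain ⟨k, hk⟩ := key g
  rw [hk m (zpowers_le.2 hn hm)]
  exact pow_mem hm k

lemma small_factor {G : Type*} [Group G] [Finite G] {q : ℕ} (hq : q.Prime) (L S : Subgroup G)
    [L.Normal] [hS : S.Normal] (h : L.relIndex S = 1 ∨ L.relIndex S = q) :
    ∃ X : Subgroup G, (∀ g, g ^ (q - 1) ∈ X) ∧ (∀ g h : G, g * h * g⁻¹ * h⁻¹ ∈ X) ∧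
      ∀ x ∈ X, ∀ s ∈ S, s⁻¹ * x * s * x⁻¹ ∈ L := by
  have := Fact.mk hq
  set f := QuotientGroup.mk' L with hf
  have hfs : Function.Surjective f := QuotientGroup.mk'_surjective L
  have hker : f.ker = L := QuotientGroup.ker_mk' L
  have hn : (S.map f).Normal := hS.map f hfs
  have hc : Nat.card (S.map f) = L.relIndex S := by rw [← relIndex_ker, hker]
  have hcyc : IsCyclic (S.map f) := by
    rcases h with h | h
    · rw [h] at hc
      have := (Nat.card_eq_one_iff_unique.1 hc).1
      infer_instance
    · exact isCyclic_of_prime_card (hc.trans h)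
  let φ : G →* MulAut (S.map f) := (MulAut.conjNormal).comp f
  let e := IsCyclic.mulAutMulEquiv (S.map f)
  refine ⟨φ.ker, ?_, ?_, ?_⟩
  · intro g
    rw [MonoidHom.mem_ker, map_pow]
    apply e.injective
    rw [map_pow, map_one]
    have h1 := ZMod.pow_totient (e (φ g))
    rcases h with h | h
    · have h2 : (Nat.card (S.map f)).totient = 1 := by rw [hc, h, Nat.totient_one]
      rw [h2, pow_one] at h1
      rw [h1, one_pow]
    · have h2 : (Nat.card (S.map f)).totient = q - 1 := by rw [hc, h, Nat.totient_prime hq]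
      rwa [h2] at h1
  · intro g h
    rw [MonoidHom.mem_ker]
    apply e.injective
    simp only [map_mul, map_inv, map_one]
    rw [mul_comm (e (φ g))]
    group
  · intro x hx s hs
    have h1 := congrArg Subtype.val (DFunLike.congr_fun (MonoidHom.mem_ker.1 hx) ⟨f s, s, hs, rfl⟩)
    have h2 : f x * f s * (f x)⁻¹ = f s := h1
    rw [← hker, MonoidHom.mem_ker]
    simp only [map_mul, map_inv]
    rw [mul_assoc, mul_assoc, ← mul_assoc (f x), h2, inv_mul_cancel]

/-- The Frattini subgroup of `Q`, as a subgroup of `G`. -/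
def Phi {G : Type*} [Group G] (Q : Subgroup G) : Subgroup G := (frattini Q).map Q.subtype

instance Phi_normal {G : Type*} [Group G] (Q : Subgroup G) [Q.Normal] : (Phi Q).Normal := by
  unfold Phi
  infer_instance

lemma mem_Phi {G : Type*} [Group G] {Q : Subgroup G} {x : G} (hx : x ∈ Q)
    (h : ∀ M : Subgroup G, M ⋖ Q → x ∈ M) : x ∈ Phi Q := by
  refine ⟨⟨x, hx⟩, ?_, rfl⟩
  show _ ∈ frattini Q
  unfold frattini Order.radical
  rw [mem_iInf]
  intro a
  rw [mem_iInf]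
  intro ha
  have ha' : IsCoatom a := ha
  have hinj := Q.subtype_injective
  have hcov : a.map Q.subtype ⋖ Q := by
    refine ⟨lt_of_le_of_ne (map_subtype_le a) ?_, ?_⟩
    · intro he
      apply ha'.1
      rw [eq_top_iff]
      rintro ⟨y, hy⟩ -
      have hy' : y ∈ a.map Q.subtype := he.ge hy
      obtain ⟨z, hz, hzy⟩ := hy'
      have : z = ⟨y, hy⟩ := Subtype.ext hzy
      exact this ▸ hz
    · intro K hMK hKQ
      have hK : K = (K.subgroupOf Q).map Q.subtype := by
        rw [subgroupOf_map_subtype, inf_of_le_left hKQ.le]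
      rw [hK, map_lt_map_iff_of_injective hinj] at hMK
      have := ha'.2 _ hMK
      rw [subgroupOf_eq_top] at this
      exact hKQ.not_ge this
  obtain ⟨z, hz, hzy⟩ := h _ hcov
  have : z = ⟨x, hx⟩ := Subtype.ext hzy
  exact this ▸ hz

lemma Phi_nongen {G : Type*} [Group G] [Finite G] {Q : Subgroup G} (C : Subgroup G)
    (h : ∀ v ∈ Q, ∃ d ∈ Phi Q, v * d ∈ C) : Q ≤ C := by
  rw [← subgroupOf_eq_top]
  apply frattini_nongenerating
  rw [eq_top_iff]
  rintro ⟨v, hv⟩ -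
  obtain ⟨_, ⟨d, hd, rfl⟩, hc⟩ := h v hv
  have h1 : (⟨v, hv⟩ : Q) * d ∈ C.subgroupOf Q := hc
  have := mul_mem (mem_sup_left (T := frattini Q) h1) (mem_sup_right (inv_mem hd))
  rwa [mul_inv_cancel_right] at this

lemma key2_cent {G : Type*} [Group G] [Finite G] {q r k : ℕ} (hq : q.Prime) (hr : r.Prime)
    (hrq : r ≠ q) (Q R : Subgroup G) [hQ : Q.Normal] [hR : R.Normal] (hQp : IsPGroup q Q)
    {x : G} (hx : x ^ r ^ k = 1) (hxR : x ∈ R)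
    (hxM : ∀ M : Subgroup G, M ⋖ Q → ∀ s ∈ R ⊓ Q, s⁻¹ * x * s * x⁻¹ ∈ M) :
    ∀ v ∈ Q, x * v = v * x := by
  have := Fact.mk hq
  have hcard : ∀ D : Subgroup G, D ≤ Q → ¬ r ∣ Nat.card D := by
    intro D hD
    obtain ⟨n, hn⟩ := (hQp.to_le hD).exists_card_eq
    rw [hn]
    exact fun h => hrq ((Nat.prime_dvd_prime_iff_eq hr hq).1 (hr.dvd_of_dvd_pow h))
  have hnorm : ∀ D : Subgroup G, D.Normal → ∀ d ∈ D, x * d * x⁻¹ ∈ D :=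
    fun D hD d hd => hD.conj_mem d hd x
  have hcomQ : ∀ v ∈ Q, v⁻¹ * x * v * x⁻¹ ∈ R ⊓ Q := by
    intro v hv
    constructor
    · have := mul_mem (hR.conj_mem x hxR v⁻¹) (inv_mem hxR)
      simpa using this
    · have := mul_mem (inv_mem hv) (hQ.conj_mem v hv x)
      simpa [mul_assoc] using this
  have hle : Q ≤ centralizer {x} := by
    apply Phi_nongen
    intro v hv
    obtain ⟨s, hs, hvs⟩ := coset_fix hr hx (R ⊓ Q) (hcard _ inf_le_right) (hnorm _ inferInstance)
      (hcomQ v hv)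
    have hs' : s⁻¹ ∈ R ⊓ Q := inv_mem hs
    obtain ⟨d, hd, hsd⟩ := coset_fix (v := s⁻¹) hr hx (Phi Q ⊓ (R ⊓ Q))
      (hcard _ (inf_le_right.trans inf_le_right)) (hnorm _ inferInstance)
      ⟨mem_Phi (hcomQ _ hs'.2).2 (fun M hM => hxM M hM _ hs'), hcomQ _ hs'.2⟩
    refine ⟨d, hd.1, ?_⟩
    rw [mem_centralizer_singleton_iff]
    have h1 : Commute x (v * s) := hvs
    have h2 : Commute x (s⁻¹ * d) := hsd
    have h3 := h1.mul_right h2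
    have h4 : v * s * (s⁻¹ * d) = v * d := by group
    rw [h4] at h3
    exact h3.eq.symm
  intro v hv
  have := hle hv
  rw [mem_centralizer_singleton_iff] at this
  exact this.symm

lemma exists_min {G : Type*} [Group G] [Finite G] (V : Subgroup G) (hV : V.Normal)
    (hne : V ≠ ⊥) : ∃ N : Subgroup G, N.Normal ∧ N ≠ ⊥ ∧ N ≤ V ∧
      ∀ W : Subgroup G, W.Normal → W ≠ ⊥ → W ≤ N → W = N := by
  obtain ⟨N, hN⟩ := Set.Finite.exists_minimal
    (s := {N : Subgroup G | N.Normal ∧ N ≠ ⊥ ∧ N ≤ V}) (Set.toFinite _) ⟨V, hV, hne, le_rfl⟩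
  refine ⟨N, hN.1.1, hN.1.2.1, hN.1.2.2, ?_⟩
  intro W h1 h2 h3
  exact le_antisymm h3 (hN.2 ⟨h1, h2, h3.trans hN.1.2.2⟩ h3)

theorem key2 {G : Type*} [Group G] [Finite G] {q : ℕ} (hq : q.Prime)
    (hqG : q ∣ Nat.card G) (Q : Sylow q G) [hQ : (Q : Subgroup G).Normal]
    (h : IsCyclic (Q : Subgroup G) ∨ ∀ M : Subgroup G, M ⋖ (Q : Subgroup G) →
      ∃ T : Subgroup G, T.Normal ∧ M ⊔ T = ⊤ ∧ (M ⊓ T).Normal) :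
    ∃ x : G, orderOf x = q ∧ (zpowers x).Normal := by
  have := Fact.mk hq
  have hqQ : q ∣ Nat.card Q := Q.dvd_card_of_dvd_card hqG
  rcases h with hc | hc
  · obtain ⟨x, hx⟩ := exists_prime_orderOf_dvd_card' (G := Q) q hqQ
    refine ⟨x, by rw [orderOf_coe, hx], ?_⟩
    refine ⟨?_⟩
    intro m hm g
    obtain ⟨k, hk⟩ := MonoidHom.map_cyclic (MulAut.conjNormal (H := (Q : Subgroup G)) g).toMonoidHom
    obtain ⟨j, rfl⟩ := hm
    have h1 := congrArg Subtype.val (hk (x ^ j))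
    have h2 : g * (x : G) ^ j * g⁻¹ = ((x : G) ^ j) ^ k := by simpa using h1
    show g * (x : G) ^ j * g⁻¹ ∈ _
    rw [h2, ← zpow_mul]
    exact zpow_mem (mem_zpowers _) _
  -- the noncyclic case
  let R := Op q G
  let S := R ⊓ (Q : Subgroup G)
  have hL : ∀ M : Subgroup G, M ⋖ (Q : Subgroup G) → ∃ X : Subgroup G,
      (∀ g, g ^ (q - 1) ∈ X) ∧ (∀ g h : G, g * h * g⁻¹ * h⁻¹ ∈ X) ∧
      ∀ x ∈ X, ∀ s ∈ S, s⁻¹ * x * s * x⁻¹ ∈ M := by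
    intro M hM
    obtain ⟨T, hT, hsup, hn⟩ := hc M hM
    have hRT : R ≤ T := Op_le_of_quot hq (isPGroup_quot (Q.2.to_le hM.le) hsup)
    have hSn : S.Normal := inferInstanceAs (Op q G ⊓ (Q : Subgroup G)).Normal
    have hMS : M ⊓ S = (M ⊓ T) ⊓ R := by
      apply le_antisymm
      · exact le_inf (le_inf inf_le_left (inf_le_right.trans (inf_le_left.trans hRT)))
          (inf_le_right.trans inf_le_left)
      · exact le_inf (inf_le_left.trans inf_le_left)
          (le_inf inf_le_right ((inf_le_left.trans inf_le_left).trans hM.le))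
    have hRn : R.Normal := inferInstanceAs (Op q G).Normal
    have hLn : (M ⊓ S).Normal := by
      rw [hMS]
      infer_instance
    have hrel : (M ⊓ S).relIndex S = 1 ∨ (M ⊓ S).relIndex S = q := by
      rw [inf_relIndex_right, ← rel_sup]
      rcases hM.eq_or_eq (le_sup_left : M ≤ M ⊔ S) (sup_le hM.le inf_le_right) with h1 | h1
      · left
        rw [h1, relIndex_self]
      · right
        rw [h1, card_max hq Q.2 hM]
    obtain ⟨X, h1, h2, h3⟩ := small_factor hq (M ⊓ S) S hrel
    exact ⟨X, h1, h2, fun x hx s hs => (h3 x hx s hs).1⟩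
  choose X hX1 hX2 hX3 using hL
  -- the elementary abelian part of the center
  let V : Subgroup G :=
    { carrier := {z | z ∈ (Q : Subgroup G) ∧ (∀ y ∈ (Q : Subgroup G), y * z = z * y) ∧ z ^ q = 1}
      one_mem' := ⟨one_mem _, by simp, one_pow _⟩
      mul_mem' := by
        rintro a b ⟨ha, ha1, ha2⟩ ⟨hb, hb1, hb2⟩
        refine ⟨mul_mem ha hb, ?_, ?_⟩
        · intro y hy
          rw [← mul_assoc, ha1 y hy, mul_assoc, hb1 y hy, mul_assoc]
        · rw [(show Commute a b from hb1 a ha).mul_pow, ha2, hb2, one_mul]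
      inv_mem' := by
        rintro a ⟨ha, ha1, ha2⟩
        refine ⟨inv_mem ha, ?_, ?_⟩
        · intro y hy
          exact ((show Commute y a from ha1 y hy).inv_right).eq
        · rw [inv_pow, ha2, inv_one] }
  have hVn : V.Normal := by
    refine ⟨?_⟩
    rintro z ⟨hz, hz1, hz2⟩ g
    refine ⟨hQ.conj_mem z hz g, ?_, ?_⟩
    · intro y hy
      have h1 := hQ.conj_mem y hy g⁻¹
      have h2 := hz1 _ h1
      rw [inv_inv] at h2
      have h3 := congrArg (fun t => g * t * g⁻¹) h2
      simpa [mul_assoc] using h3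
    · rw [conj_pow, hz2]
      simp
  have hVne : V ≠ ⊥ := by
    have hnt : Nontrivial (Q : Subgroup G) := by
      have h1 : 1 < Nat.card Q := lt_of_lt_of_le hq.one_lt (Nat.le_of_dvd Nat.card_pos hqQ)
      exact Finite.one_lt_card_iff_nontrivial.1 h1
    have hct := Q.2.center_nontrivial
    have hqc : q ∣ Nat.card (center (Q : Subgroup G)) := by
      rcases (Q.2.to_subgroup (center (Q : Subgroup G))).card_eq_or_dvd with h1 | h1
      · exact absurd h1 (Finite.one_lt_card_iff_nontrivial.2 hct).ne'
      · exact h1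
    obtain ⟨z, hz⟩ := exists_prime_orderOf_dvd_card' (G := center (Q : Subgroup G)) q hqc
    intro hb
    have hzV : ((z : (Q : Subgroup G)) : G) ∈ V := by
      refine ⟨z.1.2, ?_, ?_⟩
      · intro y hy
        exact congrArg Subtype.val (mem_center_iff.1 z.2 ⟨y, hy⟩)
      · have := pow_orderOf_eq_one z
        rw [hz] at this
        simpa using congrArg (fun t => ((t : (Q : Subgroup G)) : G)) (congrArg Subtype.val this)
    rw [hb, mem_bot] at hzV
    have : z = 1 := Subtype.ext (Subtype.ext hzV)
    rw [this, orderOf_one] at hz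
    exact hq.ne_one hz.symm
  obtain ⟨N, hNn, hNne, hNV, hNmin⟩ := exists_min V hVn hVne
  let φ : G →* MulAut N := MulAut.conjNormal
  have hφQ : ∀ y ∈ (Q : Subgroup G), φ y = 1 := by
    intro y hy
    ext n
    show y * (n : G) * y⁻¹ = n
    rw [(hNV n.2).2.1 y hy, mul_inv_cancel_right]
  have hφc : ∀ x : G, (∀ v ∈ (Q : Subgroup G), x * v = v * x) → φ x = 1 := by
    intro x hx
    ext n
    show x * (n : G) * x⁻¹ = n
    rw [hx _ (hNV n.2).1, mul_inv_cancel_right]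
  have hφX : ∀ x ∈ R, (∀ M hM, x ∈ X M hM) → φ x = 1 := by
    intro x hxR hxX
    by_contra hne
    rw [← orderOf_eq_one_iff] at hne
    obtain ⟨r, hr, hrd⟩ := Nat.exists_prime_and_dvd hne
    obtain ⟨a, m, hm, he⟩ := Nat.exists_eq_pow_mul_and_not_dvd (orderOf_pos x).ne' r hr.ne_one
    apply hm
    refine hrd.trans (orderOf_dvd_of_pow_eq_one ?_)
    rw [← map_pow]
    have hxm : (x ^ m) ^ r ^ a = 1 := by
      rw [← pow_mul, mul_comm, ← he, pow_orderOf_eq_one]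
    by_cases hrq : r = q
    · subst hrq
      apply hφQ
      rw [← QuotientGroup.eq_one_iff]
      refine eq1 hr (k := a) (n := (Q : Subgroup G).index) ?_ ?_ Q.not_dvd_index
      · rw [← QuotientGroup.mk_pow, hxm, QuotientGroup.mk_one]
      · exact pow_card_eq_one'
    · apply hφc
      have hRn : R.Normal := inferInstanceAs (Op q G).Normal
      exact key2_cent hq hr hrq Q R Q.2 hxm (pow_mem hxR m)
        (fun M hM s hs => hX3 M hM _ (pow_mem (hxX M hM) m) s hs)
  have hRn : R.Normal := inferInstanceAs (Op q G).Normal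
  have htop : R ⊔ (Q : Subgroup G) = ⊤ := by
    rw [← index_eq_one]
    obtain ⟨k, hk⟩ := IsPGroup.iff_card.1 (isPGroup_Op hq G)
    have h1 : (R ⊔ (Q : Subgroup G)).index ∣ q ^ k := by
      rw [← hk]
      exact index_dvd_of_le le_sup_left
    have h2 : (R ⊔ (Q : Subgroup G)).index ∣ (Q : Subgroup G).index := index_dvd_of_le le_sup_right
    refine Nat.eq_one_of_dvd_coprimes (Nat.Coprime.pow_left k ?_) h1 h2
    exact (Nat.Prime.coprime_iff_not_dvd hq).2 Q.not_dvd_index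
  have hred : ∀ g : G, ∃ h ∈ R, φ g = φ h := by
    intro g
    have hg : g ∈ R ⊔ (Q : Subgroup G) := htop ▸ mem_top g
    obtain ⟨a, ha, b, hb, rfl⟩ := mem_sup_of_normal_right.1 hg
    refine ⟨a, ha, ?_⟩
    rw [map_mul, hφQ b hb, mul_one]
  have hZ := zpowers_normal hq N hNne (fun a ha b hb => (hNV hb).2.1 a (hNV ha).1)
    (fun a ha => (hNV ha).2.2) hNmin
    (by
      intro g
      show φ g ^ (q - 1) = 1
      obtain ⟨a, ha, he⟩ := hred g
      rw [he, ← map_pow]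
      exact hφX _ (pow_mem ha _) (fun M hM => hX1 M hM a))
    (by
      intro g h
      show φ g * φ h = φ h * φ g
      obtain ⟨a, ha, he⟩ := hred g
      obtain ⟨b, hb, he'⟩ := hred h
      rw [he, he']
      have h1 := hφX (a * b * a⁻¹ * b⁻¹)
        (mul_mem (mul_mem (mul_mem ha hb) (inv_mem ha)) (inv_mem hb)) (fun M hM => hX2 M hM a b)
      rw [map_mul, map_mul, map_mul, map_inv, map_inv, mul_inv_eq_one, mul_inv_eq_iff_eq_mul] at h1
      exact h1)
  obtain ⟨⟨n, hn⟩, hne1⟩ := N.ne_bot_iff_exists_ne_one.1 hNne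
  have hn1 : n ≠ 1 := fun h => hne1 (Subtype.ext h)
  exact ⟨n, orderOf_eq_prime (hNV hn).2.2 hn1, hZ n hn⟩

theorem main.{u} (n : ℕ) : ∀ (G : Type u) [Group G] [Finite G],
    Nat.card G = n → Hyp G → IsSupersolvable G := by
  induction n using Nat.strong_induction_on with
  | _ n ih =>
  intro G _ _ hcard h
  by_cases h1 : Nat.card G = 1
  · have := (Nat.card_eq_one_iff_unique.1 h1).1
    exact ⟨0, fun _ => ⊥, rfl, Subsingleton.elim _ _, fun _ => le_rfl, fun _ => inferInstance,
      fun _ => ⟨1, one_mem _, Subsingleton.elim _ _⟩⟩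
  obtain ⟨q, hq, hqG, Q, hQ⟩ := exists_normal_sylow _ G rfl h1 h
  obtain ⟨x, hx, hxn⟩ := key2 hq hqG Q (h q hq Q)
  have hcx : Nat.card (zpowers x) = q := by rw [Nat.card_zpowers, hx]
  refine supersolvable_of_quot (zpowers x) ⟨x, rfl⟩ ?_
  refine ih _ ?_ (G ⧸ zpowers x) rfl (h.quot hq _ ?_)
  · have h2 := card_eq_card_quotient_mul_card_subgroup (zpowers x)
    rw [hcx] at h2
    have h3 : 0 < Nat.card (G ⧸ zpowers x) := Nat.card_pos
    have h4 := hq.two_le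
    rw [← hcard, h2]
    nlinarith
  · have := Fact.mk hq
    exact IsPGroup.of_card (n := 1) (by rw [hcx, pow_one])

lemma hyp_of {G : Type*} [Group G] [Finite G]
    (h : ∀ p : ℕ, p.Prime → p ∣ Nat.card G → ∀ P : Sylow p G,
      ¬ IsCyclic (P : Subgroup G) →
      ∀ M : Subgroup G, IsMaximalSubgroupOf M (P : Subgroup G) → M.IsCNormal) : Hyp G := by
  intro q hq Q
  by_cases hc : IsCyclic (Q : Subgroup G)
  · exact Or.inl hc
  right
  intro M hM
  have := Fact.mk hq
  have hqG : q ∣ Nat.card G := by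
    rcases Q.2.card_eq_or_dvd with h1 | h1
    · exfalso
      apply hc
      have := (Nat.card_eq_one_iff_unique.1 h1).1
      infer_instance
    · exact h1.trans (card_subgroup_dvd_card _)
  obtain ⟨T, hT, hMT, hcore⟩ := h q hq hqG Q hc M
    ⟨hM.lt, fun K h1 h2 => (hM.eq_or_eq h1.le h2).resolve_left h1.ne'⟩
  refine ⟨T, hT, ?_, ?_⟩
  · rw [← SetLike.coe_set_eq, mul_normal, hMT, coe_top]
  · have : M ⊓ T = M.normalCore ⊓ T :=
      le_antisymm (le_inf hcore inf_le_right) (inf_le_inf_right _ M.normalCore_le)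
    rw [this]
    infer_instance

end CN

theorem stmt13 {G : Type*} [Group G] [Fintype G]
    (h : ∀ p : ℕ, p.Prime → p ∣ Nat.card G → ∀ P : Sylow p G,
      ¬ IsCyclic (P : Subgroup G) →
      ∀ M : Subgroup G, IsMaximalSubgroupOf M (P : Subgroup G) → M.IsCNormal) :
    IsSupersolvable G := by
  exact CN.main _ G rfl (CN.hyp_of h)
end
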